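/- arXiv:2309.15615 — 2 statements merged into one kernel-verified Lean document; each statement's English description precedes it below -/
import Mathlib

section
/- (Euclidean case of Theorem 1.3, Sobolev regularity of the inverse.) Let Ω ⊆ ℝ² be open and let f : Ω → ℝ² be continuous and injective, lying in W^{1,2}_loc(Ω,ℝ²) with weak derivative Df. Suppose there is a measurable function K : Ω → ℝ with K(x) ≥ 1 for all x, with K integrable on compact subsets of Ω, and such that ‖Df(x)‖ ≤ K(x) · l(Df(x)) for almost every x ∈ Ω. Then f(Ω) is open, f is a homeomorphism of Ω onto f(Ω), and the inverse map f⁻¹ : f(Ω) → ℝ² lies in W^{1,2}_loc(f(Ω),ℝ²), i.e., f⁻¹ has a weak derivative whose operator norm is locally square-integrable on f(Ω). -/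
open MeasureTheory Set
open scoped ENNReal Real Topology

noncomputable section

/-- The plane `ℝ²` as a Euclidean space. -/
abbrev E2 : Type := EuclideanSpace ℝ (Fin 2)

/-- `f` lies in `W^{1,2}_loc(Ω, ℝ²)` with weak derivative `Df`. -/
def MemW12loc (Ω : Set E2) (f : E2 → E2) (Df : E2 → E2 →L[ℝ] E2) : Prop :=
  LocallyIntegrableOn f Ω ∧
  Measurable Df ∧
  (∀ A : Set E2, A ⊆ Ω → IsCompact A →
    ∫⁻ x in A, ENNReal.ofReal (‖Df x‖ ^ 2) < ⊤) ∧
  (∀ φ : E2 → ℝ, ContDiff ℝ (⊤ : ℕ∞) φ → HasCompactSupport φ → tsupport φ ⊆ Ω →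
    ∀ i : Fin 2,
      (∫ x in Ω, (fderiv ℝ φ x (EuclideanSpace.single i 1)) • f x) =
        - ∫ x in Ω, φ x • Df x (EuclideanSpace.single i 1))

/-- The minimal stretch `l(T) = min { ‖T v‖ : ‖v‖ = 1 }` of a linear map `T : ℝ² → ℝ²`. -/
def lstretch (T : E2 →L[ℝ] E2) : ℝ :=
  sInf ((fun v => ‖T v‖) '' {v : E2 | ‖v‖ = 1})

/-! ### Linear algebra in the plane -/

/-- Standard basis vectors. -/
abbrev ee (i : Fin 2) : E2 := EuclideanSpace.single i (1 : ℝ)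

/-- Jacobian determinant. -/
def jdet (T : E2 →L[ℝ] E2) : ℝ := T (ee 0) 0 * T (ee 1) 1 - T (ee 1) 0 * T (ee 0) 1

/-- Adjugate. -/
def adj (T : E2 →L[ℝ] E2) : E2 →L[ℝ] E2 :=
  (T (ee 0) 0 + T (ee 1) 1) • ContinuousLinearMap.id ℝ E2 - T

lemma decomp2 (v : E2) : v = v 0 • ee 0 + v 1 • ee 1 := by
  ext i; fin_cases i <;> simp

lemma clm_apply2 (T : E2 →L[ℝ] E2) (v : E2) (j : Fin 2) :
    T v j = v 0 * T (ee 0) j + v 1 * T (ee 1) j := by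
  conv_lhs => rw [decomp2 v]
  simp

lemma clm_applyR (T : E2 →L[ℝ] ℝ) (v : E2) :
    T v = v 0 * T (ee 0) + v 1 * T (ee 1) := by
  conv_lhs => rw [decomp2 v]
  simp

lemma clm_ext2 {S T : E2 →L[ℝ] E2} (h : ∀ i, S (ee i) = T (ee i)) : S = T := by
  ext v j
  rw [clm_apply2 S, clm_apply2 T, h 0, h 1]

lemma adj_apply (T : E2 →L[ℝ] E2) (v : E2) (j : Fin 2) :
    adj T v j = (T (ee 0) 0 + T (ee 1) 1) * v j - T v j := by
  simp [adj]

lemma apply_adj (T : E2 →L[ℝ] E2) (v : E2) : T (adj T v) = jdet T • v := by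
  ext j
  rw [clm_apply2, adj_apply, adj_apply, clm_apply2 T v 0, clm_apply2 T v 1]
  fin_cases j <;> simp [jdet] <;> ring

lemma adj_adj (T : E2 →L[ℝ] E2) : adj (adj T) = T := by
  refine clm_ext2 fun i => ?_
  ext j
  simp only [adj_apply]
  fin_cases i <;> fin_cases j <;> simp

lemma ee_norm (i : Fin 2) : ‖ee i‖ = 1 := by simp [ee]

lemma coord_le (v : E2) (j : Fin 2) : |v j| ≤ ‖v‖ := by
  simpa using PiLp.norm_apply_le v j

lemma entry_le (T : E2 →L[ℝ] E2) (i j : Fin 2) : |T (ee i) j| ≤ ‖T‖ :=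
  (coord_le _ _).trans (by simpa [ee_norm] using T.le_opNorm (ee i))

lemma norm_adj_le (T : E2 →L[ℝ] E2) : ‖adj T‖ ≤ 3 * ‖T‖ := by
  unfold adj
  refine (norm_sub_le _ _).trans ?_
  have h1 : ‖(T (ee 0) 0 + T (ee 1) 1) • ContinuousLinearMap.id ℝ E2‖ ≤ (2 * ‖T‖) * 1 := by
    rw [norm_smul]
    gcongr
    · rw [Real.norm_eq_abs]
      have := abs_add_le (T (ee 0) 0) (T (ee 1) 1)
      linarith [entry_le T 0 0, entry_le T 1 1]
    · exact ContinuousLinearMap.norm_id_le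
  linarith

lemma adj_sub (S T : E2 →L[ℝ] E2) : adj (S - T) = adj S - adj T := by
  refine clm_ext2 fun i => ?_
  ext j
  simp only [adj_apply, ContinuousLinearMap.sub_apply, PiLp.sub_apply]; ring

lemma jdet_sub_le (A B : E2 →L[ℝ] E2) :
    |jdet A - jdet B| ≤ 2 * (‖A - B‖ * (‖A‖ + ‖B‖)) := by
  have key : jdet A - jdet B =
      ((A - B) (ee 0) 0 * A (ee 1) 1 + B (ee 0) 0 * (A - B) (ee 1) 1)
      - ((A - B) (ee 1) 0 * A (ee 0) 1 + B (ee 1) 0 * (A - B) (ee 0) 1) := by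
    simp [jdet]; ring
  have m : ∀ (S T : E2 →L[ℝ] E2) (i j k l : Fin 2), |S (ee i) j * T (ee k) l| ≤ ‖S‖ * ‖T‖ := by
    intro S T i j k l
    rw [abs_mul]
    gcongr <;> exact entry_le _ _ _
  rw [key]
  refine (abs_sub _ _).trans ?_
  have h1 := abs_add_le ((A - B) (ee 0) 0 * A (ee 1) 1) (B (ee 0) 0 * (A - B) (ee 1) 1)
  have h2 := abs_add_le ((A - B) (ee 1) 0 * A (ee 0) 1) (B (ee 1) 0 * (A - B) (ee 0) 1)
  have a1 := m (A - B) A 0 0 1 1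
  have a2 := m B (A - B) 0 0 1 1
  have a3 := m (A - B) A 1 0 0 1
  have a4 := m B (A - B) 1 0 0 1
  nlinarith

lemma jdet_zero : jdet 0 = 0 := by simp [jdet]

lemma jdet_le (A : E2 →L[ℝ] E2) : |jdet A| ≤ 2 * ‖A‖ ^ 2 := by
  have := jdet_sub_le A 0
  simp [jdet_zero] at this
  nlinarith

lemma continuous_jdet : Continuous jdet := by
  unfold jdet
  fun_prop

lemma continuous_adj : Continuous adj := by
  unfold adj
  fun_prop

lemma lstretch_le (T : E2 →L[ℝ] E2) (v : E2) : lstretch T * ‖v‖ ≤ ‖T v‖ := by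
  by_cases hv : v = 0
  · simp [hv]
  have hv' : 0 < ‖v‖ := norm_pos_iff.2 hv
  have h : lstretch T ≤ ‖T (‖v‖⁻¹ • v)‖ := by
    refine csInf_le ⟨0, ?_⟩ ⟨‖v‖⁻¹ • v, ?_, rfl⟩
    · rintro _ ⟨w, _, rfl⟩; exact norm_nonneg _
    · simp [norm_smul, hv'.ne']
  rw [map_smul, norm_smul, norm_inv, norm_norm] at h
  calc lstretch T * ‖v‖ ≤ (‖v‖⁻¹ * ‖T v‖) * ‖v‖ := by gcongr
    _ = ‖T v‖ := by field_simp

lemma lstretch_nonneg (T : E2 →L[ℝ] E2) : 0 ≤ lstretch T := by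
  refine Real.sInf_nonneg ?_
  rintro _ ⟨w, _, rfl⟩; exact norm_nonneg _

lemma lstretch_mul_norm_le (T : E2 →L[ℝ] E2) : ‖T‖ * lstretch T ≤ 3 * |jdet T| := by
  rcases (lstretch_nonneg T).eq_or_lt with h | h
  · rw [← h]; simp
  have h1 : ‖adj T‖ ≤ |jdet T| / lstretch T := by
    refine ContinuousLinearMap.opNorm_le_bound _ (by positivity) fun v => ?_
    have := lstretch_le T (adj T v)
    rw [apply_adj, norm_smul, Real.norm_eq_abs] at this
    rw [div_mul_eq_mul_div, le_div_iff₀ h]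
    linarith
  have h2 : ‖T‖ ≤ 3 * ‖adj T‖ := by
    conv_lhs => rw [← adj_adj T]
    exact norm_adj_le _
  rw [le_div_iff₀ h] at h1
  nlinarith

lemma norm_sq_le_of_dist {T : E2 →L[ℝ] E2} {k : ℝ} (hk : 1 ≤ k) (h : ‖T‖ ≤ k * lstretch T) :
    ‖T‖ ^ 2 ≤ 3 * k * |jdet T| := by
  have := lstretch_mul_norm_le T
  have h0 := norm_nonneg T
  calc ‖T‖ ^ 2 = ‖T‖ * ‖T‖ := sq _
    _ ≤ ‖T‖ * (k * lstretch T) := by gcongr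
    _ = k * (‖T‖ * lstretch T) := by ring
    _ ≤ k * (3 * |jdet T|) := by gcongr
    _ = _ := by ring

/-! ### Integration by parts for smooth maps -/

lemma integral_bracket_zero {a b : E2 → ℝ} (ha : ContDiff ℝ 2 a) (hb : ContDiff ℝ 2 b)
    (hac : HasCompactSupport a) :
    ∫ x, (fderiv ℝ a x (ee 0) * fderiv ℝ b x (ee 1) - fderiv ℝ a x (ee 1) * fderiv ℝ b x (ee 0))
      = 0 := by
  have hda : ∀ v, Continuous fun x => fderiv ℝ a x v := fun v =>
    (ha.continuous_fderiv (by norm_num)).clm_apply continuous_const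
  have hdb1 : ∀ v, ContDiff ℝ 1 fun x => fderiv ℝ b x v := fun v =>
    (hb.fderiv_right (m := 1) (by norm_num)).clm_apply contDiff_const
  have hdac : ∀ v, HasCompactSupport fun x => fderiv ℝ a x v := fun v =>
    (hac.fderiv (𝕜 := ℝ)).comp_left (g := fun L : E2 →L[ℝ] ℝ => L v) (by simp)
  have hI : ∀ v w, Integrable (fun x => fderiv ℝ a x v * fderiv ℝ b x w) := fun v w =>
    ((hda v).mul (hdb1 w).continuous).integrable_of_hasCompactSupport ((hdac v).mul_right)
  have hI2 : ∀ v w, Integrable (fun x => a x * fderiv ℝ (fun y => fderiv ℝ b y w) x v) := fun v w =>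
    (ha.continuous.mul (((hdb1 w).continuous_fderiv (by norm_num)).clm_apply
      continuous_const)).integrable_of_hasCompactSupport hac.mul_right
  have hI3 : ∀ w, Integrable (fun x => a x * fderiv ℝ b x w) := fun w =>
    (ha.continuous.mul (hdb1 w).continuous).integrable_of_hasCompactSupport hac.mul_right
  have ibp : ∀ v w, ∫ x, fderiv ℝ a x v * fderiv ℝ b x w =
      - ∫ x, a x * fderiv ℝ (fun y => fderiv ℝ b y w) x v := fun v w => by
    rw [integral_mul_fderiv_eq_neg_fderiv_mul_of_integrable (hI v w) (hI2 v w) (hI3 w)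
      (fun x _ => ha.differentiable (by norm_num) x)
      (fun x _ => (hdb1 w).differentiable (by norm_num) x), neg_neg]
  rw [integral_sub (hI _ _) (hI _ _), ibp, ibp, sub_eq_zero]
  congr 2
  ext x
  have hdd : DifferentiableAt ℝ (fderiv ℝ b) x :=
    (hb.fderiv_right (m := 1) (by norm_num)).differentiable (by norm_num) x
  have hsym := (hb.contDiffAt (x := x)).isSymmSndFDerivAt (by simp)
  rw [fderiv_clm_apply hdd (by fun_prop), fderiv_clm_apply hdd (by fun_prop)]
  simp only [ContinuousLinearMap.add_apply, ContinuousLinearMap.flip_apply]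
  simp
  left
  exact hsym _ _

lemma smooth_ibp {F : E2 → E2} {φ χ : E2 → ℝ} (hF : ContDiff ℝ 2 F) (hφ : ContDiff ℝ 2 φ)
    (hχ : ContDiff ℝ 2 χ) (hχc : HasCompactSupport χ) (i : Fin 2) :
    ∫ x, χ x * fderiv ℝ φ (F x) (ee i) * jdet (fderiv ℝ F x) =
      - ∫ x, φ (F x) * fderiv ℝ χ x (adj (fderiv ℝ F x) (ee i)) := by
  have hφF : ContDiff ℝ 2 (fun x => φ (F x)) := hφ.comp hF
  have ha : ContDiff ℝ 2 (fun x => χ x * φ (F x)) := hχ.mul hφF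
  have hac : HasCompactSupport (fun x => χ x * φ (F x)) := hχc.mul_right
  have hFk : ∀ k : Fin 2, ContDiff ℝ 2 (fun x => F x k) := fun k =>
    (EuclideanSpace.proj (𝕜 := ℝ) k).contDiff.comp hF
  have dFk : ∀ (k : Fin 2) x v, fderiv ℝ (fun x => F x k) x v = fderiv ℝ F x v k := by
    intro k x v
    have h := ((EuclideanSpace.proj (𝕜 := ℝ) k : E2 →L[ℝ] ℝ).hasFDerivAt.comp x
      (hF.differentiable (by norm_num) x).hasFDerivAt).fderiv
    have : (fun x => F x k) = (EuclideanSpace.proj (𝕜 := ℝ) k : E2 →L[ℝ] ℝ) ∘ F := rfl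
    rw [this, h]; rfl
  have da : ∀ x v, fderiv ℝ (fun x => χ x * φ (F x)) x v =
      χ x * fderiv ℝ φ (F x) (fderiv ℝ F x v) + φ (F x) * fderiv ℝ χ x v := by
    intro x v
    have h1 : HasFDerivAt (fun x => φ (F x)) ((fderiv ℝ φ (F x)).comp (fderiv ℝ F x)) x :=
      (hφ.differentiable (by norm_num) (F x)).hasFDerivAt.comp x
        (hF.differentiable (by norm_num) x).hasFDerivAt
    have h2 := ((hχ.differentiable (by norm_num) x).hasFDerivAt.mul h1).fderiv
    have : (fun x => χ x * φ (F x)) = χ * (fun x => φ (F x)) := rfl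
    rw [this, h2]; simp
  have hdχ : Continuous (fderiv ℝ χ) := hχ.continuous_fderiv (by norm_num)
  have hdφ : Continuous (fderiv ℝ φ) := hφ.continuous_fderiv (by norm_num)
  have hdF : Continuous (fderiv ℝ F) := hF.continuous_fderiv (by norm_num)
  have hI1 : Integrable fun x => χ x * fderiv ℝ φ (F x) (ee i) * jdet (fderiv ℝ F x) := by
    refine Continuous.integrable_of_hasCompactSupport ?_ (hχc.mul_right.mul_right)
    exact (hχ.continuous.mul ((hdφ.comp hF.continuous).clm_apply continuous_const)).mul
      (continuous_jdet.comp hdF)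
  have hI2 : Integrable fun x => φ (F x) * fderiv ℝ χ x (adj (fderiv ℝ F x) (ee i)) := by
    refine Continuous.integrable_of_hasCompactSupport ?_ ?_
    · exact hφF.continuous.mul (hdχ.clm_apply ((continuous_adj.comp hdF).clm_apply
        continuous_const))
    · refine HasCompactSupport.mul_left ?_
      refine (hχc.fderiv (𝕜 := ℝ)).mono ?_
      intro x hx h0
      exact hx (by simp [h0])
  rw [← sub_eq_zero, sub_neg_eq_add, ← integral_add hI1 hI2]
  have hz := integral_bracket_zero ha (hFk (1 - i)) hac
  have hpt : ∀ x, χ x * fderiv ℝ φ (F x) (ee i) * jdet (fderiv ℝ F x) +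
      φ (F x) * fderiv ℝ χ x (adj (fderiv ℝ F x) (ee i)) =
      (if i = 0 then 1 else -1) * (fderiv ℝ (fun x => χ x * φ (F x)) x (ee 0)
        * fderiv ℝ (fun x => F x (1 - i)) x (ee 1)
      - fderiv ℝ (fun x => χ x * φ (F x)) x (ee 1) * fderiv ℝ (fun x => F x (1 - i)) x (ee 0)) := by
    intro x
    rw [da, da, dFk, dFk, clm_applyR (fderiv ℝ φ (F x)) (fderiv ℝ F x (ee 0)),
      clm_applyR (fderiv ℝ φ (F x)) (fderiv ℝ F x (ee 1)),
      clm_applyR (fderiv ℝ χ x) (adj _ _), adj_apply, adj_apply]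
    fin_cases i <;> simp [jdet] <;> ring
  simp_rw [hpt]
  rw [integral_const_mul, hz, mul_zero]

/-! ### Mollification in `L²` -/

/-- The standard sequence of mollifying bumps. -/
def mol (n : ℕ) : ContDiffBump (0 : E2) where
  rIn := 1 / (2 * (n + 1))
  rOut := 1 / (n + 1)
  rIn_pos := by positivity
  rIn_lt_rOut := by
    rw [div_lt_div_iff₀ (by positivity) (by positivity)]
    have : (0 : ℝ) ≤ n := Nat.cast_nonneg n
    nlinarith

/-- Normalised mollifier. -/
def rho (n : ℕ) : E2 → ℝ := (mol n).normed volume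

lemma mol_rOut_tendsto : Filter.Tendsto (fun n => (mol n).rOut) Filter.atTop (𝓝 0) :=
  tendsto_one_div_add_atTop_nhds_zero_nat

lemma rho_contDiff (n : ℕ) {k : ℕ∞} : ContDiff ℝ k (rho n) := (mol n).contDiff_normed
lemma rho_cont (n : ℕ) : Continuous (rho n) := (mol n).continuous_normed
lemma rho_compact (n : ℕ) : HasCompactSupport (rho n) := (mol n).hasCompactSupport_normed
lemma rho_nonneg (n : ℕ) (x : E2) : 0 ≤ rho n x := (mol n).nonneg_normed x
lemma rho_integral (n : ℕ) : ∫ x, rho n x = 1 := (mol n).integral_normed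
lemma rho_integrable (n : ℕ) : Integrable (rho n) :=
  (rho_cont n).integrable_of_hasCompactSupport (rho_compact n)
lemma rho_tsupport (n : ℕ) : tsupport (rho n) = Metric.closedBall 0 (mol n).rOut :=
  (mol n).tsupport_normed_eq
lemma rho_eq_zero {n : ℕ} {x : E2} (h : (mol n).rOut ≤ ‖x‖) : rho n x = 0 := by
  have : x ∉ Function.support (rho n) := by
    unfold rho
    rw [(mol n).support_normed_eq]; simpa using h
  simpa using this

lemma lintegral_rho (n : ℕ) : ∫⁻ x, ENNReal.ofReal (rho n x) = 1 := by
  rw [← ofReal_integral_eq_lintegral_ofReal (rho_integrable n) (.of_forall (rho_nonneg n)),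
    rho_integral]; simp

/-- Mollification. -/
def mollify {G : Type*} [NormedAddCommGroup G] [NormedSpace ℝ G] (n : ℕ) (h : E2 → G) : E2 → G :=
  fun x => ∫ t, rho n t • h (x - t)

lemma translation_tendsto {G : Type*} [NormedAddCommGroup G] [NormedSpace ℝ G]
    {h : E2 → G} (h2 : MemLp h 2) :
    Filter.Tendsto (fun t => ∫⁻ x, ‖h (x - t) - h x‖ₑ ^ 2) (𝓝 0) (𝓝 0) := by
  let g : E2 → C(E2, E2) := fun t => ⟨fun x => x - t, by fun_prop⟩
  have hg : Continuous g := by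
    refine ContinuousMap.continuous_of_continuous_uncurry _ ?_
    simp only [Function.uncurry_def, g, ContinuousMap.coe_mk]
    fun_prop
  have hgm : ∀ t, MeasurePreserving (g t) volume volume := fun t =>
    measurePreserving_sub_right volume t
  have hc := (continuous_const (y := h2.toLp h)).compMeasurePreservingLp hg hgm (by norm_num)
  have h0 := (hc.tendsto 0)
  have hg0 : Lp.compMeasurePreserving (g 0) (hgm 0) (h2.toLp h) = h2.toLp h := by
    apply Lp.ext
    refine (Lp.coeFn_compMeasurePreserving _ _).trans ?_
    have : ((h2.toLp h : E2 → G) ∘ (g 0)) = (h2.toLp h) := by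
      ext x; simp [g]
    rw [this]
  rw [hg0, Lp.tendsto_Lp_iff_tendsto_eLpNorm'] at h0
  have h1 : ∀ t, eLpNorm (((Lp.compMeasurePreserving (g t) (hgm t) (h2.toLp h) : Lp G 2 volume)
      : E2 → G) - (h2.toLp h : E2 → G)) 2 volume ^ 2 = ∫⁻ x, ‖h (x - t) - h x‖ₑ ^ 2 := by
    intro t
    have : (((Lp.compMeasurePreserving (g t) (hgm t) (h2.toLp h) : Lp G 2 volume)
      : E2 → G) - (h2.toLp h : E2 → G)) =ᵐ[volume] fun x => h (x - t) - h x := by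
      have e1 := (Lp.toLp_compMeasurePreserving h2 (hgm t))
      have e2 : (Lp.compMeasurePreserving (g t) (hgm t) (h2.toLp h) : E2 → G) =ᵐ[volume]
          h ∘ (g t) := by
        rw [e1]; exact MemLp.coeFn_toLp _
      filter_upwards [e2, h2.coeFn_toLp] with x hx1 hx2
      rw [Pi.sub_apply, hx1, hx2]; rfl
    rw [eLpNorm_congr_ae this, eLpNorm_eq_lintegral_rpow_enorm_toReal (by norm_num) (by norm_num)]
    simp only [ENNReal.toReal_ofNat, ENNReal.rpow_ofNat]
    rw [← ENNReal.rpow_natCast, ← ENNReal.rpow_mul]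
    norm_num
  have h3 := ENNReal.Tendsto.pow (n := 2) h0
  simp only [h1] at h3
  simpa using h3

lemma jensen_sq {r : E2 → ℝ≥0∞} (hr : Measurable r) (hr1 : ∫⁻ t, r t = 1)
    {g : E2 → ℝ≥0∞} (hg : Measurable g) : (∫⁻ t, r t * g t) ^ 2 ≤ ∫⁻ t, r t * g t ^ 2 := by
  set P := (volume : Measure E2).withDensity r
  have hP : P univ = 1 := by simp [P, hr1]
  have e : ∀ u : E2 → ℝ≥0∞, Measurable u → ∫⁻ t, r t * u t = ∫⁻ t, u t ∂P := fun u hu => by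
    simp only [P]
    rw [lintegral_withDensity_eq_lintegral_mul _ hr hu]; rfl
  rw [e g hg, e _ (hg.pow_const 2)]
  have := ENNReal.lintegral_mul_le_Lp_mul_Lq P (p := 2) (q := 2) (by constructor <;> norm_num)
    hg.aemeasurable (measurable_const (a := (1 : ℝ≥0∞))).aemeasurable
  simp [hP] at this
  calc (∫⁻ t, g t ∂P) ^ 2 ≤ ((∫⁻ t, g t ^ 2 ∂P) ^ (2⁻¹ : ℝ)) ^ 2 := by gcongr
    _ = _ := by rw [← ENNReal.rpow_natCast, ← ENNReal.rpow_mul]; norm_num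

lemma mollify_sub_le {G : Type*} [NormedAddCommGroup G] [NormedSpace ℝ G] [CompleteSpace G]
    {h : E2 → G} (hm : StronglyMeasurable h) (hl : LocallyIntegrable h) (n : ℕ) (x : E2) :
    ‖mollify n h x - h x‖ₑ ^ 2 ≤ ∫⁻ t, ENNReal.ofReal (rho n t) * ‖h (x - t) - h x‖ₑ ^ 2 := by
  have hI1 : Integrable fun t => rho n t • h (x - t) :=
    (rho_compact n).convolutionExists_left (ContinuousLinearMap.lsmul ℝ ℝ) (rho_cont n) hl x
  have hI2 : Integrable fun t => rho n t • h x := (rho_integrable n).smul_const _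
  have e1 : mollify n h x - h x = ∫ t, rho n t • (h (x - t) - h x) := by
    simp_rw [smul_sub]
    rw [integral_sub hI1 hI2, integral_smul_const, rho_integral, one_smul]; rfl
  have hms : Measurable fun t => ‖h (x - t) - h x‖ₑ :=
    ((hm.comp_measurable (measurable_const.sub measurable_id)).sub
      stronglyMeasurable_const).enorm
  rw [e1]
  refine le_trans ?_ (jensen_sq (rho_cont n).measurable.ennreal_ofReal (lintegral_rho n) hms)
  gcongr
  refine (enorm_integral_le_lintegral_enorm _).trans_eq ?_
  congr 1; ext t
  rw [enorm_smul, Real.enorm_eq_ofReal (rho_nonneg n t)]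

lemma mollify_tendsto {G : Type*} [NormedAddCommGroup G] [NormedSpace ℝ G] [CompleteSpace G]
    {h : E2 → G} (hm : StronglyMeasurable h) (h2 : MemLp h 2) :
    Filter.Tendsto (fun n => ∫⁻ x, ‖mollify n h x - h x‖ₑ ^ 2) Filter.atTop (𝓝 0) := by
  have hl : LocallyIntegrable h := h2.locallyIntegrable (by norm_num)
  rw [ENNReal.tendsto_nhds_zero]
  intro δ hδ
  have ht := (ENNReal.tendsto_nhds_zero.1 (translation_tendsto h2)) δ hδ
  obtain ⟨s, hs, hs'⟩ := Metric.eventually_nhds_iff.1 ht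
  filter_upwards [mol_rOut_tendsto.eventually (gt_mem_nhds hs)] with n hn
  calc ∫⁻ x, ‖mollify n h x - h x‖ₑ ^ 2
      ≤ ∫⁻ x, ∫⁻ t, ENNReal.ofReal (rho n t) * ‖h (x - t) - h x‖ₑ ^ 2 :=
        lintegral_mono fun x => mollify_sub_le hm hl n x
    _ = ∫⁻ t, ∫⁻ x, ENNReal.ofReal (rho n t) * ‖h (x - t) - h x‖ₑ ^ 2 := by
        refine lintegral_lintegral_swap ?_
        refine Measurable.aemeasurable ?_
        refine Measurable.mul ((rho_cont n).measurable.comp measurable_snd).ennreal_ofReal ?_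
        refine Measurable.pow_const ?_ 2
        exact ((hm.comp_measurable (measurable_fst.sub measurable_snd)).sub
          (hm.comp_measurable measurable_fst)).enorm
    _ = ∫⁻ t, ENNReal.ofReal (rho n t) * ∫⁻ x, ‖h (x - t) - h x‖ₑ ^ 2 := by
        congr 1; ext t
        rw [lintegral_const_mul' _ _ ENNReal.ofReal_ne_top]
    _ ≤ ∫⁻ t, ENNReal.ofReal (rho n t) * δ := by
        refine lintegral_mono fun t => ?_
        by_cases h' : ‖t‖ < s
        · gcongr
          exact hs' (by simpa using h')
        · rw [rho_eq_zero (by linarith)]; simp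
    _ = δ := by
        rw [lintegral_mul_const _ (rho_cont n).measurable.ennreal_ofReal, lintegral_rho, one_mul]

/-! ### Mollification of a Sobolev map -/

lemma mollify_eq_conv {G : Type*} [NormedAddCommGroup G] [NormedSpace ℝ G] (n : ℕ) (h : E2 → G) :
    mollify n h = convolution (rho n) h (ContinuousLinearMap.lsmul ℝ ℝ) volume := rfl

lemma mollify_continuous {G : Type*} [NormedAddCommGroup G] [NormedSpace ℝ G] [CompleteSpace G]
    (n : ℕ) {h : E2 → G} (hl : LocallyIntegrable h) : Continuous (mollify n h) := by
  rw [mollify_eq_conv]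
  exact (rho_compact n).continuous_convolution_left _ (rho_cont n) hl

lemma mollify_contDiff {G : Type*} [NormedAddCommGroup G] [NormedSpace ℝ G] [CompleteSpace G]
    (n : ℕ) {h : E2 → G} (hl : LocallyIntegrable h) {k : ℕ∞} : ContDiff ℝ k (mollify n h) := by
  rw [mollify_eq_conv]
  exact (rho_compact n).contDiff_convolution_left _ (rho_contDiff n) hl

lemma mollify_eq_swap {G : Type*} [NormedAddCommGroup G] [NormedSpace ℝ G] (n : ℕ) (h : E2 → G)
    (x : E2) : mollify n h x = ∫ s, rho n (x - s) • h s := by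
  unfold mollify
  rw [← integral_sub_left_eq_self (fun s => rho n (x - s) • h s) volume x]
  simp

lemma mollify_tendsto_pt {G : Type*} [NormedAddCommGroup G] [NormedSpace ℝ G] [CompleteSpace G]
    {h : E2 → G} (hm : AEStronglyMeasurable h) {x : E2} (hc : ContinuousAt h x) :
    Filter.Tendsto (fun n => mollify n h x) Filter.atTop (𝓝 (h x)) := by
  simp_rw [mollify_eq_conv]
  refine ContDiffBump.convolution_tendsto_right (φ := mol) (g := fun _ => h) (k := fun _ => x)
    mol_rOut_tendsto (.of_forall fun _ => hm) ?_ tendsto_const_nhds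
  exact hc.tendsto.comp Filter.tendsto_snd

lemma mollify_hasFDerivAt {h : E2 → E2} (hl : LocallyIntegrable h) (n : ℕ) (x : E2) (v : E2) :
    fderiv ℝ (mollify n h) x v = ∫ t, fderiv ℝ (rho n) t v • h (x - t) := by
  have hd := (rho_compact n).hasFDerivAt_convolution_left (ContinuousLinearMap.lsmul ℝ ℝ)
    (μ := volume) (rho_contDiff n (k := 1)) hl x
  rw [mollify_eq_conv, hd.fderiv]
  have hE : Integrable fun t => (ContinuousLinearMap.lsmul ℝ ℝ).precompL E2
      (fderiv ℝ (rho n) t) (h (x - t)) := by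
    have h1 : HasCompactSupport (fderiv ℝ (rho n)) := (rho_compact n).fderiv (𝕜 := ℝ)
    have h2 : Continuous (fderiv ℝ (rho n)) :=
      (rho_contDiff n (k := 1)).continuous_fderiv (by norm_num)
    have h3 := (h1.convolutionExists_left (μ := volume)
      ((ContinuousLinearMap.lsmul ℝ ℝ).precompL E2) h2 hl x)
    exact h3.integrable
  rw [convolution_def, ContinuousLinearMap.integral_apply hE]
  refine integral_congr_ae (.of_forall fun t => ?_)
  simp only [ContinuousLinearMap.precompL_apply, ContinuousLinearMap.lsmul_apply]

lemma mollify_apply {h : E2 → E2 →L[ℝ] E2} (hl : LocallyIntegrable h) (n : ℕ) (x : E2) (v : E2) :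
    mollify n h x v = ∫ s, rho n (x - s) • h s v := by
  rw [mollify_eq_swap]
  have hE2 : Integrable fun s => rho n (x - s) • h s := by
    have := ((rho_compact n).convolutionExists_left (ContinuousLinearMap.lsmul ℝ ℝ)
      (rho_cont n) hl x)
    have h' := this.integrable.comp_sub_left x
    simpa using h'
  rw [ContinuousLinearMap.integral_apply hE2]
  rfl

lemma rho_sub_fderiv (n : ℕ) (x s v : E2) :
    fderiv ℝ (fun s => rho n (x - s)) s v = - fderiv ℝ (rho n) (x - s) v := by
  have := ((rho_contDiff n (k := 1)).differentiable (by norm_num) (x - s)).hasFDerivAt.comp s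
    ((hasFDerivAt_const x s).sub (hasFDerivAt_id s))
  have h2 := this.fderiv
  have h3 : (rho n ∘ HSub.hSub x) = fun s => rho n (x - s) := rfl
  rw [h3] at h2
  rw [h2]; simp

lemma rho_sub_tsupport (n : ℕ) (x : E2) :
    tsupport (fun s => rho n (x - s)) ⊆ Metric.closedBall x (mol n).rOut := by
  refine closure_minimal (fun s hs => ?_) Metric.isClosed_closedBall
  by_contra hcon
  refine hs (rho_eq_zero ?_)
  rw [Metric.mem_closedBall, not_le, dist_comm, dist_eq_norm] at hcon
  exact hcon.le

lemma rho_sub_compact (n : ℕ) (x : E2) : HasCompactSupport (fun s => rho n (x - s)) :=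
  (isCompact_closedBall x _).of_isClosed_subset (isClosed_tsupport _) (rho_sub_tsupport n x)

lemma rho_sub_contDiff (n : ℕ) (x : E2) : ContDiff ℝ (⊤ : ℕ∞) (fun s => rho n (x - s)) :=
  (rho_contDiff n).comp (contDiff_const.sub contDiff_id)

lemma mollify_fderiv {Ω S : Set E2} {f : E2 → E2} {Df : E2 → E2 →L[ℝ] E2}
    (hf : MemW12loc Ω f Df) (hΩm : MeasurableSet Ω)
    (hSΩ : S ⊆ Ω) (hl : LocallyIntegrable (S.indicator f))
    (hDl : LocallyIntegrable (S.indicator Df)) (n : ℕ) {x : E2}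
    (hx : Metric.closedBall x (mol n).rOut ⊆ S) :
    fderiv ℝ (mollify n (S.indicator f)) x = mollify n (S.indicator Df) x := by
  refine clm_ext2 fun i => ?_
  rw [mollify_hasFDerivAt hl, mollify_apply hDl]
  have hts := rho_sub_tsupport n x
  have hw := hf.2.2.2 _ (rho_sub_contDiff n x) (rho_sub_compact n x) (hts.trans (hx.trans hSΩ)) i
  have hfd := rho_sub_fderiv n x
  have hz : ∀ s, s ∉ S → fderiv ℝ (fun s => rho n (x - s)) s = 0 := by
    intro s hs
    have : s ∉ tsupport (fun s => rho n (x - s)) := fun h => hs (hx (hts h))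
    exact image_eq_zero_of_notMem_tsupport fun h => this ((tsupport_fderiv_subset ℝ) h)
  have hzr : ∀ s, s ∉ S → rho n (x - s) = 0 := by
    intro s hs
    have : s ∉ tsupport (fun s => rho n (x - s)) := fun h => hs (hx (hts h))
    exact image_eq_zero_of_notMem_tsupport (f := fun s => rho n (x - s)) this
  have l2 : ∫ t, fderiv ℝ (rho n) t (ee i) • S.indicator f (x - t) =
      ∫ s, fderiv ℝ (rho n) (x - s) (ee i) • S.indicator f s := by
    rw [← integral_sub_left_eq_self
      (fun s => fderiv ℝ (rho n) (x - s) (ee i) • S.indicator f s) volume x]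
    simp
  rw [l2]
  have l3 : ∫ s, fderiv ℝ (rho n) (x - s) (ee i) • S.indicator f s =
      - ∫ s in Ω, fderiv ℝ (fun s => rho n (x - s)) s (ee i) • f s := by
    rw [← integral_neg, ← integral_indicator hΩm]
    congr 1; ext1 s
    by_cases hs : s ∈ S
    · rw [indicator_of_mem hs, indicator_of_mem (hSΩ hs), hfd]; simp
    · have h1 := hfd s (ee i)
      rw [hz s hs] at h1
      have h2 : fderiv ℝ (rho n) (x - s) (ee i) = 0 := by simpa using h1.symm
      by_cases hs' : s ∈ Ω
      · rw [indicator_of_notMem hs, indicator_of_mem hs', hz s hs]; simp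
      · rw [indicator_of_notMem hs, indicator_of_notMem hs']; simp
  rw [l3, hw, neg_neg, ← integral_indicator hΩm]
  congr 1; ext1 s
  by_cases hs : s ∈ S
  · rw [indicator_of_mem hs, indicator_of_mem (hSΩ hs)]
  · by_cases hs' : s ∈ Ω
    · rw [indicator_of_notMem hs, indicator_of_mem hs', hzr s hs]; simp
    · rw [indicator_of_notMem hs, indicator_of_notMem hs']; simp

lemma memLp_indicator {Ω S : Set E2} {f : E2 → E2} {Df : E2 → E2 →L[ℝ] E2}
    (hf : MemW12loc Ω f Df) (hS : IsCompact S) (hSΩ : S ⊆ Ω) :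
    StronglyMeasurable (S.indicator Df) ∧ MemLp (S.indicator Df) 2 := by
  have h1 : StronglyMeasurable (S.indicator Df) :=
    (hf.2.1.stronglyMeasurable).indicator hS.measurableSet
  refine ⟨h1, h1.aestronglyMeasurable, ?_⟩
  rw [eLpNorm_lt_top_iff_lintegral_rpow_enorm_lt_top (by norm_num) (by norm_num)]
  refine lt_of_le_of_lt (le_of_eq ?_) (hf.2.2.1 S hSΩ hS)
  rw [← lintegral_indicator hS.measurableSet]
  congr 1; ext1 x
  by_cases hx : x ∈ S
  · simp only [indicator_of_mem hx, ENNReal.toReal_ofNat, ENNReal.rpow_ofNat]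
    rw [ENNReal.ofReal_pow (norm_nonneg _), ofReal_norm]
  · simp only [indicator_of_notMem hx, ENNReal.toReal_ofNat, ENNReal.rpow_ofNat]
    show ‖(0 : E2 →L[ℝ] E2)‖ₑ ^ 2 = 0
    rw [← ofReal_norm, norm_zero]; simp

lemma locInt_indicator {Ω S : Set E2} {f : E2 → E2} {Df : E2 → E2 →L[ℝ] E2}
    (hf : MemW12loc Ω f Df) (hS : IsCompact S) (hSΩ : S ⊆ Ω) :
    Integrable (S.indicator f) :=
  (integrable_indicator_iff hS.measurableSet).2 (hf.1.integrableOn_compact_subset hSΩ hS)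

/-! ### Integration by parts for Sobolev maps -/

lemma integral_mul_tendsto {a : ℕ → E2 → ℝ} {a0 : E2 → ℝ} {G : ℕ → E2 → ℝ} {G0 : E2 → ℝ} {C : ℝ}
    (ham : ∀ n, AEStronglyMeasurable (a n)) (hC : ∀ n x, |a n x| ≤ C)
    (ha : ∀ x, Filter.Tendsto (fun n => a n x) Filter.atTop (𝓝 (a0 x)))
    (hG : ∀ n, AEStronglyMeasurable (G n)) (hG0 : Integrable G0)
    (hL : Filter.Tendsto (fun n => ∫⁻ x, ‖G n x - G0 x‖ₑ) Filter.atTop (𝓝 0)) :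
    Filter.Tendsto (fun n => ∫ x, a n x * G n x) Filter.atTop (𝓝 (∫ x, a0 x * G0 x)) := by
  have h1 : Filter.Tendsto (fun n => ∫ x, a n x * G0 x) Filter.atTop (𝓝 (∫ x, a0 x * G0 x)) := by
    refine tendsto_integral_of_dominated_convergence (fun x => C * ‖G0 x‖)
      (fun n => (ham n).mul hG0.1) (hG0.norm.const_mul C) (fun n => .of_forall fun x => ?_)
      (.of_forall fun x => (ha x).mul_const _)
    rw [norm_mul]
    gcongr
    exact hC n x
  have hC0 : 0 ≤ C := (abs_nonneg _).trans (hC 0 0)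
  have h2 : Filter.Tendsto (fun n => ∫ x, a n x * (G n x - G0 x)) Filter.atTop (𝓝 0) := by
    rw [tendsto_zero_iff_norm_tendsto_zero]
    have h3 : Filter.Tendsto (fun n => (ENNReal.ofReal C * ∫⁻ x, ‖G n x - G0 x‖ₑ).toReal)
        Filter.atTop (𝓝 0) := by
      have := ENNReal.Tendsto.const_mul (a := ENNReal.ofReal C) hL (Or.inr ENNReal.ofReal_ne_top)
      rw [mul_zero] at this
      have h' := (ENNReal.tendsto_toReal ENNReal.zero_ne_top).comp this
      rw [ENNReal.toReal_zero] at h'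
      exact h'
    have hev : ∀ᶠ n in Filter.atTop, ∫⁻ x, ‖G n x - G0 x‖ₑ < ⊤ :=
      hL.eventually (gt_mem_nhds ENNReal.zero_lt_top)
    refine tendsto_of_tendsto_of_tendsto_of_le_of_le' tendsto_const_nhds h3
      (.of_forall fun n => norm_nonneg _) ?_
    filter_upwards [hev] with n hn
    rw [← toReal_enorm]
    refine ENNReal.toReal_mono (ENNReal.mul_lt_top ENNReal.ofReal_lt_top hn).ne ?_
    refine (enorm_integral_le_lintegral_enorm _).trans ?_
    rw [← lintegral_const_mul' _ _ ENNReal.ofReal_ne_top]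
    refine lintegral_mono fun x => ?_
    rw [enorm_mul]
    gcongr
    rw [← ofReal_norm]
    exact ENNReal.ofReal_le_ofReal (hC n x)
  have hev : ∀ᶠ n in Filter.atTop, ∫⁻ x, ‖G n x - G0 x‖ₑ < ⊤ :=
    hL.eventually (gt_mem_nhds ENNReal.zero_lt_top)
  have h4 := h2.add h1
  rw [zero_add] at h4
  refine h4.congr' ?_
  filter_upwards [hev] with n hn
  have hi : Integrable (fun x => G n x - G0 x) := ⟨(hG n).sub hG0.1, hn⟩
  rw [← integral_add]
  · congr 1; ext x; ring
  · exact hi.bdd_mul (ham n) (.of_forall (hC n))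
  · exact hG0.bdd_mul (ham n) (.of_forall (hC n))

lemma cs_tendsto {u : ℕ → E2 → ℝ≥0∞} {w : E2 → ℝ≥0∞} (hu : ∀ n, AEMeasurable (u n))
    (hw : AEMeasurable w) (hw2 : ∫⁻ x, w x ^ 2 < ⊤)
    (h : Filter.Tendsto (fun n => ∫⁻ x, u n x ^ 2) Filter.atTop (𝓝 0)) :
    Filter.Tendsto (fun n => ∫⁻ x, u n x * w x) Filter.atTop (𝓝 0) := by
  have key : ∀ n, ∫⁻ x, u n x * w x ≤
      (∫⁻ x, u n x ^ 2) ^ (2⁻¹ : ℝ) * (∫⁻ x, w x ^ 2) ^ (2⁻¹ : ℝ) := by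
    intro n
    have := ENNReal.lintegral_mul_le_Lp_mul_Lq volume (p := 2) (q := 2)
      (by constructor <;> norm_num) (hu n) hw
    simpa using this
  have h1 : Filter.Tendsto (fun n => (∫⁻ x, u n x ^ 2) ^ (2⁻¹ : ℝ) *
      (∫⁻ x, w x ^ 2) ^ (2⁻¹ : ℝ)) Filter.atTop (𝓝 0) := by
    have h2 := (ENNReal.continuous_rpow_const (y := (2⁻¹ : ℝ))).tendsto 0 |>.comp h
    have h3 := ENNReal.Tendsto.mul_const (b := (∫⁻ x, w x ^ 2) ^ (2⁻¹ : ℝ)) h2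
      (Or.inr (ENNReal.rpow_lt_top_of_nonneg (by norm_num) hw2.ne).ne)
    simpa using h3
  exact tendsto_of_tendsto_of_tendsto_of_le_of_le tendsto_const_nhds h1
    (fun n => zero_le) key

lemma memLp_two_lintegral {G : Type*} [NormedAddCommGroup G] {h : E2 → G} (h2 : MemLp h 2) :
    ∫⁻ x, ‖h x‖ₑ ^ 2 < ⊤ := by
  have := (eLpNorm_lt_top_iff_lintegral_rpow_enorm_lt_top (by norm_num) (by norm_num)).1 h2.2
  simpa using this

lemma jdet_tendsto {D : ℕ → E2 → E2 →L[ℝ] E2} {D0 : E2 → E2 →L[ℝ] E2}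
    (hm : ∀ n, AEStronglyMeasurable (D n)) (h2 : MemLp D0 2)
    (h : Filter.Tendsto (fun n => ∫⁻ x, ‖D n x - D0 x‖ₑ ^ 2) Filter.atTop (𝓝 0)) :
    Filter.Tendsto (fun n => ∫⁻ x, ‖jdet (D n x) - jdet (D0 x)‖ₑ) Filter.atTop (𝓝 0) := by
  have hu : ∀ n, AEMeasurable fun x => ‖D n x - D0 x‖ₑ := fun n => ((hm n).sub h2.1).enorm
  have h1 := cs_tendsto hu h2.1.enorm (memLp_two_lintegral h2) h
  have h3 : Filter.Tendsto (fun n => 2 * (∫⁻ x, ‖D n x - D0 x‖ₑ ^ 2) +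
      4 * (∫⁻ x, ‖D n x - D0 x‖ₑ * ‖D0 x‖ₑ)) Filter.atTop (𝓝 0) := by
    have a := ENNReal.Tendsto.const_mul (a := 2) h (Or.inr (by norm_num))
    have b := ENNReal.Tendsto.const_mul (a := 4) h1 (Or.inr (by norm_num))
    simpa using a.add b
  refine tendsto_of_tendsto_of_tendsto_of_le_of_le tendsto_const_nhds h3
    (fun n => zero_le) fun n => ?_
  rw [← lintegral_const_mul' _ _ (by norm_num), ← lintegral_const_mul' _ _ (by norm_num),
    ← lintegral_add_left' (((hu n).pow_const 2).const_mul 2)]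
  refine lintegral_mono fun x => ?_
  have hb := jdet_sub_le (D n x) (D0 x)
  have ht : ‖D n x‖ ≤ ‖D n x - D0 x‖ + ‖D0 x‖ := by
    simpa using norm_add_le (D n x - D0 x) (D0 x)
  have hb2 : |jdet (D n x) - jdet (D0 x)| ≤
      2 * ‖D n x - D0 x‖ ^ 2 + 4 * (‖D n x - D0 x‖ * ‖D0 x‖) := by
    nlinarith [norm_nonneg (D n x - D0 x)]
  calc ‖jdet (D n x) - jdet (D0 x)‖ₑ = ENNReal.ofReal |jdet (D n x) - jdet (D0 x)| := by
        rw [← ofReal_norm, Real.norm_eq_abs]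
    _ ≤ ENNReal.ofReal (2 * ‖D n x - D0 x‖ ^ 2 + 4 * (‖D n x - D0 x‖ * ‖D0 x‖)) :=
        ENNReal.ofReal_le_ofReal hb2
    _ = _ := by
        rw [ENNReal.ofReal_add (by positivity) (by positivity), ENNReal.ofReal_mul (by norm_num),
          ENNReal.ofReal_mul (by norm_num), ENNReal.ofReal_mul (by positivity),
          ENNReal.ofReal_pow (by positivity), ofReal_norm, ofReal_norm]
        norm_num

lemma jdet_integrable {D0 : E2 → E2 →L[ℝ] E2} (h2 : MemLp D0 2) :
    Integrable fun x => jdet (D0 x) := by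
  refine ⟨continuous_jdet.comp_aestronglyMeasurable h2.1, ?_⟩
  have := ENNReal.mul_lt_top (a := 2) (by norm_num) (memLp_two_lintegral h2)
  refine lt_of_le_of_lt ?_ this
  rw [← lintegral_const_mul' _ _ (by norm_num)]
  refine lintegral_mono fun x => ?_
  calc ‖jdet (D0 x)‖ₑ = ENNReal.ofReal |jdet (D0 x)| := by rw [← ofReal_norm, Real.norm_eq_abs]
    _ ≤ ENNReal.ofReal (2 * ‖D0 x‖ ^ 2) := ENNReal.ofReal_le_ofReal (jdet_le _)
    _ = _ := by
      rw [ENNReal.ofReal_mul (by norm_num), ENNReal.ofReal_pow (by positivity), ofReal_norm]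
      norm_num

lemma contDiff_two_of_top {φ : E2 → ℝ} (hφ : ContDiff ℝ (⊤ : ℕ∞) φ) : ContDiff ℝ 2 φ :=
  hφ.of_le (m := ((2 : ℕ∞) : WithTop ℕ∞)) (by exact_mod_cast le_top)

lemma grad_pair_bound (w : E2 →L[ℝ] ℝ) (A B : E2 →L[ℝ] E2) (i : Fin 2) :
    ‖w (adj A (ee i)) - w (adj B (ee i))‖ₑ ≤ ‖A - B‖ₑ * ‖3 * ‖w‖‖ₑ := by
  have e : w (adj A (ee i)) - w (adj B (ee i)) = w (adj (A - B) (ee i)) := by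
    rw [adj_sub, sub_apply, map_sub]
  rw [e, ← ofReal_norm, ← ofReal_norm, ← ofReal_norm, ← ENNReal.ofReal_mul (norm_nonneg _)]
  refine ENNReal.ofReal_le_ofReal ?_
  have h1 := w.le_opNorm (adj (A - B) (ee i))
  have h2 := (adj (A - B)).le_opNorm (ee i)
  rw [ee_norm, mul_one] at h2
  have h3 := norm_adj_le (A - B)
  have h4 := norm_nonneg w
  rw [Real.norm_of_nonneg (by positivity : 0 ≤ 3 * ‖w‖)]
  calc _ ≤ ‖w‖ * (3 * ‖A - B‖) := h1.trans (by gcongr; exact h2.trans h3)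
    _ = _ := by ring

lemma grad_pair_meas {w : E2 → E2 →L[ℝ] ℝ} (hw : Continuous w) {D : E2 → E2 →L[ℝ] E2}
    (hD : AEStronglyMeasurable D) (i : Fin 2) :
    AEStronglyMeasurable fun x => w x (adj (D x) (ee i)) := by
  have h0 : Continuous fun T : E2 →L[ℝ] E2 => adj T (ee i) :=
    continuous_adj.clm_apply continuous_const
  have h1 : AEStronglyMeasurable (fun x => adj (D x) (ee i)) :=
    h0.comp_aestronglyMeasurable hD
  have h2 : AEStronglyMeasurable w := hw.aestronglyMeasurable
  have h3 : Continuous fun p : (E2 →L[ℝ] ℝ) × E2 => p.1 p.2 :=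
    continuous_fst.clm_apply continuous_snd
  exact h3.comp_aestronglyMeasurable (h2.prodMk h1)

lemma grad_weight_memLp {w : E2 → E2 →L[ℝ] ℝ} (hw : Continuous w) (hc : HasCompactSupport w) :
    MemLp (fun x => 3 * ‖w x‖) 2 := by
  have h1 : Continuous fun x => 3 * ‖w x‖ := continuous_const.mul hw.norm
  have h2 : HasCompactSupport fun x => 3 * ‖w x‖ := hc.norm.mul_left
  exact h1.memLp_of_hasCompactSupport h2

lemma grad_pair_integrable {w : E2 → E2 →L[ℝ] ℝ} (hw : Continuous w) (hc : HasCompactSupport w)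
    {D0 : E2 → E2 →L[ℝ] E2} (hD2 : MemLp D0 2) (i : Fin 2) :
    Integrable fun x => w x (adj (D0 x) (ee i)) := by
  refine ⟨grad_pair_meas hw hD2.1 i, ?_⟩
  have hw2 := grad_weight_memLp hw hc
  have a1 := memLp_two_lintegral hw2
  have a2 := memLp_two_lintegral hD2
  have := ENNReal.lintegral_mul_le_Lp_mul_Lq volume (p := 2) (q := 2)
    (by constructor <;> norm_num) hD2.1.enorm hw2.1.enorm
  refine lt_of_le_of_lt (lintegral_mono fun x => ?_) (this.trans_lt ?_)
  · have := grad_pair_bound (w x) (D0 x) 0 i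
    have h0 : adj 0 (ee i) = 0 := by ext j; simp [adj_apply]
    rw [h0, map_zero, sub_zero, sub_zero] at this
    exact this
  · refine ENNReal.mul_lt_top ?_ ?_
    · refine ENNReal.rpow_lt_top_of_nonneg (by norm_num) ?_
      simp only [ENNReal.rpow_ofNat]; exact a2.ne
    · refine ENNReal.rpow_lt_top_of_nonneg (by norm_num) ?_
      simp only [ENNReal.rpow_ofNat]; exact a1.ne

lemma grad_pair_tendsto {w : E2 → E2 →L[ℝ] ℝ} (hw : Continuous w) (hc : HasCompactSupport w)
    {D : ℕ → E2 → E2 →L[ℝ] E2} {D0 : E2 → E2 →L[ℝ] E2}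
    (hm : ∀ n, AEStronglyMeasurable (D n)) (hD2 : MemLp D0 2)
    (h : Filter.Tendsto (fun n => ∫⁻ x, ‖D n x - D0 x‖ₑ ^ 2) Filter.atTop (𝓝 0)) (i : Fin 2) :
    Filter.Tendsto (fun n => ∫⁻ x, ‖w x (adj (D n x) (ee i)) - w x (adj (D0 x) (ee i))‖ₑ)
      Filter.atTop (𝓝 0) := by
  have hw2 := grad_weight_memLp hw hc
  have hu : ∀ n, AEMeasurable fun x => ‖D n x - D0 x‖ₑ := fun n => ((hm n).sub hD2.1).enorm
  have hcs := cs_tendsto hu hw2.1.enorm (memLp_two_lintegral hw2) h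
  exact tendsto_of_tendsto_of_tendsto_of_le_of_le tendsto_const_nhds hcs
      (fun n => zero_le) fun n => lintegral_mono fun x => grad_pair_bound _ _ _ i

lemma ibp_lhs {χ φ : E2 → ℝ} (hχ : Continuous χ) (hχc : HasCompactSupport χ)
    (hdφ : Continuous (fderiv ℝ φ)) (hdφc : HasCompactSupport (fderiv ℝ φ))
    {F : ℕ → E2 → E2} {f : E2 → E2} (hF : ∀ n, Continuous (F n))
    (hFt : ∀ x ∈ tsupport χ, Filter.Tendsto (fun n => F n x) Filter.atTop (𝓝 (f x)))
    {D : ℕ → E2 → E2 →L[ℝ] E2} {D0 : E2 → E2 →L[ℝ] E2}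
    (hm : ∀ n, AEStronglyMeasurable (D n)) (hD2 : MemLp D0 2)
    (h : Filter.Tendsto (fun n => ∫⁻ x, ‖D n x - D0 x‖ₑ ^ 2) Filter.atTop (𝓝 0)) (i : Fin 2) :
    Filter.Tendsto (fun n => ∫ x, χ x * fderiv ℝ φ (F n x) (ee i) * jdet (D n x)) Filter.atTop
      (𝓝 (∫ x, χ x * fderiv ℝ φ (f x) (ee i) * jdet (D0 x))) := by
  obtain ⟨C1, hC1⟩ := hdφ.bounded_above_of_compact_support hdφc
  obtain ⟨C3, hC3⟩ := hχ.bounded_above_of_compact_support hχc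
  have hc : Continuous fun y => fderiv ℝ φ y (ee i) := hdφ.clm_apply continuous_const
  have hχ0 : ∀ x, x ∉ tsupport χ → χ x = 0 := fun x hx => image_eq_zero_of_notMem_tsupport hx
  refine integral_mul_tendsto (a := fun n x => χ x * fderiv ℝ φ (F n x) (ee i))
    (a0 := fun x => χ x * fderiv ℝ φ (f x) (ee i)) (G := fun n x => jdet (D n x))
    (G0 := fun x => jdet (D0 x)) (C := C3 * C1) ?_ ?_ ?_ ?_ (jdet_integrable hD2)
    (jdet_tendsto hm hD2 h)
  · intro n
    exact (hχ.mul (hc.comp (hF n))).aestronglyMeasurable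
  · intro n x
    rw [abs_mul]
    gcongr
    · exact (norm_nonneg _).trans (hC3 0)
    · exact hC3 x
    · refine le_trans ?_ (hC1 (F n x))
      have := (fderiv ℝ φ (F n x)).le_opNorm (ee i)
      rwa [ee_norm, mul_one] at this
  · intro x
    by_cases hx : x ∈ tsupport χ
    · exact Filter.Tendsto.const_mul _ ((hc.tendsto _).comp (hFt x hx))
    · simp only [hχ0 x hx, zero_mul]; exact tendsto_const_nhds
  · intro n
    exact continuous_jdet.comp_aestronglyMeasurable (hm n)

lemma ibp_rhs {χ φ : E2 → ℝ} (hφ : Continuous φ) (hφc : HasCompactSupport φ)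
    (hdχ : Continuous (fderiv ℝ χ)) (hdχc : HasCompactSupport (fderiv ℝ χ))
    {F : ℕ → E2 → E2} {f : E2 → E2} (hF : ∀ n, Continuous (F n))
    (hFt : ∀ x ∈ tsupport χ, Filter.Tendsto (fun n => F n x) Filter.atTop (𝓝 (f x)))
    {D : ℕ → E2 → E2 →L[ℝ] E2} {D0 : E2 → E2 →L[ℝ] E2}
    (hm : ∀ n, AEStronglyMeasurable (D n)) (hD2 : MemLp D0 2)
    (h : Filter.Tendsto (fun n => ∫⁻ x, ‖D n x - D0 x‖ₑ ^ 2) Filter.atTop (𝓝 0)) (i : Fin 2) :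
    Filter.Tendsto (fun n => ∫ x, (tsupport χ).indicator (fun x => φ (F n x)) x *
      fderiv ℝ χ x (adj (D n x) (ee i))) Filter.atTop
      (𝓝 (∫ x, (tsupport χ).indicator (fun x => φ (f x)) x *
        fderiv ℝ χ x (adj (D0 x) (ee i)))) := by
  obtain ⟨C2, hC2⟩ := hφ.bounded_above_of_compact_support hφc
  refine integral_mul_tendsto (a := fun n => (tsupport χ).indicator fun x => φ (F n x))
    (a0 := (tsupport χ).indicator fun x => φ (f x))
    (G := fun n x => fderiv ℝ χ x (adj (D n x) (ee i)))
    (G0 := fun x => fderiv ℝ χ x (adj (D0 x) (ee i))) (C := C2) ?_ ?_ ?_ ?_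
    (grad_pair_integrable hdχ hdχc hD2 i) (grad_pair_tendsto hdχ hdχc hm hD2 h i)
  · intro n
    have h1 : AEStronglyMeasurable (fun x => φ (F n x)) := (hφ.comp (hF n)).aestronglyMeasurable
    exact h1.indicator (isClosed_tsupport χ).measurableSet
  · intro n x
    by_cases hx : x ∈ tsupport χ
    · rw [indicator_of_mem hx]; exact hC2 _
    · rw [indicator_of_notMem hx, abs_zero]; exact (norm_nonneg _).trans (hC2 0)
  · intro x
    by_cases hx : x ∈ tsupport χ
    · simp only [indicator_of_mem hx]
      exact (hφ.tendsto _).comp (hFt x hx)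
    · simp only [indicator_of_notMem hx]; exact tendsto_const_nhds
  · intro n
    exact grad_pair_meas hdχ (hm n) i

lemma fderiv_compact {χ : E2 → ℝ} (h : HasCompactSupport χ) : HasCompactSupport (fderiv ℝ χ) :=
  h.fderiv (𝕜 := ℝ)

lemma fderiv_zero_off {χ : E2 → ℝ} {x : E2} (hx : x ∉ tsupport χ) : fderiv ℝ χ x = 0 :=
  image_eq_zero_of_notMem_tsupport fun h => hx ((tsupport_fderiv_subset ℝ) h)

lemma ibp_setup {Ω S K : Set E2} (hΩ : IsOpen Ω) {f : E2 → E2} {Df : E2 → E2 →L[ℝ] E2}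
    (hcont : ContinuousOn f Ω) (hf : MemW12loc Ω f Df) {δ : ℝ} (hδ : 0 < δ)
    (hS : IsCompact S) (hSΩ : S ⊆ Ω) (hK : ∀ x ∈ K, Metric.closedBall x δ ⊆ S)
    (hfl : LocallyIntegrable (S.indicator f)) (hDl : LocallyIntegrable (S.indicator Df)) :
    (∀ x ∈ K, Filter.Tendsto (fun n => mollify n (S.indicator f) x) Filter.atTop (𝓝 (f x))) ∧
    (∀ᶠ n in Filter.atTop, ∀ x ∈ K,
      fderiv ℝ (mollify n (S.indicator f)) x = mollify n (S.indicator Df) x) := by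
  constructor
  · intro x hx
    have hev : S.indicator f =ᶠ[𝓝 x] f := by
      filter_upwards [Metric.closedBall_mem_nhds x hδ] with y hy
      exact indicator_of_mem (hK x hx hy) f
    have hc : ContinuousAt (S.indicator f) x := by
      have := hcont.continuousAt (hΩ.mem_nhds (hSΩ (hK x hx (Metric.mem_closedBall_self hδ.le))))
      exact this.congr hev.symm
    have := mollify_tendsto_pt hfl.aestronglyMeasurable hc
    rwa [hev.eq_of_nhds] at this
  · filter_upwards [mol_rOut_tendsto.eventually (gt_mem_nhds hδ)] with n hn x hx
    refine mollify_fderiv hf hΩ.measurableSet hSΩ hfl hDl n ?_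
    exact (Metric.closedBall_subset_closedBall hn.le).trans (hK x hx)

lemma sobolev_ibp {Ω : Set E2} (hΩ : IsOpen Ω) {f : E2 → E2} {Df : E2 → E2 →L[ℝ] E2}
    (hcont : ContinuousOn f Ω) (hf : MemW12loc Ω f Df)
    {χ φ : E2 → ℝ} (hχ : ContDiff ℝ (⊤ : ℕ∞) χ) (hχc : HasCompactSupport χ) (hχΩ : tsupport χ ⊆ Ω)
    (hφ : ContDiff ℝ (⊤ : ℕ∞) φ) (hφc : HasCompactSupport φ) (i : Fin 2) :
    ∫ x, χ x * fderiv ℝ φ (f x) (ee i) * jdet (Df x) =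
      - ∫ x, φ (f x) * fderiv ℝ χ x (adj (Df x) (ee i)) := by
  obtain ⟨δ, hδ, hSΩ⟩ := hχc.exists_cthickening_subset_open hΩ hχΩ
  have hSc : IsCompact (Metric.cthickening δ (tsupport χ)) := IsCompact.cthickening hχc
  have hsub : tsupport χ ⊆ Metric.cthickening δ (tsupport χ) := Metric.self_subset_cthickening _
  have hK : ∀ x ∈ tsupport χ, Metric.closedBall x δ ⊆ Metric.cthickening δ (tsupport χ) :=
    fun x hx y hy => Metric.mem_cthickening_of_dist_le y x δ _ hx hy
  generalize Metric.cthickening δ (tsupport χ) = S at *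
  obtain ⟨hDm, hD2⟩ := memLp_indicator hf hSc hSΩ
  have hDl : LocallyIntegrable (S.indicator Df) := hD2.locallyIntegrable (by norm_num)
  have hfl : LocallyIntegrable (S.indicator f) := (locInt_indicator hf hSc hSΩ).locallyIntegrable
  obtain ⟨hFt, hDn⟩ := ibp_setup hΩ hcont hf hδ hSc hSΩ hK hfl hDl
  have hDL := mollify_tendsto hDm hD2
  have hDnm : ∀ n, AEStronglyMeasurable (mollify n (S.indicator Df)) := fun n =>
    (mollify_continuous n hDl).aestronglyMeasurable
  have hFc : ∀ n, Continuous (mollify n (S.indicator f)) := fun n => mollify_continuous n hfl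
  have hF2 : ∀ n, ContDiff ℝ 2 (mollify n (S.indicator f)) := fun n =>
    mollify_contDiff n hfl (k := 2)
  have hi : ∀ x ∈ tsupport χ, S.indicator Df x = Df x := fun x hx => indicator_of_mem (hsub hx) Df
  generalize S.indicator Df = D0 at *
  generalize S.indicator f = f1 at *
  have hχ2 : ContDiff ℝ 2 χ := contDiff_two_of_top hχ
  have hφ2 : ContDiff ℝ 2 φ := contDiff_two_of_top hφ
  have hdχ : Continuous (fderiv ℝ χ) := hχ2.continuous_fderiv (by norm_num)
  have hdφ : Continuous (fderiv ℝ φ) := hφ2.continuous_fderiv (by norm_num)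
  have hχ0 : ∀ x, x ∉ tsupport χ → χ x = 0 := fun x hx => image_eq_zero_of_notMem_tsupport hx
  have L := ibp_lhs hχ.continuous hχc hdφ (fderiv_compact hφc) hFc hFt hDnm hD2 hDL i
  have R := ibp_rhs hφ.continuous hφc hdχ (fderiv_compact hχc) hFc hFt hDnm hD2 hDL i
  have eL : ∫ x, χ x * fderiv ℝ φ (f x) (ee i) * jdet (Df x) =
      ∫ x, χ x * fderiv ℝ φ (f x) (ee i) * jdet (D0 x) := by
    congr 1; ext x
    by_cases hx : x ∈ tsupport χ
    · rw [hi x hx]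
    · rw [hχ0 x hx, zero_mul, zero_mul, zero_mul]
  have eR : ∫ x, φ (f x) * fderiv ℝ χ x (adj (Df x) (ee i)) =
      ∫ x, (tsupport χ).indicator (fun x => φ (f x)) x * fderiv ℝ χ x (adj (D0 x) (ee i)) := by
    congr 1; ext x
    by_cases hx : x ∈ tsupport χ
    · rw [hi x hx, indicator_of_mem hx]
    · rw [fderiv_zero_off hx, zero_apply, zero_apply, mul_zero, mul_zero]
  rw [eL, eR]
  refine tendsto_nhds_unique L (R.neg.congr' ?_)
  filter_upwards [hDn] with n hn
  have hs := smooth_ibp (F := mollify n f1) (hF2 n) hφ2 hχ2 hχc i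
  have e1 : ∫ x, χ x * fderiv ℝ φ (mollify n f1 x) (ee i) * jdet (mollify n D0 x) =
      ∫ x, χ x * fderiv ℝ φ (mollify n f1 x) (ee i) * jdet (fderiv ℝ (mollify n f1) x) := by
    congr 1; ext x
    by_cases hx : x ∈ tsupport χ
    · rw [hn x hx]
    · rw [hχ0 x hx, zero_mul, zero_mul, zero_mul]
  rw [e1, hs]
  congr 2; ext x
  by_cases hx : x ∈ tsupport χ
  · rw [hn x hx, indicator_of_mem hx]
  · rw [fderiv_zero_off hx, zero_apply, zero_apply, mul_zero, mul_zero]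

/-! ### The constancy lemma -/

lemma rho_fderiv_cont (n : ℕ) : Continuous (fderiv ℝ (rho n)) :=
  (rho_contDiff n (k := 1)).continuous_fderiv (by norm_num)

lemma rho_bdd (n : ℕ) : ∃ C, ∀ x, ‖rho n x‖ ≤ C :=
  (rho_cont n).bounded_above_of_compact_support (rho_compact n)

lemma rho_fderiv_bdd (n : ℕ) : ∃ C, ∀ x, ‖fderiv ℝ (rho n) x‖ ≤ C :=
  (rho_fderiv_cont n).bounded_above_of_compact_support (fderiv_compact (rho_compact n))

lemma rho_neg (n : ℕ) (x : E2) : rho n (-x) = rho n x := (mol n).normed_neg x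

lemma avg_hasFDerivAt {f : E2 → E2} (hfm : Measurable f) {h : E2 → ℝ} (hh : Integrable h)
    (n : ℕ) (y : E2) :
    HasFDerivAt (fun y => ∫ x, h x * rho n (y - f x))
      (∫ x, h x • fderiv ℝ (rho n) (y - f x)) y := by
  obtain ⟨C, hC⟩ := rho_bdd n
  obtain ⟨C', hC'⟩ := rho_fderiv_bdd n
  have hm : ∀ y, AEStronglyMeasurable (fun x => rho n (y - f x)) volume := fun y =>
    ((rho_cont n).measurable.comp (measurable_const.sub hfm)).aestronglyMeasurable
  have hsub : Measurable fun x => y - f x := measurable_const.sub hfm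
  have hm' : AEStronglyMeasurable (fun x => fderiv ℝ (rho n) (y - f x)) volume :=
    (rho_fderiv_cont n).comp_aestronglyMeasurable hsub.aestronglyMeasurable
  refine hasFDerivAt_integral_of_dominated_of_fderiv_le (s := univ)
    (F := fun y x => h x * rho n (y - f x)) (F' := fun y x => h x • fderiv ℝ (rho n) (y - f x))
    (bound := fun x => ‖h x‖ * C') Filter.univ_mem ?_ ?_ ?_ ?_ ?_ ?_
  · exact .of_forall fun y => hh.1.mul (hm y)
  · exact hh.mul_bdd (c := C) (hm y) (.of_forall fun x => hC _)
  · exact hh.1.smul hm'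
  · refine .of_forall fun x y _ => ?_
    rw [norm_smul]
    exact mul_le_mul_of_nonneg_left (hC' _) (norm_nonneg _)
  · exact hh.norm.mul_const C'
  · refine .of_forall fun x y _ => ?_
    have h1 : HasFDerivAt (rho n) (fderiv ℝ (rho n) (y - f x)) (y - f x) :=
      ((rho_contDiff n (k := 1)).differentiable (by norm_num) (y - f x)).hasFDerivAt
    have h2 : HasFDerivAt (fun y => y - f x) (ContinuousLinearMap.id ℝ E2) y :=
      (hasFDerivAt_id y).sub_const (f x)
    have h3 := h1.comp y h2
    rw [ContinuousLinearMap.comp_id] at h3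
    exact h3.const_mul (h x)

lemma avg_fderiv_zero {f : E2 → E2} (hfm : Measurable f) {h : E2 → ℝ} (hh : Integrable h)
    {y0 : E2} {r : ℝ}
    (hT : ∀ φ : E2 → ℝ, ContDiff ℝ (⊤ : ℕ∞) φ → HasCompactSupport φ →
      tsupport φ ⊆ Metric.ball y0 r → ∀ i, ∫ x, fderiv ℝ φ (f x) (ee i) * h x = 0)
    (n : ℕ) (hn : (mol n).rOut < r / 2) (y : E2) (hy : y ∈ Metric.ball y0 (r / 2)) :
    fderiv ℝ (fun y => ∫ x, h x * rho n (y - f x)) y = 0 := by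
  rw [(avg_hasFDerivAt hfm hh n y).fderiv]
  obtain ⟨C', hC'⟩ := rho_fderiv_bdd n
  have hsub : Measurable fun x => y - f x := measurable_const.sub hfm
  have hm' : AEStronglyMeasurable (fun x => fderiv ℝ (rho n) (y - f x)) volume :=
    (rho_fderiv_cont n).comp_aestronglyMeasurable hsub.aestronglyMeasurable
  have hi : Integrable fun x => h x • fderiv ℝ (rho n) (y - f x) := by
    refine (hh.norm.mul_const C').mono' (hh.1.smul hm') (.of_forall fun x => ?_)
    rw [norm_smul]
    exact mul_le_mul_of_nonneg_left (hC' _) (norm_nonneg _)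
  have key : ∀ i, (∫ x, h x • fderiv ℝ (rho n) (y - f x)) (ee i) = 0 := by
    intro i
    rw [ContinuousLinearMap.integral_apply hi]
    have h1 := hT _ (rho_sub_contDiff n y) (rho_sub_compact n y) (by
      refine (rho_sub_tsupport n y).trans fun z hz => ?_
      rw [Metric.mem_closedBall] at hz
      rw [Metric.mem_ball] at hy ⊢
      linarith [dist_triangle z y y0]) i
    simp_rw [rho_sub_fderiv, neg_mul] at h1
    rw [integral_neg, neg_eq_zero] at h1
    rw [← h1]
    refine integral_congr_ae (.of_forall fun x => ?_)
    simp only [smul_apply, smul_eq_mul]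
    ring
  generalize (∫ x, h x • fderiv ℝ (rho n) (y - f x)) = T at key
  ext v
  rw [clm_applyR]
  rw [key, key]; simp

lemma avg_fubini {f : E2 → E2} (hfm : Measurable f) {h : E2 → ℝ} (hh : Integrable h)
    (n : ℕ) {u : E2 → ℝ} (hu : Continuous u) (huc : HasCompactSupport u) :
    ∫ y, u y * (∫ x, h x * rho n (y - f x)) = ∫ x, mollify n u (f x) * h x := by
  obtain ⟨C, hC⟩ := rho_bdd n
  have hui : Integrable u := hu.integrable_of_hasCompactSupport huc
  have hi : Integrable (fun p : E2 × E2 => (u p.1 * h p.2) * rho n (p.1 - f p.2))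
      (volume.prod volume) := by
    refine (hui.mul_prod hh).mul_bdd (c := C) ?_ (.of_forall fun x => hC _)
    exact ((rho_cont n).measurable.comp
      (measurable_fst.sub (hfm.comp measurable_snd))).aestronglyMeasurable
  have hsw := integral_integral_swap (f := fun y x => (u y * h x) * rho n (y - f x)) hi
  have e1 : ∫ y, u y * (∫ x, h x * rho n (y - f x)) =
      ∫ y, ∫ x, (u y * h x) * rho n (y - f x) := by
    congr 1; ext y
    rw [← integral_const_mul]
    congr 1; ext x; ring
  rw [e1, hsw]
  congr 1; ext x
  rw [mollify_eq_swap, ← integral_mul_const]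
  congr 1; ext y
  rw [← rho_neg n (y - f x), neg_sub, smul_eq_mul]; ring

lemma mollify_le {u : E2 → ℝ} {C : ℝ} (hC : ∀ x, ‖u x‖ ≤ C) (n : ℕ) (x : E2) :
    ‖mollify n u x‖ ≤ C := by
  unfold mollify
  have : ∫ t, rho n t * C = C := by rw [integral_mul_const, rho_integral, one_mul]
  rw [← this]
  refine norm_integral_le_of_norm_le ((rho_integrable n).mul_const C) (.of_forall fun t => ?_)
  rw [norm_smul, Real.norm_of_nonneg (rho_nonneg n t)]
  exact mul_le_mul_of_nonneg_left (hC _) (rho_nonneg n t)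

lemma avg_tendsto {f : E2 → E2} (hfm : Measurable f) {h : E2 → ℝ} (hh : Integrable h)
    {u : E2 → ℝ} (hu : Continuous u) (huc : HasCompactSupport u) :
    Filter.Tendsto (fun n => ∫ x, mollify n u (f x) * h x) Filter.atTop
      (𝓝 (∫ x, u (f x) * h x)) := by
  obtain ⟨C, hC⟩ := hu.bounded_above_of_compact_support huc
  have hul : LocallyIntegrable u := hu.locallyIntegrable
  refine tendsto_integral_of_dominated_convergence (fun x => C * ‖h x‖) ?_
    (hh.norm.const_mul C) ?_ ?_
  · intro n
    have := ((mollify_continuous n hul).measurable.comp hfm).aestronglyMeasurable (μ := volume)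
    exact this.mul hh.1
  · refine fun n => .of_forall fun x => ?_
    rw [norm_mul]
    exact mul_le_mul_of_nonneg_right (mollify_le hC n _) (norm_nonneg _)
  · refine .of_forall fun x => ?_
    exact (mollify_tendsto_pt hul.aestronglyMeasurable hu.continuousAt).mul_const _

lemma constancy {f : E2 → E2} (hfm : Measurable f) {h : E2 → ℝ} (hh : Integrable h)
    {y0 : E2} {r : ℝ} (hr : 0 < r)
    (hT : ∀ φ : E2 → ℝ, ContDiff ℝ (⊤ : ℕ∞) φ → HasCompactSupport φ →
      tsupport φ ⊆ Metric.ball y0 r → ∀ i, ∫ x, fderiv ℝ φ (f x) (ee i) * h x = 0) :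
    ∃ c : ℝ, ∀ u : E2 → ℝ, Continuous u → HasCompactSupport u →
      (∀ y, y ∉ Metric.ball y0 (r / 2) → u y = 0) → ∫ x, u (f x) * h x = c * ∫ y, u y := by
  have hy0 : y0 ∈ Metric.ball y0 (r / 2) := Metric.mem_ball_self (by positivity)
  let c : ℕ → ℝ := fun n => ∫ x, h x * rho n (y0 - f x)
  have hev : ∀ᶠ n in Filter.atTop, (mol n).rOut < r / 2 :=
    mol_rOut_tendsto.eventually (gt_mem_nhds (by positivity))
  have hconst : ∀ n, (mol n).rOut < r / 2 → ∀ y ∈ Metric.ball y0 (r / 2),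
      ∫ x, h x * rho n (y - f x) = c n := by
    intro n hn y hy
    refine Metric.isOpen_ball.is_const_of_fderiv_eq_zero (𝕜 := ℝ)
      (f := fun y => ∫ x, h x * rho n (y - f x)) (convex_ball y0 (r / 2)).isPreconnected
      (fun z _ => (avg_hasFDerivAt hfm hh n z).differentiableAt.differentiableWithinAt) ?_ hy hy0
    intro z hz
    exact avg_fderiv_zero hfm hh hT n hn z hz
  have hlim : ∀ u : E2 → ℝ, Continuous u → HasCompactSupport u →
      (∀ y, y ∉ Metric.ball y0 (r / 2) → u y = 0) →
      Filter.Tendsto (fun n => c n * ∫ y, u y) Filter.atTop (𝓝 (∫ x, u (f x) * h x)) := by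
    intro u hu huc hu0
    refine (avg_tendsto hfm hh hu huc).congr' ?_
    filter_upwards [hev] with n hn
    rw [← avg_fubini hfm hh n hu huc, ← integral_const_mul]
    congr 1; ext y
    by_cases hy : y ∈ Metric.ball y0 (r / 2)
    · rw [hconst n hn y hy, mul_comm]
    · rw [hu0 y hy, zero_mul, mul_zero]
  let b : ContDiffBump y0 := ⟨r / 8, r / 4, by positivity, by linarith⟩
  have hb0 : ∀ y, y ∉ Metric.ball y0 (r / 2) → b y = 0 := by
    intro y hy
    refine b.zero_of_le_dist ?_
    rw [Metric.mem_ball, not_lt] at hy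
    change r / 4 ≤ _
    linarith
  have hbl := hlim b b.continuous b.hasCompactSupport hb0
  have hbp : 0 < ∫ y, b y := b.integral_pos
  refine ⟨(∫ x, b (f x) * h x) / ∫ y, b y, fun u hu huc hu0 => ?_⟩
  have hc : Filter.Tendsto c Filter.atTop (𝓝 ((∫ x, b (f x) * h x) / ∫ y, b y)) := by
    refine (hbl.div_const (∫ y, b y)).congr fun n => ?_
    field_simp
  exact tendsto_nhds_unique (hlim u hu huc hu0) (hc.mul_const _)

/-! ### The measure identity -/

lemma open_identity {f : E2 → E2} (hfm : Measurable f) {h : E2 → ℝ} (hh : Integrable h) {c : ℝ}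
    {U : Set E2} (hU : IsOpen U) (hUb : Bornology.IsBounded U)
    (hT : ∀ u : E2 → ℝ, Continuous u → HasCompactSupport u → (∀ y, y ∉ U → u y = 0) →
      ∫ x, u (f x) * h x = c * ∫ y, u y) :
    ∫ x in f ⁻¹' U, h x = ∫ _y in U, c := by
  have hne : Uᶜ.Nonempty := by
    rw [nonempty_compl]
    rintro rfl
    have h1 : IsCompact (univ : Set E2) := Metric.isCompact_of_isClosed_isBounded isClosed_univ hUb
    exact noncompact_univ E2 h1
  let u : ℕ → E2 → ℝ := fun n y => min 1 (n * Metric.infDist y Uᶜ)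
  have huc : ∀ n, Continuous (u n) := fun n =>
    continuous_const.min (continuous_const.mul (Metric.continuous_infDist_pt _))
  have hu0 : ∀ n y, y ∉ U → u n y = 0 := by
    intro n y hy
    have : Metric.infDist y Uᶜ = 0 := Metric.infDist_zero_of_mem hy
    simp [u, this]
  have hus : ∀ n, HasCompactSupport (u n) := by
    intro n
    refine HasCompactSupport.of_support_subset_isCompact hUb.isCompact_closure ?_
    intro y hy
    by_contra hcon
    exact hy (hu0 n y fun h => hcon (subset_closure h))
  have hub : ∀ n y, ‖u n y‖ ≤ U.indicator 1 y := by
    intro n y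
    by_cases hy : y ∈ U
    · rw [indicator_of_mem hy, Real.norm_of_nonneg]
      · exact min_le_left _ _
      · exact le_min zero_le_one (mul_nonneg (Nat.cast_nonneg n) Metric.infDist_nonneg)
    · rw [hu0 n y hy, indicator_of_notMem hy, norm_zero]
  have hul : ∀ y, Filter.Tendsto (fun n => u n y) Filter.atTop (𝓝 (U.indicator 1 y)) := by
    intro y
    by_cases hy : y ∈ U
    · rw [indicator_of_mem hy]
      have hp : 0 < Metric.infDist y Uᶜ :=
        (hU.isClosed_compl.notMem_iff_infDist_pos hne).1 (by simpa using hy)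
      have ht : Filter.Tendsto (fun n : ℕ => (n : ℝ) * Metric.infDist y Uᶜ) Filter.atTop
          Filter.atTop := tendsto_natCast_atTop_atTop.atTop_mul_const hp
      refine tendsto_const_nhds.congr' ?_
      filter_upwards [ht.eventually_ge_atTop 1] with n hn
      simp [u, hn]
    · simp only [hu0 _ y hy, indicator_of_notMem hy]; exact tendsto_const_nhds
  have hUf : volume U ≠ ⊤ := hUb.measure_lt_top.ne
  have hi1 : Integrable (U.indicator (1 : E2 → ℝ)) :=
    (integrable_indicator_iff hU.measurableSet).2 (integrableOn_const hUf)
  have L : Filter.Tendsto (fun n => ∫ x, u n (f x) * h x) Filter.atTop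
      (𝓝 (∫ x, U.indicator 1 (f x) * h x)) := by
    refine tendsto_integral_of_dominated_convergence (fun x => ‖h x‖) ?_ hh.norm ?_ ?_
    · intro n
      have := ((huc n).measurable.comp hfm).aestronglyMeasurable (μ := volume)
      exact this.mul hh.1
    · refine fun n => .of_forall fun x => ?_
      rw [norm_mul]
      have h1 : ‖u n (f x)‖ ≤ 1 := (hub n _).trans (indicator_le_self' (by simp) _)
      nlinarith [norm_nonneg (h x)]
    · exact .of_forall fun x => (hul _).mul_const _
  have R : Filter.Tendsto (fun n => c * ∫ y, u n y) Filter.atTop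
      (𝓝 (c * ∫ y, U.indicator 1 y)) := by
    refine Filter.Tendsto.const_mul c ?_
    exact tendsto_integral_of_dominated_convergence (U.indicator 1)
      (fun n => (huc n).aestronglyMeasurable) hi1 (fun n => .of_forall (hub n))
      (.of_forall hul)
  have := tendsto_nhds_unique (R.congr fun n => (hT (u n) (huc n) (hus n) (hu0 n)).symm) L
  have e1 : ∫ x in f ⁻¹' U, h x = ∫ x, U.indicator 1 (f x) * h x := by
    rw [← integral_indicator (hfm hU.measurableSet)]
    congr 1; ext x
    by_cases hx : f x ∈ U
    · rw [indicator_of_mem (show x ∈ f ⁻¹' U from hx), indicator_of_mem hx]; simp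
    · rw [indicator_of_notMem (show x ∉ f ⁻¹' U from hx), indicator_of_notMem hx]; simp
  rw [e1, ← this, ← integral_const_mul, ← integral_indicator hU.measurableSet]
  congr 1; ext x
  by_cases hx : x ∈ U
  · rw [indicator_of_mem hx, indicator_of_mem hx]; simp
  · rw [indicator_of_notMem hx, indicator_of_notMem hx]; simp

lemma set_identity {f : E2 → E2} (hfm : Measurable f) {h : E2 → ℝ} (hh : Integrable h) {c : ℝ}
    {B : Set E2} (hB : IsOpen B) (hBb : Bornology.IsBounded B)
    (hT : ∀ u : E2 → ℝ, Continuous u → HasCompactSupport u → (∀ y, y ∉ B → u y = 0) →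
      ∫ x, u (f x) * h x = c * ∫ y, u y) {A : Set E2} (hA : MeasurableSet A) :
    ∫ x in f ⁻¹' A, h x ∂(volume.restrict (f ⁻¹' B)) = ∫ _y in A, c ∂(volume.restrict B) := by
  have hBf : volume B ≠ ⊤ := hBb.measure_lt_top.ne
  have : IsFiniteMeasure (volume.restrict B) := ⟨by simpa using hBb.measure_lt_top⟩
  have hh' : Integrable h (volume.restrict (f ⁻¹' B)) := hh.restrict
  have hopen : ∀ U, IsOpen U →
      ∫ x in f ⁻¹' U, h x ∂(volume.restrict (f ⁻¹' B)) = ∫ _y in U, c ∂(volume.restrict B) := by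
    intro U hU
    rw [Measure.restrict_restrict (hfm hU.measurableSet), Measure.restrict_restrict hU.measurableSet,
      ← preimage_inter]
    refine open_identity hfm hh (hU.inter hB) (hBb.subset inter_subset_right) ?_
    intro u h1 h2 h3
    exact hT u h1 h2 fun y hy => h3 y fun h => hy h.2
  have huniv := hopen univ isOpen_univ
  rw [preimage_univ, Measure.restrict_univ, Measure.restrict_univ] at huniv
  have hgen : (inferInstance : MeasurableSpace E2) =
      MeasurableSpace.generateFrom {s : Set E2 | IsOpen s} := BorelSpace.measurable_eq
  induction A, hA using MeasurableSpace.induction_on_inter hgen isPiSystem_isOpen with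
  | empty => simp
  | basic U hU => exact hopen U hU
  | compl A hA ih =>
    have h1 := integral_add_compl (hfm hA) hh'
    have h2 := integral_add_compl hA (integrable_const c : Integrable (fun _ => c) (volume.restrict B))
    rw [preimage_compl]
    linarith
  | iUnion A hd hA ih =>
    rw [preimage_iUnion]
    have h1 := hasSum_integral_iUnion (fun i => hfm (hA i)) (f := h) (μ := volume.restrict (f ⁻¹' B))
      (fun i j hij => (hd hij).preimage f) hh'.integrableOn
    have h2 := hasSum_integral_iUnion hA (f := fun _ => c) (μ := volume.restrict B)
      hd (integrable_const c).integrableOn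
    simp_rw [ih] at h1
    exact h1.unique h2

lemma sign_identity {f : E2 → E2} (hfm : Measurable f) {h : E2 → ℝ} (hhm : Measurable h)
    (hh : Integrable h) {c : ℝ} (hc : 0 ≤ c) {B W : Set E2} (hB : MeasurableSet B)
    (hW : MeasurableSet W) (hfc : ContinuousOn f W) (hinj : InjOn f W)
    (hh0 : ∀ x, f x ∈ B → x ∉ W → h x = 0)
    (hT : ∀ A, MeasurableSet A →
      ∫ x in f ⁻¹' A, h x ∂(volume.restrict (f ⁻¹' B)) = ∫ _y in A, c ∂(volume.restrict B)) :
    ∀ᵐ x ∂(volume.restrict (f ⁻¹' B)), 0 ≤ h x := by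
  have hNm : MeasurableSet (W ∩ {x | h x < 0}) := hW.inter (hhm measurableSet_Iio)
  have hAm : MeasurableSet (f '' (W ∩ {x | h x < 0})) :=
    hNm.image_of_continuousOn_injOn (hfc.mono inter_subset_left) (hinj.mono inter_subset_left)
  have h1 := hT _ hAm
  have hN : MeasurableSet {x | h x < 0} := hhm measurableSet_Iio
  have e : ∫ x in f ⁻¹' (f '' (W ∩ {x | h x < 0})), h x ∂(volume.restrict (f ⁻¹' B)) =
      ∫ x in {x | h x < 0}, h x ∂(volume.restrict (f ⁻¹' B)) := by
    rw [← integral_indicator (hfm hAm), ← integral_indicator hN]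
    refine integral_congr_ae ?_
    filter_upwards [ae_restrict_mem (hfm hB)] with x hx
    by_cases hxW : x ∈ W
    · have : x ∈ f ⁻¹' (f '' (W ∩ {x | h x < 0})) ↔ x ∈ {x | h x < 0} := by
        constructor
        · rintro ⟨z, hz, hzx⟩
          have := hinj hz.1 hxW hzx
          exact this ▸ hz.2
        · intro hx'
          exact ⟨x, ⟨hxW, hx'⟩, rfl⟩
      by_cases hx' : x ∈ {x | h x < 0}
      · rw [indicator_of_mem hx', indicator_of_mem (this.2 hx')]
      · rw [indicator_of_notMem hx', indicator_of_notMem fun h => hx' (this.1 h)]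
    · have h0 := hh0 x hx hxW
      have h0' : ∀ S : Set E2, S.indicator h x = 0 := fun S => by
        by_cases hS : x ∈ S
        · rw [indicator_of_mem hS, h0]
        · exact indicator_of_notMem hS h
      rw [h0', h0']
  have h2 : 0 ≤ ∫ x in {x | h x < 0}, h x ∂(volume.restrict (f ⁻¹' B)) := by
    rw [← e, h1]
    exact integral_nonneg fun _ => hc
  have h3 : ∫ x in {x | h x < 0}, - h x ∂(volume.restrict (f ⁻¹' B)) = 0 := by
    refine le_antisymm ?_ (setIntegral_nonneg hN fun x hx => ?_)
    · rw [integral_neg]; linarith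
    · have : h x < 0 := hx
      linarith
  rw [setIntegral_eq_zero_iff_of_nonneg_ae] at h3
  · rw [Filter.EventuallyEq, ae_restrict_iff' hN] at h3
    filter_upwards [h3] with x hx
    by_contra hcon
    have := hx (not_le.1 hcon)
    simp at this
    exact hcon this.ge
  · rw [Filter.EventuallyLE, ae_restrict_iff' hN]
    refine .of_forall fun x hx => ?_
    have : h x < 0 := hx
    simp only [Pi.zero_apply]
    linarith
  · exact hh.restrict.neg.integrableOn

lemma measure_identity_pos {f : E2 → E2} (hfm : Measurable f) {h : E2 → ℝ} (hhm : Measurable h)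
    (hh : Integrable h) {c : ℝ} (hc : 0 ≤ c) {B : Set E2} (hBb : Bornology.IsBounded B)
    (hpos : ∀ᵐ x ∂(volume.restrict (f ⁻¹' B)), 0 ≤ h x)
    (hT : ∀ A, MeasurableSet A →
      ∫ x in f ⁻¹' A, h x ∂(volume.restrict (f ⁻¹' B)) = ∫ _y in A, c ∂(volume.restrict B)) :
    ((volume.restrict (f ⁻¹' B)).withDensity fun x => ENNReal.ofReal |h x|).map f =
      ENNReal.ofReal |c| • volume.restrict B := by
  have : IsFiniteMeasure (volume.restrict B) := ⟨by simpa using hBb.measure_lt_top⟩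
  ext A hA
  rw [Measure.map_apply hfm hA, withDensity_apply _ (hfm hA), Measure.smul_apply, abs_of_nonneg hc]
  have e : ∫⁻ x in f ⁻¹' A, ENNReal.ofReal |h x| ∂(volume.restrict (f ⁻¹' B)) =
      ENNReal.ofReal (∫ x in f ⁻¹' A, h x ∂(volume.restrict (f ⁻¹' B))) := by
    rw [ofReal_integral_eq_lintegral_ofReal hh.restrict.integrableOn (ae_restrict_of_ae hpos)]
    refine lintegral_congr_ae ?_
    filter_upwards [ae_restrict_of_ae hpos] with x hx
    rw [abs_of_nonneg hx]
  rw [e, hT A hA]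
  simp only [integral_const, measureReal_restrict_apply_univ, smul_eq_mul]
  rw [mul_comm, ENNReal.ofReal_mul hc, ofReal_measureReal]

/-- Summary: sign of the density and the change of variables measure identity. -/
lemma measure_identity {f : E2 → E2} (hfm : Measurable f) {h : E2 → ℝ} (hhm : Measurable h)
    (hh : Integrable h) {c : ℝ} {B W : Set E2} (hB : IsOpen B) (hBb : Bornology.IsBounded B)
    (hW : MeasurableSet W) (hfc : ContinuousOn f W) (hinj : InjOn f W)
    (hh0 : ∀ x, f x ∈ B → x ∉ W → h x = 0)
    (hT : ∀ u : E2 → ℝ, Continuous u → HasCompactSupport u → (∀ y, y ∉ B → u y = 0) →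
      ∫ x, u (f x) * h x = c * ∫ y, u y) :
    ∃ σ : ℝ, (∀ᵐ x ∂(volume.restrict (f ⁻¹' B)), h x = σ * |h x|) ∧ c = σ * |c| ∧
      ((volume.restrict (f ⁻¹' B)).withDensity fun x => ENNReal.ofReal |h x|).map f =
      ENNReal.ofReal |c| • volume.restrict B := by
  rcases le_total 0 c with hc | hc
  · have hS : ∀ A, MeasurableSet A → ∫ x in f ⁻¹' A, h x ∂(volume.restrict (f ⁻¹' B)) =
        ∫ _y in A, c ∂(volume.restrict B) := fun A hA => set_identity hfm hh hB hBb hT hA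
    have hpos := sign_identity hfm hhm hh hc hB.measurableSet hW hfc hinj hh0 hS
    refine ⟨1, ?_, by rw [abs_of_nonneg hc, one_mul],
      measure_identity_pos hfm hhm hh hc hBb hpos hS⟩
    filter_upwards [hpos] with x hx
    rw [abs_of_nonneg hx, one_mul]
  · have hS : ∀ A, MeasurableSet A → ∫ x in f ⁻¹' A, (-h) x ∂(volume.restrict (f ⁻¹' B)) =
        ∫ _y in A, (-c) ∂(volume.restrict B) := fun A hA => by
      have := set_identity hfm hh hB hBb hT hA
      simp only [Pi.neg_apply, integral_neg, this]
    have hpos := sign_identity hfm hhm.neg hh.neg (neg_nonneg.2 hc) hB.measurableSet hW hfc hinj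
      (fun x h1 h2 => by rw [Pi.neg_apply, hh0 x h1 h2, neg_zero]) hS
    refine ⟨-1, ?_, by rw [abs_of_nonpos hc]; ring, ?_⟩
    · filter_upwards [hpos] with x hx
      have : h x ≤ 0 := by simpa using hx
      rw [abs_of_nonpos this]; ring
    · have := measure_identity_pos hfm hhm.neg hh.neg (neg_nonneg.2 hc) hBb hpos hS
      simpa only [Pi.neg_apply, abs_neg] using this

/-! ### The local structure of the map -/

lemma local_geometry {Ω : Set E2} (hΩ : IsOpen Ω) {f : E2 → E2} (hcont : ContinuousOn f Ω)
    (hinj : InjOn f Ω) {x0 : E2} (hx0 : x0 ∈ Ω) :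
    ∃ (R r : ℝ) (χ : E2 → ℝ), 0 < R ∧ 0 < r ∧ Metric.closedBall x0 R ⊆ Ω ∧
      ContDiff ℝ (⊤ : ℕ∞) χ ∧ HasCompactSupport χ ∧ tsupport χ ⊆ Metric.closedBall x0 R ∧
      ∀ x ∈ Metric.closedBall x0 R, f x ∈ Metric.ball (f x0) r → χ =ᶠ[𝓝 x] fun _ => 1 := by
  obtain ⟨R, hR, hRΩ⟩ := Metric.nhds_basis_closedBall.mem_iff.1 (hΩ.mem_nhds hx0)
  let b : ContDiffBump x0 := ⟨R / 2, R, by positivity, by linarith⟩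
  have hAc : IsCompact (f '' (Metric.closedBall x0 R \ Metric.ball x0 (R / 2))) := by
    refine ((isCompact_closedBall x0 R).diff Metric.isOpen_ball).image_of_continuousOn ?_
    exact hcont.mono (sdiff_subset.trans hRΩ)
  have hnot : f x0 ∉ f '' (Metric.closedBall x0 R \ Metric.ball x0 (R / 2)) := by
    rintro ⟨x, hx, hxx⟩
    have := hinj (hRΩ hx.1) hx0 hxx
    rw [this] at hx
    exact hx.2 (Metric.mem_ball_self (by positivity))
  obtain ⟨r, hr, hrA⟩ := Metric.isOpen_iff.1 hAc.isClosed.isOpen_compl (f x0) hnot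
  refine ⟨R, r, b, hR, hr, hRΩ, b.contDiff, b.hasCompactSupport, ?_, ?_⟩
  · rw [b.tsupport_eq]
  · intro x hx hfx
    have : x ∈ Metric.ball x0 (R / 2) := by
      by_contra hcon
      exact hrA hfx ⟨x, ⟨hx, hcon⟩, rfl⟩
    exact b.eventuallyEq_one_of_mem_ball this

lemma jdet_meas {Df : E2 → E2 →L[ℝ] E2} (h : Measurable Df) : Measurable fun x => jdet (Df x) :=
  continuous_jdet.measurable.comp h

lemma cut_jdet_integrable {Ω S : Set E2} {f : E2 → E2} {Df : E2 → E2 →L[ℝ] E2}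
    (hf : MemW12loc Ω f Df) (hS : IsCompact S) (hSΩ : S ⊆ Ω) {χ : E2 → ℝ} (hχ : Continuous χ)
    (hχc : HasCompactSupport χ) (hχS : ∀ x, x ∉ S → χ x = 0) :
    Integrable fun x => χ x * jdet (Df x) := by
  obtain ⟨C, hC⟩ := hχ.bounded_above_of_compact_support hχc
  have h1 := jdet_integrable (memLp_indicator hf hS hSΩ).2
  have h2 : Integrable fun x => χ x * jdet (S.indicator Df x) :=
    h1.bdd_mul (c := C) hχ.aestronglyMeasurable (.of_forall hC)
  refine h2.congr (.of_forall fun x => ?_)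
  by_cases hx : x ∈ S
  · simp only [indicator_of_mem hx]
  · simp only [hχS x hx, zero_mul]

lemma ae_zero_const {Ω : Set E2} (hΩ : IsOpen Ω) {f : E2 → E2} {Df : E2 → E2 →L[ℝ] E2}
    (hcont : ContinuousOn f Ω) (hf : MemW12loc Ω f Df) {x0 : E2} {ε : ℝ} (hε : 0 < ε)
    (hS : Metric.closedBall x0 ε ⊆ Ω)
    (hz : ∀ᵐ x ∂(volume.restrict (Metric.closedBall x0 ε)), Df x = 0) :
    ∀ x ∈ Metric.ball x0 (ε / 2), f x = f x0 := by
  have hSc := isCompact_closedBall x0 ε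
  have hDl : LocallyIntegrable ((Metric.closedBall x0 ε).indicator Df) :=
    (memLp_indicator hf hSc hS).2.locallyIntegrable (by norm_num)
  have hfl : LocallyIntegrable ((Metric.closedBall x0 ε).indicator f) :=
    (locInt_indicator hf hSc hS).locallyIntegrable
  have hK : ∀ x ∈ Metric.ball x0 (ε / 2),
      Metric.closedBall x (ε / 2) ⊆ Metric.closedBall x0 ε := by
    intro x hx y hy
    rw [Metric.mem_ball] at hx
    rw [Metric.mem_closedBall] at hy ⊢
    linarith [dist_triangle y x x0]
  obtain ⟨h1, h2⟩ := ibp_setup hΩ hcont hf (half_pos hε) hSc hS hK hfl hDl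
  have hz' : ∀ n x, mollify n ((Metric.closedBall x0 ε).indicator Df) x = 0 := by
    intro n x
    rw [mollify_eq_swap]
    refine integral_eq_zero_of_ae ?_
    rw [ae_restrict_iff' measurableSet_closedBall] at hz
    filter_upwards [hz] with s hs
    by_cases hs' : s ∈ Metric.closedBall x0 ε
    · rw [indicator_of_mem hs', hs hs', smul_zero]; rfl
    · rw [indicator_of_notMem hs', smul_zero]; rfl
  intro x hx
  have hx0 : x0 ∈ Metric.ball x0 (ε / 2) := Metric.mem_ball_self (half_pos hε)
  refine tendsto_nhds_unique_of_eventuallyEq (h1 x hx) (h1 x0 hx0) ?_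
  filter_upwards [h2] with n hn
  refine Metric.isOpen_ball.is_const_of_fderiv_eq_zero (𝕜 := ℝ)
    (convex_ball x0 (ε / 2)).isPreconnected ?_ ?_ hx hx0
  · exact ((mollify_contDiff n hfl (k := 1)).differentiable (by norm_num)).differentiableOn
  · intro z hz
    rw [hn z hz, hz']; rfl

/-- The local data around a point. -/
structure LocalData (Ω : Set E2) (f : E2 → E2) (Df : E2 → E2 →L[ℝ] E2) (x0 : E2) where
  R : ℝ
  s : ℝ
  χ : E2 → ℝ
  c : ℝ
  σ : ℝ
  hs : 0 < s
  hc : c ≠ 0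
  hσ : σ ≠ 0
  hRΩ : Metric.closedBall x0 R ⊆ Ω
  χsmooth : ContDiff ℝ (⊤ : ℕ∞) χ
  χcomp : HasCompactSupport χ
  χR : tsupport χ ⊆ Metric.closedBall x0 R
  hsurj : Metric.ball (f x0) s ⊆ f '' Metric.closedBall x0 R
  hV : ∀ x ∈ Ω, f x ∈ Metric.ball (f x0) s → x ∈ Metric.closedBall x0 R ∧ χ =ᶠ[𝓝 x] fun _ => 1
  hsign : ∀ᵐ x ∂(volume.restrict (Ω ∩ f ⁻¹' Metric.ball (f x0) s)),
    jdet (Df x) = σ * |jdet (Df x)|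
  hmap : ((volume.restrict (Ω ∩ f ⁻¹' Metric.ball (f x0) s)).withDensity
    fun x => ENNReal.ofReal |jdet (Df x)|).map f =
      ENNReal.ofReal |c| • volume.restrict (Metric.ball (f x0) s)

lemma local_test {Ω : Set E2} (hΩ : IsOpen Ω) {f : E2 → E2} {Df : E2 → E2 →L[ℝ] E2}
    (hcont : ContinuousOn f Ω) (hf : MemW12loc Ω f Df) {x0 : E2} {R r : ℝ} {χ : E2 → ℝ}
    (hRΩ : Metric.closedBall x0 R ⊆ Ω) (hχ : ContDiff ℝ (⊤ : ℕ∞) χ) (hχc : HasCompactSupport χ)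
    (hχR : tsupport χ ⊆ Metric.closedBall x0 R)
    (h1 : ∀ x ∈ Metric.closedBall x0 R, f x ∈ Metric.ball (f x0) r → χ =ᶠ[𝓝 x] fun _ => 1)
    (φ : E2 → ℝ) (hφ : ContDiff ℝ (⊤ : ℕ∞) φ) (hφc : HasCompactSupport φ)
    (hφr : tsupport φ ⊆ Metric.ball (f x0) r) (i : Fin 2) :
    ∫ x, fderiv ℝ φ (f x) (ee i) * (χ x * jdet (Df x)) = 0 := by
  have h := sobolev_ibp hΩ hcont hf hχ hχc (hχR.trans hRΩ) hφ hφc i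
  have e1 : ∫ x, φ (f x) * fderiv ℝ χ x (adj (Df x) (ee i)) = 0 := by
    refine integral_eq_zero_of_ae (.of_forall fun x => ?_)
    change φ (f x) * fderiv ℝ χ x (adj (Df x) (ee i)) = 0
    by_cases hx : x ∈ tsupport χ
    · by_cases hfx : f x ∈ Metric.ball (f x0) r
      · have : fderiv ℝ χ x = 0 := by
          rw [(h1 x (hχR hx) hfx).fderiv_eq]; exact fderiv_const_apply _
        rw [this, zero_apply, mul_zero]
      · have : φ (f x) = 0 := image_eq_zero_of_notMem_tsupport fun h => hfx (hφr h)
        rw [this, zero_mul]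
    · rw [fderiv_zero_off hx, zero_apply, mul_zero]
  rw [e1, neg_zero] at h
  rw [← h]
  congr 1; ext x; ring

lemma local_c_ne_zero {Ω : Set E2} (hΩ : IsOpen Ω) {f : E2 → E2} {Df : E2 → E2 →L[ℝ] E2}
    (hfm : Measurable f) (hcont : ContinuousOn f Ω) (hinj : InjOn f Ω) (hf : MemW12loc Ω f Df)
    {K : E2 → ℝ} (hK1 : ∀ x, 1 ≤ K x)
    (hdist : ∀ᵐ x ∂(volume.restrict Ω), ‖Df x‖ ≤ K x * lstretch (Df x))
    {x0 : E2} (hx0 : x0 ∈ Ω) {s : ℝ} (hs : 0 < s) {χ : E2 → ℝ}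
    (hχ : Continuous χ) (hχ1 : χ =ᶠ[𝓝 x0] fun _ => 1) {c : ℝ}
    (hmap : ((volume.restrict (f ⁻¹' Metric.ball (f x0) s)).withDensity
      fun x => ENNReal.ofReal |χ x * jdet (Df x)|).map f =
      ENNReal.ofReal |c| • volume.restrict (Metric.ball (f x0) s)) : c ≠ 0 := by
  rintro rfl
  rw [abs_zero, ENNReal.ofReal_zero, zero_smul, Measure.map_eq_zero_iff hfm.aemeasurable] at hmap
  have hm : Measurable fun x => ENNReal.ofReal |χ x * jdet (Df x)| :=
    (hχ.measurable.mul (jdet_meas hf.2.1)).abs.ennreal_ofReal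
  rw [withDensity_eq_zero_iff hm.aemeasurable] at hmap
  have hBm : MeasurableSet (f ⁻¹' Metric.ball (f x0) s) := hfm Metric.isOpen_ball.measurableSet
  rw [Filter.EventuallyEq, ae_restrict_iff' hBm] at hmap
  rw [ae_restrict_iff' hΩ.measurableSet] at hdist
  have hn : ∀ᶠ x in 𝓝 x0, x ∈ Ω ∧ χ x = 1 ∧ f x ∈ Metric.ball (f x0) s := by
    filter_upwards [hΩ.mem_nhds hx0, hχ1, (hcont.continuousAt (hΩ.mem_nhds hx0)).eventually
      (Metric.ball_mem_nhds (f x0) hs)] with x h1 h2 h3 using ⟨h1, h2, h3⟩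
  obtain ⟨ε, hε, hεs⟩ := Metric.nhds_basis_closedBall.eventually_iff.1 hn
  have hz : ∀ᵐ x ∂(volume.restrict (Metric.closedBall x0 ε)), Df x = 0 := by
    rw [ae_restrict_iff' measurableSet_closedBall]
    filter_upwards [hmap, hdist] with x h1 h2 hx
    obtain ⟨a1, a2, a3⟩ := hεs hx
    have h3 := h1 a3
    simp only [a2, one_mul, Pi.zero_apply, ENNReal.ofReal_eq_zero] at h3
    have h4 := norm_sq_le_of_dist (hK1 x) (h2 a1)
    have h5 : |jdet (Df x)| = 0 := le_antisymm h3 (abs_nonneg _)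
    rw [h5, mul_zero] at h4
    have : ‖Df x‖ = 0 := by nlinarith [norm_nonneg (Df x)]
    exact norm_eq_zero.1 this
  have hcst := ae_zero_const hΩ hcont hf hε (fun x hx => (hεs hx).1) hz
  have hmem : x0 + (ε / 4) • ee 0 ∈ Metric.ball x0 (ε / 2) := by
    rw [Metric.mem_ball, dist_eq_norm, add_sub_cancel_left, norm_smul, ee_norm,
      Real.norm_of_nonneg (by positivity)]
    linarith
  have hmem2 : x0 + (ε / 4) • ee 0 ∈ Metric.closedBall x0 ε :=
    (Metric.ball_subset_closedBall.trans (Metric.closedBall_subset_closedBall (by linarith))) hmem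
  have h1 := hinj (hεs hmem2).1 hx0 (hcst _ hmem)
  have h2 : (ε / 4) • ee 0 = 0 := by simpa using h1
  have h3 : ‖(ε / 4) • ee 0‖ = ε / 4 := by
    rw [norm_smul, ee_norm, Real.norm_of_nonneg (by positivity), mul_one]
  rw [h2, norm_zero] at h3
  linarith

lemma local_surj {f : E2 → E2} (hfm : Measurable f) {D B : Set E2} (hD : IsCompact D)
    (hcont : ContinuousOn f D) (hB : IsOpen B) {h : E2 → ℝ} (hh : ∀ x, x ∉ D → h x = 0)
    {c : ℝ} (hc : c ≠ 0)
    (hmap : ((volume.restrict (f ⁻¹' B)).withDensity fun x => ENNReal.ofReal |h x|).map f =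
      ENNReal.ofReal |c| • volume.restrict B) : B ⊆ f '' D := by
  intro y hy
  by_contra hcon
  have hUo : IsOpen (B \ f '' D) := hB.sdiff (hD.image_of_continuousOn hcont).isClosed
  have h1 := congrArg (fun m => m (B \ f '' D)) hmap
  simp only [Measure.smul_apply] at h1
  rw [Measure.map_apply hfm hUo.measurableSet, withDensity_apply _ (hfm hUo.measurableSet),
    Measure.restrict_apply hUo.measurableSet, inter_eq_left.2 sdiff_subset] at h1
  have h2 : ∫⁻ x in f ⁻¹' (B \ f '' D), ENNReal.ofReal |h x| ∂(volume.restrict (f ⁻¹' B)) = 0 := by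
    rw [setLIntegral_congr_fun (g := fun _ => 0) (hfm hUo.measurableSet), lintegral_zero]
    intro x hx
    have : x ∉ D := fun hxD => hx.2 ⟨x, hxD, rfl⟩
    simp [hh x this]
  rw [h2, smul_eq_mul, eq_comm, mul_eq_zero] at h1
  rcases h1 with h1 | h1
  · rw [ENNReal.ofReal_eq_zero] at h1
    exact hc (abs_eq_zero.1 (le_antisymm h1 (abs_nonneg _)))
  · exact (hUo.measure_pos volume ⟨y, hy, hcon⟩).ne' h1

lemma exists_localData {Ω : Set E2} (hΩ : IsOpen Ω) {f : E2 → E2} {Df : E2 → E2 →L[ℝ] E2}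
    (hfm : Measurable f) (hcont : ContinuousOn f Ω) (hinj : InjOn f Ω) (hf : MemW12loc Ω f Df)
    {K : E2 → ℝ} (hK1 : ∀ x, 1 ≤ K x)
    (hdist : ∀ᵐ x ∂(volume.restrict Ω), ‖Df x‖ ≤ K x * lstretch (Df x))
    {x0 : E2} (hx0 : x0 ∈ Ω) : Nonempty (LocalData Ω f Df x0) := by
  obtain ⟨R, r, χ, hR, hr, hRΩ, hχ, hχc, hχR, h1⟩ := local_geometry hΩ hcont hinj hx0
  have hχ0 : ∀ x, x ∉ Metric.closedBall x0 R → χ x = 0 := fun x hx =>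
    image_eq_zero_of_notMem_tsupport fun h => hx (hχR h)
  have hh : Integrable fun x => χ x * jdet (Df x) :=
    cut_jdet_integrable hf (isCompact_closedBall x0 R) hRΩ hχ.continuous hχc hχ0
  have hhm : Measurable fun x => χ x * jdet (Df x) :=
    hχ.continuous.measurable.mul (jdet_meas hf.2.1)
  obtain ⟨c, hc⟩ := constancy hfm hh hr (local_test hΩ hcont hf hRΩ hχ hχc hχR h1)
  obtain ⟨σ, hσ, hcσ, hmap⟩ := measure_identity hfm hhm hh Metric.isOpen_ball Metric.isBounded_ball
    (W := Metric.closedBall x0 R) measurableSet_closedBall (hcont.mono hRΩ) (hinj.mono hRΩ)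
    (fun x _ hx => by rw [hχ0 x hx, zero_mul]) hc
  have hball : Metric.ball (f x0) (r / 2) ⊆ Metric.ball (f x0) r :=
    Metric.ball_subset_ball (by linarith)
  have hc0 := local_c_ne_zero hΩ hfm hcont hinj hf hK1 hdist hx0 (half_pos hr) hχ.continuous
    (h1 x0 (Metric.mem_closedBall_self hR.le) (Metric.mem_ball_self hr)) hmap
  have hsurj := local_surj hfm (isCompact_closedBall x0 R) (hcont.mono hRΩ) Metric.isOpen_ball
    (fun x hx => by rw [hχ0 x hx, zero_mul]) hc0 hmap
  have hV : ∀ x ∈ Ω, f x ∈ Metric.ball (f x0) (r / 2) →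
      x ∈ Metric.closedBall x0 R ∧ χ =ᶠ[𝓝 x] fun _ => 1 := by
    intro x hx hfx
    obtain ⟨z, hz, hzx⟩ := hsurj hfx
    have : z = x := hinj (hRΩ hz) hx hzx
    subst this
    exact ⟨hz, h1 z hz (hball hfx)⟩
  have hBm : MeasurableSet (f ⁻¹' Metric.ball (f x0) (r / 2)) :=
    hfm Metric.isOpen_ball.measurableSet
  have hVm : MeasurableSet (Ω ∩ f ⁻¹' Metric.ball (f x0) (r / 2)) := hΩ.measurableSet.inter hBm
  refine ⟨⟨R, r / 2, χ, c, σ, half_pos hr, hc0, ?_, hRΩ, hχ, hχc, hχR, hsurj, hV, ?_, ?_⟩⟩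
  · rintro rfl
    rw [zero_mul] at hcσ
    exact hc0 hcσ
  · rw [ae_restrict_iff' hBm] at hσ
    rw [ae_restrict_iff' hVm]
    filter_upwards [hσ] with x h2 hx
    have h3 := h2 hx.2
    rwa [(hV x hx.1 hx.2).2.eq_of_nhds, one_mul] at h3
  · rw [← hmap]
    congr 1
    rw [← withDensity_indicator hVm, ← withDensity_indicator hBm]
    congr 1
    ext x
    by_cases hx : x ∈ f ⁻¹' Metric.ball (f x0) (r / 2)
    · rw [indicator_of_mem hx]
      by_cases hxΩ : x ∈ Ω
      · rw [indicator_of_mem (show x ∈ Ω ∩ _ from ⟨hxΩ, hx⟩),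
          (hV x hxΩ hx).2.eq_of_nhds, one_mul]
      · rw [indicator_of_notMem fun h => hxΩ h.1, hχ0 x fun h => hxΩ (hRΩ h)]
        simp
    · rw [indicator_of_notMem hx, indicator_of_notMem fun h => hx h.2]

/-! ### The inverse map -/

/-- The inverse, extended by zero. -/
def invMap (Ω : Set E2) (f : E2 → E2) : E2 → E2 := (f '' Ω).indicator (Function.invFunOn f Ω)

/-- Its weak derivative. -/
def invDer (Ω : Set E2) (f : E2 → E2) (Df : E2 → E2 →L[ℝ] E2) : E2 → E2 →L[ℝ] E2 :=
  fun y => (jdet (Df (invMap Ω f y)))⁻¹ • adj (Df (invMap Ω f y))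

lemma invMap_left {Ω : Set E2} {f : E2 → E2} (hinj : InjOn f Ω) {x : E2} (hx : x ∈ Ω) :
    invMap Ω f (f x) = x := by
  unfold invMap
  rw [indicator_of_mem (mem_image_of_mem f hx)]
  exact hinj.leftInvOn_invFunOn hx

lemma image_open {Ω : Set E2} {f : E2 → E2} {Df : E2 → E2 →L[ℝ] E2}
    (hloc : ∀ x0 ∈ Ω, Nonempty (LocalData Ω f Df x0)) : IsOpen (f '' Ω) := by
  rw [Metric.isOpen_iff]
  rintro _ ⟨x0, hx0, rfl⟩
  obtain ⟨d⟩ := hloc x0 hx0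
  exact ⟨d.s, d.hs, d.hsurj.trans (image_mono d.hRΩ)⟩

lemma invMap_cont {Ω : Set E2} {f : E2 → E2} {Df : E2 → E2 →L[ℝ] E2}
    (hcont : ContinuousOn f Ω) (hinj : InjOn f Ω)
    (hloc : ∀ x0 ∈ Ω, Nonempty (LocalData Ω f Df x0)) : ContinuousOn (invMap Ω f) (f '' Ω) := by
  rintro _ ⟨x0, hx0, rfl⟩
  obtain ⟨d⟩ := hloc x0 hx0
  have h : ContinuousOn (invMap Ω f) (Metric.ball (f x0) d.s) := by
    rw [continuousOn_iff_isClosed]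
    intro t ht
    refine ⟨f '' (Metric.closedBall x0 d.R ∩ t), ?_, ?_⟩
    · exact (((isCompact_closedBall x0 d.R).inter_right ht).image_of_continuousOn
        (hcont.mono (inter_subset_left.trans d.hRΩ))).isClosed
    · ext y
      constructor
      · rintro ⟨h1, h2⟩
        obtain ⟨x, hx, rfl⟩ := d.hsurj h2
        rw [mem_preimage, invMap_left hinj (d.hRΩ hx)] at h1
        exact ⟨⟨x, ⟨hx, h1⟩, rfl⟩, h2⟩
      · rintro ⟨⟨x, hx, rfl⟩, h2⟩
        refine ⟨?_, h2⟩
        rw [mem_preimage, invMap_left hinj (d.hRΩ hx.1)]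
        exact hx.2
  exact (h.continuousAt (Metric.ball_mem_nhds _ d.hs)).continuousWithinAt

lemma invMap_meas {Ω : Set E2} {f : E2 → E2} (ho : IsOpen (f '' Ω))
    (hc : ContinuousOn (invMap Ω f) (f '' Ω)) : Measurable (invMap Ω f) := by
  classical
  have h := ContinuousOn.measurable_piecewise (f := invMap Ω f) (g := fun _ => (0 : E2))
    (s := f '' Ω) hc continuousOn_const ho.measurableSet
  have e : (f '' Ω).piecewise (invMap Ω f) (fun _ => (0 : E2)) = invMap Ω f := by
    ext1 y
    by_cases hy : y ∈ f '' Ω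
    · rw [piecewise_eq_of_mem _ _ _ hy]
    · rw [piecewise_eq_of_notMem _ _ _ hy]
      unfold invMap
      rw [indicator_of_notMem hy]
  rwa [e] at h

lemma invDer_meas {Ω : Set E2} {f : E2 → E2} {Df : E2 → E2 →L[ℝ] E2} (hD : Measurable Df)
    (hg : Measurable (invMap Ω f)) : Measurable (invDer Ω f Df) := by
  have h1 : Measurable fun y => Df (invMap Ω f y) := hD.comp hg
  have h2 : Measurable fun y => (jdet (Df (invMap Ω f y)))⁻¹ := (jdet_meas h1).inv
  have h3 : Measurable fun y => adj (Df (invMap Ω f y)) := continuous_adj.measurable.comp h1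
  exact h2.smul h3

lemma lintegral_cov {Ω : Set E2} {f : E2 → E2} {Df : E2 → E2 →L[ℝ] E2} (hfm : Measurable f)
    (hD : Measurable Df) {x0 : E2} (d : LocalData Ω f Df x0) {G : E2 → ℝ≥0∞} (hG : Measurable G) :
    ENNReal.ofReal |d.c| * ∫⁻ y in Metric.ball (f x0) d.s, G y =
      ∫⁻ x in Ω ∩ f ⁻¹' Metric.ball (f x0) d.s, ENNReal.ofReal |jdet (Df x)| * G (f x) := by
  have hm : Measurable fun x => ENNReal.ofReal |jdet (Df x)| := (jdet_meas hD).abs.ennreal_ofReal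
  have hGf : Measurable fun x => G (f x) := hG.comp hfm
  rw [← smul_eq_mul, ← lintegral_smul_measure, ← d.hmap, lintegral_map hG hfm]
  exact lintegral_withDensity_eq_lintegral_mul _ hm hGf

lemma integral_cov {Ω : Set E2} {f : E2 → E2} {Df : E2 → E2 →L[ℝ] E2} (hfm : Measurable f)
    (hD : Measurable Df) {x0 : E2} (d : LocalData Ω f Df x0) {G : E2 → ℝ} (hG : Measurable G) :
    d.σ * |d.c| * ∫ y in Metric.ball (f x0) d.s, G y =
      ∫ x in Ω ∩ f ⁻¹' Metric.ball (f x0) d.s, jdet (Df x) * G (f x) := by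
  have hm : Measurable fun x => ENNReal.ofReal |jdet (Df x)| := (jdet_meas hD).abs.ennreal_ofReal
  have h1 := congrArg (fun m => ∫ y, G y ∂m) d.hmap
  rw [integral_smul_measure, ENNReal.toReal_ofReal (abs_nonneg _),
    integral_map hfm.aemeasurable hG.aestronglyMeasurable,
    integral_withDensity_eq_integral_toReal_smul hm (.of_forall fun x => ENNReal.ofReal_lt_top),
    smul_eq_mul] at h1
  rw [mul_assoc, ← h1, ← integral_const_mul]
  refine integral_congr_ae ?_
  filter_upwards [d.hsign] with x hx
  rw [ENNReal.toReal_ofReal (abs_nonneg _), smul_eq_mul, ← mul_assoc, ← hx]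

lemma invDer_bound {T : E2 →L[ℝ] E2} {k : ℝ} (hk : 1 ≤ k) (h : ‖T‖ ≤ k * lstretch T) :
    |jdet T| * ‖(jdet T)⁻¹ • adj T‖ ^ 2 ≤ 27 * k := by
  have h1 := norm_sq_le_of_dist hk h
  have h2 := norm_adj_le T
  rcases eq_or_ne (jdet T) 0 with h0 | h0
  · rw [h0, abs_zero, zero_mul]; linarith
  · have hp : 0 < |jdet T| := abs_pos.2 h0
    rw [norm_smul, norm_inv, Real.norm_eq_abs, mul_pow]
    have h3 : ‖adj T‖ ^ 2 ≤ (3 * ‖T‖) ^ 2 := by gcongr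
    have h4 : ‖adj T‖ ^ 2 ≤ 27 * k * |jdet T| := by nlinarith
    calc |jdet T| * (|jdet T|⁻¹ ^ 2 * ‖adj T‖ ^ 2) = ‖adj T‖ ^ 2 / |jdet T| := by
          field_simp
      _ ≤ _ := by rw [div_le_iff₀ hp]; exact h4

lemma invDer_local {Ω : Set E2} (hΩ : IsOpen Ω) {f : E2 → E2} {Df : E2 → E2 →L[ℝ] E2}
    (hfm : Measurable f) (hinj : InjOn f Ω) (hD : Measurable Df)
    (hg : Measurable (invMap Ω f)) {K : E2 → ℝ} (hK1 : ∀ x, 1 ≤ K x)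
    (hKloc : ∀ A : Set E2, A ⊆ Ω → IsCompact A → ∫⁻ x in A, ENNReal.ofReal (K x) < ⊤)
    (hdist : ∀ᵐ x ∂(volume.restrict Ω), ‖Df x‖ ≤ K x * lstretch (Df x))
    {x0 : E2} (d : LocalData Ω f Df x0) :
    ∫⁻ y in Metric.ball (f x0) d.s, ENNReal.ofReal (‖invDer Ω f Df y‖ ^ 2) < ⊤ := by
  have hDgm := invDer_meas hD hg
  have hG : Measurable fun y => ENNReal.ofReal (‖invDer Ω f Df y‖ ^ 2) :=
    (hDgm.norm.pow_const 2).ennreal_ofReal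
  have h1 := lintegral_cov hfm hD d hG
  have hc : ENNReal.ofReal |d.c| ≠ 0 := by
    rw [Ne, ENNReal.ofReal_eq_zero, not_le]; exact abs_pos.2 d.hc
  have h2 : ∫⁻ x in Ω ∩ f ⁻¹' Metric.ball (f x0) d.s, ENNReal.ofReal |jdet (Df x)| *
      ENNReal.ofReal (‖invDer Ω f Df (f x)‖ ^ 2) < ⊤ := by
    have hVm : MeasurableSet (Ω ∩ f ⁻¹' Metric.ball (f x0) d.s) :=
      hΩ.measurableSet.inter (hfm Metric.isOpen_ball.measurableSet)
    have h3 : ∫⁻ x in Metric.closedBall x0 d.R, ENNReal.ofReal 27 * ENNReal.ofReal (K x) < ⊤ := by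
      rw [lintegral_const_mul' _ _ ENNReal.ofReal_ne_top]
      exact ENNReal.mul_lt_top ENNReal.ofReal_lt_top (hKloc _ d.hRΩ (isCompact_closedBall _ _))
    refine lt_of_le_of_lt ?_ h3
    refine le_trans ?_ (lintegral_mono_set (s := Ω ∩ f ⁻¹' Metric.ball (f x0) d.s)
      fun x hx => (d.hV x hx.1 hx.2).1)
    refine lintegral_mono_ae ?_
    rw [ae_restrict_iff' hΩ.measurableSet] at hdist
    rw [ae_restrict_iff' hVm]
    filter_upwards [hdist] with x hx hxV
    rw [← ENNReal.ofReal_mul (abs_nonneg _), ← ENNReal.ofReal_mul (by norm_num)]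
    refine ENNReal.ofReal_le_ofReal ?_
    unfold invDer
    rw [invMap_left hinj hxV.1]
    exact invDer_bound (hK1 x) (hx hxV.1)
  rw [← h1] at h2
  by_contra hcon
  rw [not_lt, top_le_iff] at hcon
  rw [hcon, ENNReal.mul_top hc] at h2
  exact lt_irrefl _ h2

lemma invDer_compact {Ω : Set E2} {f : E2 → E2} {F : E2 → ℝ≥0∞} {Df : E2 → E2 →L[ℝ] E2}
    (hloc : ∀ x0 ∈ Ω, ∃ d : LocalData Ω f Df x0, ∫⁻ y in Metric.ball (f x0) d.s, F y < ⊤)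
    {A : Set E2} (hA : IsCompact A) (hAΩ : A ⊆ f '' Ω) : ∫⁻ y in A, F y < ⊤ := by
  refine hA.induction_on (p := fun A => ∫⁻ y in A, F y < ⊤) ?_ ?_ ?_ ?_
  · simp
  · exact fun s t hst ht => (lintegral_mono_set hst).trans_lt ht
  · exact fun s t hs ht => (lintegral_union_le F s t).trans_lt (ENNReal.add_lt_top.2 ⟨hs, ht⟩)
  · intro y hy
    obtain ⟨x0, hx0, rfl⟩ := hAΩ hy
    obtain ⟨d, hd⟩ := hloc x0 hx0
    exact ⟨_, mem_nhdsWithin_of_mem_nhds (Metric.ball_mem_nhds _ d.hs), hd⟩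

/-! ### The weak derivative of the inverse -/

lemma weak_local {Ω : Set E2} (hΩ : IsOpen Ω) {f : E2 → E2} {Df : E2 → E2 →L[ℝ] E2}
    (hfm : Measurable f) (hcont : ContinuousOn f Ω) (hinj : InjOn f Ω) (hf : MemW12loc Ω f Df)
    (hg : Measurable (invMap Ω f)) {K : E2 → ℝ} (hK1 : ∀ x, 1 ≤ K x)
    (hdist : ∀ᵐ x ∂(volume.restrict Ω), ‖Df x‖ ≤ K x * lstretch (Df x))
    {x0 : E2} (d : LocalData Ω f Df x0) {φ : E2 → ℝ} (hφ : ContDiff ℝ (⊤ : ℕ∞) φ)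
    (hφc : HasCompactSupport φ) (hφB : tsupport φ ⊆ Metric.ball (f x0) d.s) (i j : Fin 2) :
    ∫ y, fderiv ℝ φ y (ee i) * (invMap Ω f y) j =
      - ∫ y, φ y * (invDer Ω f Df y (ee i)) j := by
  have hD : Measurable Df := hf.2.1
  have hDgm := invDer_meas hD hg
  have hVm : MeasurableSet (Ω ∩ f ⁻¹' Metric.ball (f x0) d.s) :=
    hΩ.measurableSet.inter (hfm Metric.isOpen_ball.measurableSet)
  have hφ0 : ∀ y, y ∉ Metric.ball (f x0) d.s → φ y = 0 := fun y hy =>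
    image_eq_zero_of_notMem_tsupport fun h => hy (hφB h)
  have hφ1 : ∀ y, y ∉ Metric.ball (f x0) d.s → fderiv ℝ φ y = 0 := fun y hy =>
    fderiv_zero_off fun h => hy (hφB h)
  have hdc : Continuous fun y => fderiv ℝ φ y (ee i) :=
    (hφ.continuous_fderiv (by simp)).clm_apply continuous_const
  have hpj : ∀ j : Fin 2, Measurable fun v : E2 => v j := fun j =>
    (EuclideanSpace.proj (𝕜 := ℝ) j : E2 →L[ℝ] ℝ).continuous.measurable
  have hG1 : Measurable fun y => fderiv ℝ φ y (ee i) * (invMap Ω f y) j :=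
    hdc.measurable.mul ((hpj j).comp hg)
  have hap : Measurable fun y => invDer Ω f Df y (ee i) :=
    (ContinuousLinearMap.apply ℝ E2 (ee i)).continuous.measurable.comp hDgm
  have hG2 : Measurable fun y => φ y * (invDer Ω f Df y (ee i)) j :=
    hφ.continuous.measurable.mul ((hpj j).comp hap)
  have e1 := integral_cov hfm hD d hG1
  have e2 := integral_cov hfm hD d hG2
  rw [setIntegral_eq_integral_of_forall_compl_eq_zero
    (fun y hy => by rw [hφ1 y hy]; simp)] at e1
  rw [setIntegral_eq_integral_of_forall_compl_eq_zero
    (fun y hy => by rw [hφ0 y hy, zero_mul])] at e2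
  have hpjs : ContDiff ℝ (⊤ : ℕ∞) fun v : E2 => v j :=
    (EuclideanSpace.proj (𝕜 := ℝ) j : E2 →L[ℝ] ℝ).contDiff
  have hχj : ContDiff ℝ (⊤ : ℕ∞) fun x => d.χ x * x j := d.χsmooth.mul hpjs
  have hχjc : HasCompactSupport fun x => d.χ x * x j := d.χcomp.mul_right
  have hts : tsupport (fun x => d.χ x * x j) ⊆ tsupport d.χ := tsupport_mul_subset_left
  have hχjΩ : tsupport (fun x => d.χ x * x j) ⊆ Ω := hts.trans (d.χR.trans d.hRΩ)
  have e3 := sobolev_ibp hΩ hcont hf hχj hχjc hχjΩ hφ hφc i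
  have e4 : ∫ x, d.χ x * x j * fderiv ℝ φ (f x) (ee i) * jdet (Df x) =
      ∫ x in Ω ∩ f ⁻¹' Metric.ball (f x0) d.s,
        jdet (Df x) * (fderiv ℝ φ (f x) (ee i) * (invMap Ω f (f x)) j) := by
    rw [← setIntegral_eq_integral_of_forall_compl_eq_zero
      (s := Ω ∩ f ⁻¹' Metric.ball (f x0) d.s)]
    · refine setIntegral_congr_fun hVm fun x hx => ?_
      have h1 : d.χ x = 1 := (d.hV x hx.1 hx.2).2.eq_of_nhds
      change d.χ x * x j * fderiv ℝ φ (f x) (ee i) * jdet (Df x) =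
        jdet (Df x) * (fderiv ℝ φ (f x) (ee i) * (invMap Ω f (f x)) j)
      rw [invMap_left hinj hx.1, h1]
      ring
    · intro x hx
      by_cases hxΩ : x ∈ Ω
      · have hb : f x ∉ Metric.ball (f x0) d.s := fun h => hx ⟨hxΩ, h⟩
        rw [hφ1 _ hb]; simp
      · have hz : d.χ x = 0 := image_eq_zero_of_notMem_tsupport
          fun h => hxΩ (d.hRΩ (d.χR h))
        rw [hz]; ring
  have e5 : ∫ x, φ (f x) * fderiv ℝ (fun x => d.χ x * x j) x (adj (Df x) (ee i)) =
      ∫ x in Ω ∩ f ⁻¹' Metric.ball (f x0) d.s,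
        jdet (Df x) * (φ (f x) * (invDer Ω f Df (f x) (ee i)) j) := by
    rw [← setIntegral_eq_integral_of_forall_compl_eq_zero
      (s := Ω ∩ f ⁻¹' Metric.ball (f x0) d.s)]
    · refine setIntegral_congr_ae hVm ?_
      rw [ae_restrict_iff' hΩ.measurableSet] at hdist
      filter_upwards [hdist] with x hxd hx
      have hev : (fun x => d.χ x * x j) =ᶠ[𝓝 x] fun x : E2 => x j := by
        filter_upwards [(d.hV x hx.1 hx.2).2] with z hz
        rw [hz, one_mul]
      have hfd : fderiv ℝ (fun x => d.χ x * x j) x =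
          (EuclideanSpace.proj (𝕜 := ℝ) j : E2 →L[ℝ] ℝ) := by
        rw [hev.fderiv_eq]
        exact (EuclideanSpace.proj (𝕜 := ℝ) j : E2 →L[ℝ] ℝ).fderiv
      rw [hfd]
      unfold invDer
      rw [invMap_left hinj hx.1]
      have hsq := norm_sq_le_of_dist (hK1 x) (hxd hx.1)
      change φ (f x) * (adj (Df x) (ee i)) j =
        jdet (Df x) * (φ (f x) * ((jdet (Df x))⁻¹ * (adj (Df x) (ee i)) j))
      rcases eq_or_ne (jdet (Df x)) 0 with h0 | h0
      · rw [h0, abs_zero, mul_zero] at hsq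
        have hn : Df x = 0 := by
          rw [← norm_eq_zero]
          exact pow_eq_zero_iff (two_ne_zero) |>.1 (le_antisymm hsq (sq_nonneg _))
        rw [adj_apply, hn]
        simp
      · field_simp
    · intro x hx
      by_cases hxΩ : x ∈ Ω
      · have hb : f x ∉ Metric.ball (f x0) d.s := fun h => hx ⟨hxΩ, h⟩
        rw [hφ0 _ hb, zero_mul]
      · have hz : fderiv ℝ (fun x => d.χ x * x j) x = 0 :=
          fderiv_zero_off fun h => hxΩ (hχjΩ h)
        rw [hz]; simp
  rw [e4, e5, ← e1, ← e2, ← mul_neg] at e3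
  exact mul_left_cancel₀ (mul_ne_zero d.hσ (abs_ne_zero.2 d.hc)) e3

/-- Smooth decomposition of a test function subordinate to a cover. -/
lemma exists_decomp {φ : E2 → ℝ} (hφ : ContDiff ℝ (⊤ : ℕ∞) φ) (hφc : HasCompactSupport φ)
    {ι : Type} (U : ι → Set E2) (hU : ∀ k, IsOpen (U k)) (hcov : tsupport φ ⊆ ⋃ k, U k) :
    ∃ (t : Finset ι) (ψ : ι → E2 → ℝ), (∀ k ∈ t, ContDiff ℝ (⊤ : ℕ∞) (ψ k)) ∧
      (∀ k ∈ t, HasCompactSupport (ψ k)) ∧ (∀ k ∈ t, tsupport (ψ k) ⊆ U k) ∧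
      (∀ k ∈ t, tsupport (ψ k) ⊆ tsupport φ) ∧ ∀ x, φ x = ∑ k ∈ t, ψ k x := by
  classical
  obtain ⟨t, ht⟩ := IsCompact.elim_finite_subcover (s := tsupport φ) hφc U hU hcov
  have ht' : tsupport φ ⊆ ⋃ k : t, U k := by
    intro x hx
    obtain ⟨k, hk, hx⟩ := mem_iUnion₂.1 (ht hx)
    exact mem_iUnion.2 ⟨⟨k, hk⟩, hx⟩
  obtain ⟨p, hp⟩ := SmoothPartitionOfUnity.exists_isSubordinate (modelWithCornersSelf ℝ E2)
    (isClosed_tsupport φ) (fun k : t => U k) (fun k => hU k) ht'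
  refine ⟨t, fun k x => if h : k ∈ t then p ⟨k, h⟩ x * φ x else 0, ?_, ?_, ?_, ?_, ?_⟩
  · intro k hk
    simp only [dif_pos hk]
    exact (contMDiff_iff_contDiff.1 (p ⟨k, hk⟩).contMDiff).mul hφ
  · intro k hk
    simp only [dif_pos hk]
    exact hφc.mul_left
  · intro k hk
    simp only [dif_pos hk]
    exact tsupport_mul_subset_left.trans (hp ⟨k, hk⟩)
  · intro k hk
    simp only [dif_pos hk]
    exact tsupport_mul_subset_right
  · intro x
    rw [← Finset.sum_attach]
    have : ∀ k ∈ t.attach, (if h : (k : ι) ∈ t then p ⟨k, h⟩ x * φ x else 0) = p k x * φ x :=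
      fun k _ => by rw [dif_pos k.2]
    rw [Finset.sum_congr rfl this, ← Finset.sum_mul]
    by_cases hx : x ∈ tsupport φ
    · have h1 := p.sum_eq_one hx
      rw [finsum_eq_sum_of_fintype] at h1
      have h2 : ∑ k ∈ t.attach, p k x = 1 := h1
      rw [h2, one_mul]
    · rw [image_eq_zero_of_notMem_tsupport hx, mul_zero]

lemma smul_integrable_of_loc {U : Set E2} {F : E2 → E2} (hF : LocallyIntegrableOn F U)
    {ψ : E2 → ℝ} (hψ : Continuous ψ) (hψc : HasCompactSupport ψ) (hψU : tsupport ψ ⊆ U) :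
    Integrable fun y => ψ y • F y := by
  have h1 : IntegrableOn F (tsupport ψ) := hF.integrableOn_compact_subset hψU hψc
  have h2 : IntegrableOn (fun y => ψ y • F y) (tsupport ψ) :=
    h1.continuousOn_smul hψ.continuousOn hψc
  refine (integrableOn_iff_integrable_of_support_subset ?_).1 h2
  intro y hy
  by_contra hcon
  apply hy
  change ψ y • F y = 0
  rw [image_eq_zero_of_notMem_tsupport hcon, zero_smul]

lemma locInt_of_sq {U : Set E2} (hU : IsOpen U) {T : E2 → E2 →L[ℝ] E2} (hT : Measurable T)
    (h : ∀ A : Set E2, A ⊆ U → IsCompact A → ∫⁻ x in A, ENNReal.ofReal (‖T x‖ ^ 2) < ⊤)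
    (i : Fin 2) : LocallyIntegrableOn (fun y => T y (ee i)) U := by
  rw [locallyIntegrableOn_iff hU.isLocallyClosed]
  intro A hAU hA
  have hap : Measurable fun y => T y (ee i) :=
    (ContinuousLinearMap.apply ℝ E2 (ee i)).continuous.measurable.comp hT
  have h1 : IntegrableOn (fun x => ‖T x‖ ^ 2) A := by
    refine ⟨(hT.norm.pow_const 2).aestronglyMeasurable, ?_⟩
    rw [hasFiniteIntegral_iff_ofReal (.of_forall fun x => sq_nonneg _)]
    exact h A hAU hA
  have h2 : IntegrableOn (fun _ : E2 => (1 : ℝ)) A :=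
    integrableOn_const hA.measure_lt_top.ne
  refine Integrable.mono' (h2.add h1) hap.aestronglyMeasurable (.of_forall fun x => ?_)
  have h3 : ‖T x (ee i)‖ ≤ ‖T x‖ := by
    have := (T x).le_opNorm (ee i)
    rwa [ee_norm, mul_one] at this
  change ‖T x (ee i)‖ ≤ 1 + ‖T x‖ ^ 2
  nlinarith [sq_nonneg (‖T x‖ - 1), norm_nonneg (T x)]

lemma integral_coord {F : E2 → E2} (hF : Integrable F) (j : Fin 2) :
    (∫ y, F y) j = ∫ y, F y j :=
  ((EuclideanSpace.proj (𝕜 := ℝ) j : E2 →L[ℝ] ℝ).integral_comp_comm hF).symm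

lemma fderiv_tsupp {φ : E2 → ℝ} (v : E2) :
    tsupport (fun y => fderiv ℝ φ y v) ⊆ tsupport φ := by
  refine closure_minimal ?_ (isClosed_tsupport φ)
  intro y hy
  by_contra h
  apply hy
  change fderiv ℝ φ y v = 0
  rw [fderiv_zero_off h]
  rfl

/-- The regularity of the inverse for measurable `f`. -/
lemma inverse_main {Ω : Set E2} (hΩ : IsOpen Ω) {f : E2 → E2} {Df : E2 → E2 →L[ℝ] E2}
    (hfm : Measurable f) (hcont : ContinuousOn f Ω) (hinj : InjOn f Ω) (hf : MemW12loc Ω f Df)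
    {K : E2 → ℝ} (hK1 : ∀ x, 1 ≤ K x)
    (hKloc : ∀ A : Set E2, A ⊆ Ω → IsCompact A → ∫⁻ x in A, ENNReal.ofReal (K x) < ⊤)
    (hdist : ∀ᵐ x ∂(volume.restrict Ω), ‖Df x‖ ≤ K x * lstretch (Df x)) :
    IsOpen (f '' Ω) ∧ ContinuousOn (invMap Ω f) (f '' Ω) ∧
      MemW12loc (f '' Ω) (invMap Ω f) (invDer Ω f Df) := by
  have hloc : ∀ x0 ∈ Ω, Nonempty (LocalData Ω f Df x0) := fun x0 hx0 =>
    exists_localData hΩ hfm hcont hinj hf hK1 hdist hx0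
  have ho := image_open hloc
  have hgc := invMap_cont hcont hinj hloc
  have hg := invMap_meas ho hgc
  have hDg := invDer_meas hf.2.1 hg
  have hsq : ∀ A : Set E2, A ⊆ f '' Ω → IsCompact A →
      ∫⁻ y in A, ENNReal.ofReal (‖invDer Ω f Df y‖ ^ 2) < ⊤ := fun A hAU hA =>
    invDer_compact (Df := Df) (fun x0 hx0 => ⟨(hloc x0 hx0).some,
      invDer_local hΩ hfm hinj hf.2.1 hg hK1 hKloc hdist _⟩) hA hAU
  have hgl : LocallyIntegrableOn (invMap Ω f) (f '' Ω) := hgc.locallyIntegrableOn ho.measurableSet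
  refine ⟨ho, hgc, hgl, hDg, hsq, ?_⟩
  intro φ hφ hφc hφU i
  change (∫ y in f '' Ω, fderiv ℝ φ y (ee i) • invMap Ω f y) =
    - ∫ y in f '' Ω, φ y • invDer Ω f Df y (ee i)
  have hl2 := locInt_of_sq ho hDg hsq i
  have hI1 : ∀ ψ : E2 → ℝ, ContDiff ℝ (⊤ : ℕ∞) ψ → HasCompactSupport ψ → tsupport ψ ⊆ f '' Ω →
      Integrable fun y => fderiv ℝ ψ y (ee i) • invMap Ω f y := by
    intro ψ h1 h2 h3
    have hdc : Continuous fun y => fderiv ℝ ψ y (ee i) :=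
      (h1.continuous_fderiv (by simp)).clm_apply continuous_const
    have hcs : HasCompactSupport fun y => fderiv ℝ ψ y (ee i) :=
      IsCompact.of_isClosed_subset h2 (isClosed_tsupport _) (fderiv_tsupp (ee i))
    exact smul_integrable_of_loc hgl hdc hcs ((fderiv_tsupp (ee i)).trans h3)
  have hI2 : ∀ ψ : E2 → ℝ, ContDiff ℝ (⊤ : ℕ∞) ψ → HasCompactSupport ψ → tsupport ψ ⊆ f '' Ω →
      Integrable fun y => ψ y • invDer Ω f Df y (ee i) := fun ψ h1 h2 h3 =>
    smul_integrable_of_loc hl2 h1.continuous h2 h3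
  rw [setIntegral_eq_integral_of_forall_compl_eq_zero (fun y hy => by
      rw [fderiv_zero_off fun h => hy (hφU h)]; simp),
    setIntegral_eq_integral_of_forall_compl_eq_zero (fun y hy => by
      rw [image_eq_zero_of_notMem_tsupport fun h => hy (hφU h), zero_smul])]
  obtain ⟨t, ψ, hs, hc, hsub, hsub', hsum⟩ := exists_decomp hφ hφc
    (fun k : Ω => Metric.ball (f k) (hloc k k.2).some.s) (fun k => Metric.isOpen_ball) (by
      intro y hy
      obtain ⟨x, hx, rfl⟩ := hφU hy
      exact mem_iUnion.2 ⟨⟨x, hx⟩, Metric.mem_ball_self (hloc x hx).some.hs⟩)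
  have hfd : ∀ y, fderiv ℝ φ y (ee i) = ∑ k ∈ t, fderiv ℝ (ψ k) y (ee i) := by
    intro y
    have e : φ = fun y => ∑ k ∈ t, ψ k y := funext hsum
    have hd : ∀ k ∈ t, DifferentiableAt ℝ (ψ k) y := fun k hk =>
      (hs k hk).differentiable (by simp) y
    rw [e, fderiv_fun_sum hd]
    simp
  have hE1 : ∫ y, fderiv ℝ φ y (ee i) • invMap Ω f y =
      ∑ k ∈ t, ∫ y, fderiv ℝ (ψ k) y (ee i) • invMap Ω f y := by
    rw [← integral_finset_sum _ fun k hk => hI1 _ (hs k hk) (hc k hk) ((hsub' k hk).trans hφU)]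
    refine integral_congr_ae (.of_forall fun y => ?_)
    change fderiv ℝ φ y (ee i) • invMap Ω f y = _
    rw [hfd, Finset.sum_smul]
  have hE2 : ∫ y, φ y • invDer Ω f Df y (ee i) =
      ∑ k ∈ t, ∫ y, ψ k y • invDer Ω f Df y (ee i) := by
    rw [← integral_finset_sum _ fun k hk => hI2 _ (hs k hk) (hc k hk) ((hsub' k hk).trans hφU)]
    refine integral_congr_ae (.of_forall fun y => ?_)
    change φ y • invDer Ω f Df y (ee i) = _
    rw [hsum, Finset.sum_smul]
  rw [hE1, hE2, ← Finset.sum_neg_distrib]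
  refine Finset.sum_congr rfl fun k hk => ?_
  ext j
  rw [PiLp.neg_apply, integral_coord (hI1 _ (hs k hk) (hc k hk) ((hsub' k hk).trans hφU)),
    integral_coord (hI2 _ (hs k hk) (hc k hk) ((hsub' k hk).trans hφU))]
  exact weak_local hΩ hfm hcont hinj hf hg hK1 hdist (hloc k k.2).some (hs k hk) (hc k hk)
    (hsub k hk) i j

lemma memW12_congr {Ω : Set E2} (hΩ : IsOpen Ω) {f f' : E2 → E2} {Df : E2 → E2 →L[ℝ] E2}
    (h : EqOn f f' Ω) (hf : MemW12loc Ω f Df) : MemW12loc Ω f' Df := by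
  obtain ⟨h1, h2, h3, h4⟩ := hf
  refine ⟨?_, h2, h3, ?_⟩
  · rw [locallyIntegrableOn_iff hΩ.isLocallyClosed] at h1 ⊢
    intro k hk hkc
    exact (h1 k hk hkc).congr_fun (fun x hx => h (hk hx)) hkc.measurableSet
  · intro φ a b c i
    rw [← h4 φ a b c i]
    refine setIntegral_congr_fun hΩ.measurableSet fun x hx => ?_
    change _ • f' x = _ • f x
    rw [h hx]

/-- **Sobolev regularity of the inverse** (euclidean case of Theorem 1.3): an injective
continuous mapping of finite distortion with locally integrable distortion is a
homeomorphism onto its (open) image, and its inverse lies in `W^{1,2}_loc`. -/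
theorem inverse_in_W12loc
    (Ω : Set E2) (hΩopen : IsOpen Ω)
    (f : E2 → E2) (Df : E2 → E2 →L[ℝ] E2)
    (hcont : ContinuousOn f Ω) (hinj : InjOn f Ω)
    (hf : MemW12loc Ω f Df)
    (K : E2 → ℝ) (hKmeas : Measurable K) (hK1 : ∀ x, 1 ≤ K x)
    (hKloc : ∀ A : Set E2, A ⊆ Ω → IsCompact A →
      ∫⁻ x in A, ENNReal.ofReal (K x) < ⊤)
    (hdist : ∀ᵐ x ∂(volume.restrict Ω), ‖Df x‖ ≤ K x * lstretch (Df x)) :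
    IsOpen (f '' Ω) ∧
    ∃ g : E2 → E2,
      ContinuousOn g (f '' Ω) ∧
      (∀ x ∈ Ω, g (f x) = x) ∧
      (∀ y ∈ f '' Ω, g y ∈ Ω ∧ f (g y) = y) ∧
      ∃ Dg : E2 → E2 →L[ℝ] E2, MemW12loc (f '' Ω) g Dg := by
  classical
  have hEq : EqOn f (Ω.piecewise f (fun _ => (0 : E2))) Ω := fun x hx =>
    (piecewise_eq_of_mem _ _ _ hx).symm
  have hfm : Measurable (Ω.piecewise f (fun _ => (0 : E2))) :=
    ContinuousOn.measurable_piecewise hcont continuousOn_const hΩopen.measurableSet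
  generalize Ω.piecewise f (fun _ => (0 : E2)) = f' at hEq hfm
  have him : f '' Ω = f' '' Ω := hEq.image_eq
  have hc' : ContinuousOn f' Ω := hcont.congr hEq.symm
  have hi' : InjOn f' Ω := hinj.congr hEq
  have key := inverse_main hΩopen hfm hc' hi' (memW12_congr hΩopen hEq hf) hK1 hKloc hdist
  rw [him]
  refine ⟨key.1, invMap Ω f', key.2.1, ?_, ?_, _, key.2.2⟩
  · intro x hx
    rw [hEq hx]
    exact invMap_left hi' hx
  · rintro _ ⟨x, hx, rfl⟩
    rw [invMap_left hi' hx]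
    exact ⟨hx, hEq hx⟩
end
end

section
/- (Euclidean case of Lemma 5.1, quantitative L² bound for the inverse gradient.) Let Ω ⊆ ℝ² be open and let f : Ω → ℝ² be continuous and injective, lying in W^{1,2}_loc(Ω,ℝ²) with weak derivative Df. Suppose there is a measurable function K : Ω → ℝ with K(x) ≥ 1 for all x, with K integrable on compact subsets of Ω, and such that ‖Df(x)‖ ≤ K(x) · l(Df(x)) for almost every x ∈ Ω. Define ψ : f(Ω) → [0,∞] by ψ(y) = 1 / l(Df(f⁻¹(y))) (with 1/0 = ∞). Then for every Borel set E ⊆ f(Ω) one has ∫_E ψ(y)² dy ≤ 2 ∫_{f⁻¹(E)} K(x) dx; in particular ψ is square-integrable on every compact subset of f(Ω). -/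
open MeasureTheory Set
open scoped ENNReal Real Topology

noncomputable section

theorem isSimplyConnected_univ_complex : IsSimplyConnected (univ : Set ℂ) := by
  have : SimplyConnectedSpace (univ : Set ℂ) :=
    haveI : ContractibleSpace (univ : Set ℂ) := (Homeomorph.Set.univ ℂ).contractibleSpace
    inferInstance
  exact this

/-- The Brouwer fixed point theorem on the closed unit disc of `ℂ`. -/
theorem brouwer_unit_complex (F : ℂ → ℂ) (hF : ContinuousOn F (Metric.closedBall 0 1))
    (hm : MapsTo F (Metric.closedBall 0 1) (Metric.closedBall 0 1)) :
    ∃ x ∈ Metric.closedBall (0 : ℂ) 1, F x = x := by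
  by_contra! hne
  set p : ℂ → ℂ := fun x => ((max 1 ‖x‖)⁻¹ : ℝ) • x with hp
  have hpos : ∀ x : ℂ, 0 < max 1 ‖x‖ := fun x => lt_of_lt_of_le one_pos (le_max_left _ _)
  have hpc : Continuous p := by
    refine Continuous.smul (Continuous.inv₀ (by fun_prop) fun x => (hpos x).ne') continuous_id
  have hpm : ∀ x, p x ∈ Metric.closedBall (0 : ℂ) 1 := by
    intro x
    rw [mem_closedBall_zero_iff, hp]
    simp only [norm_smul, norm_inv, Real.norm_eq_abs, abs_of_pos (hpos x)]
    rw [inv_mul_le_iff₀ (hpos x), mul_one]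
    exact le_max_right _ _
  have hp1 : ∀ x : ℂ, ‖x‖ = 1 → p x = x := by
    intro x hx
    simp [hp, hx]
  have hFp : Continuous fun x => F (p x) := hF.comp_continuous hpc hpm
  obtain ⟨L, hL, hLe⟩ := Complex.exists_continuousOn_eqOn_exp_comp isSimplyConnected_univ_complex
    isOpen_univ (g := fun x => p x - F (p x)) (hpc.sub hFp).continuousOn (by
      rintro ⟨x, -, hx⟩
      exact hne (p x) (hpm x) (sub_eq_zero.1 hx).symm)
  rw [continuousOn_univ] at hL
  set e : ℝ → ℂ := fun t => Complex.exp (t * Complex.I) with he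
  have hec : Continuous e := by fun_prop
  have hen : ∀ t, ‖e t‖ = 1 := fun t => Complex.norm_exp_ofReal_mul_I t
  have hem : ∀ t, e t ∈ Metric.closedBall (0 : ℂ) 1 := fun t => by simp [hen]
  have hF2 : Continuous fun t => F (e t) := hF.comp_continuous hec hem
  set q : ℝ → ℂ := fun t => (e t - F (e t)) * (e t)⁻¹ with hq
  have hen0 : ∀ t, e t ≠ 0 := fun t => Complex.exp_ne_zero _
  have hqc : Continuous q := (hec.sub hF2).mul (hec.inv₀ hen0)
  have hqs : ∀ t, q t ∈ Complex.slitPlane := by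
    intro t
    left
    have h1 : q t = 1 - F (e t) * (e t)⁻¹ := by
      simp only [hq]; rw [sub_mul, mul_inv_cancel₀ (hen0 t)]
    set w := F (e t) * (e t)⁻¹ with hw
    have hwn : ‖w‖ ≤ 1 := by
      rw [hw, norm_mul, norm_inv, hen]
      simpa using hm (hem t)
    have hw1 : w ≠ 1 := by
      intro h
      apply hne (e t) (hem t)
      have := congrArg (· * e t) h
      simpa [hw, mul_assoc, hen0 t] using this
    rw [h1, Complex.sub_re, Complex.one_re, sub_pos]
    have hle : w.re ≤ 1 := (Complex.re_le_norm w).trans hwn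
    refine lt_of_le_of_ne hle fun h => hw1 ?_
    have h2 : w.re ^ 2 + w.im ^ 2 ≤ 1 := by
      have := Complex.sq_norm w
      rw [Complex.normSq_apply] at this
      nlinarith [norm_nonneg w]
    have h3 : w.im = 0 := by rw [h] at h2; nlinarith [sq_nonneg w.im]
    exact Complex.ext (by simpa using h) (by simpa using h3)
  set h : ℝ → ℂ := fun t => t * Complex.I + Complex.log (q t) - L (e t) with hh
  have hhc : Continuous h := by
    have : Continuous fun t => Complex.log (q t) := hqc.clog hqs
    have : Continuous fun t => L (e t) := hL.comp hec
    fun_prop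
  have hint : ∀ t, ∃ n : ℤ, (h t).im / (2 * π) = n := by
    intro t
    have h1 : Complex.exp (h t) = 1 := by
      have h2 : Complex.exp (L (e t)) = e t - F (e t) := by
        have := hLe (mem_univ (e t))
        simpa [hp1 _ (hen t)] using this
      have hne' : e t - F (e t) ≠ 0 := sub_ne_zero.2 (hne _ (hem t)).symm
      simp only [hh]
      rw [Complex.exp_sub, Complex.exp_add, Complex.exp_log (Complex.slitPlane_ne_zero (hqs t)), h2]
      change e t * ((e t - F (e t)) * (e t)⁻¹) / _ = 1
      field_simp [hen0 t]
    obtain ⟨n, hn⟩ := Complex.exp_eq_one_iff.1 h1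
    refine ⟨n, ?_⟩
    rw [hn]
    have : (2 * π : ℝ) ≠ 0 := by positivity
    simp
  have hk : Continuous fun t => (h t).im / (2 * π) := by fun_prop
  have he0 : e (2 * π) = e 0 := by
    simp [he, Complex.exp_two_pi_mul_I]
  have hend : (h (2 * π)).im / (2 * π) = (h 0).im / (2 * π) + 1 := by
    have hq0 : q (2 * π) = q 0 := by simp only [hq, he0]
    have : (2 * π : ℝ) ≠ 0 := by positivity
    simp only [hh, he0, hq0]
    simp
    field_simp
    ring
  obtain ⟨n, hn⟩ := hint 0
  have hmem : (n : ℝ) + 1 / 2 ∈ Icc ((h 0).im / (2 * π)) ((h (2 * π)).im / (2 * π)) := by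
    rw [hend, hn]; constructor <;> linarith
  obtain ⟨t, -, ht⟩ := intermediate_value_Icc (by positivity) hk.continuousOn hmem
  obtain ⟨m, hm'⟩ := hint t
  simp only at ht
  rw [hm'] at ht
  have : (2 * m : ℝ) = 2 * n + 1 := by linarith
  have : 2 * m = 2 * n + 1 := by exact_mod_cast this
  omega

/-- The Brouwer fixed point theorem on closed discs of the plane. -/
theorem brouwer_E2 (c : E2) (r : ℝ) (hr : 0 < r) (F : E2 → E2)
    (hF : ContinuousOn F (Metric.closedBall c r))
    (hm : MapsTo F (Metric.closedBall c r) (Metric.closedBall c r)) :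
    ∃ x ∈ Metric.closedBall c r, F x = x := by
  let T := Complex.orthonormalBasisOneI.repr
  let A : ℂ → E2 := fun z => c + r • T z
  let A' : E2 → ℂ := fun x => T.symm (r⁻¹ • (x - c))
  have hA : Continuous A := by fun_prop
  have hA' : Continuous A' := by fun_prop
  have hAm : MapsTo A (Metric.closedBall 0 1) (Metric.closedBall c r) := by
    intro z hz
    rw [mem_closedBall_zero_iff] at hz
    simp only [A, mem_closedBall_iff_norm, add_sub_cancel_left, norm_smul, T.norm_map,
      Real.norm_eq_abs, abs_of_pos hr]
    nlinarith
  have hAm' : MapsTo A' (Metric.closedBall c r) (Metric.closedBall 0 1) := by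
    intro z hz
    rw [mem_closedBall_iff_norm] at hz
    simp only [A', mem_closedBall_zero_iff, norm_smul, T.symm.norm_map,
      Real.norm_eq_abs, abs_of_pos (inv_pos.2 hr)]
    rwa [inv_mul_le_iff₀ hr, mul_one]
  have hAA : ∀ x, A (A' x) = x := by
    intro x
    simp only [A, A', LinearIsometryEquiv.apply_symm_apply, smul_smul, mul_inv_cancel₀ hr.ne',
      one_smul, add_sub_cancel]
  obtain ⟨z, hz, hzF⟩ := brouwer_unit_complex (fun z => A' (F (A z)))
    (hA'.comp_continuousOn (hF.comp hA.continuousOn hAm))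
    (fun z hz => hAm' (hm (hAm hz)))
  refine ⟨A z, hAm hz, ?_⟩
  have := congrArg A hzF
  simpa only [hAA] using this

theorem closedBall_subset_image_of_near_id (c : E2) (r δ : ℝ) (hr : 0 < r) (h : E2 → E2)
    (hc : ContinuousOn h (Metric.closedBall c r))
    (hd : ∀ y ∈ Metric.closedBall c r, dist (h y) y ≤ δ) :
    Metric.closedBall c (r - δ) ⊆ h '' Metric.closedBall c r := by
  intro z hz
  obtain ⟨y, hy, hyF⟩ := brouwer_E2 c r hr (fun y => y - h y + z)
    (by fun_prop) (by
      intro y hy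
      have h1 := hd y hy
      rw [dist_comm, dist_eq_norm] at h1
      rw [mem_closedBall_iff_norm] at hz ⊢
      calc ‖y - h y + z - c‖ = ‖(y - h y) + (z - c)‖ := by congr 1; abel
        _ ≤ δ + (r - δ) := (norm_add_le _ _).trans (add_le_add h1 hz)
        _ = r := by ring)
  refine ⟨y, hy, ?_⟩
  have : y - h y + z = y := hyF
  have h2 : z - h y = 0 := by
    calc z - h y = (y - h y + z) - y := by abel
      _ = 0 := by rw [this, sub_self]
  exact (sub_eq_zero.1 h2).symm


/-- Invariance of domain in the plane, local form (after Kulpa and Tao). -/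
theorem invariance_of_domain_ball (x₀ : E2) (r : ℝ) (hr : 0 < r) (f : E2 → E2)
    (hf : ContinuousOn f (Metric.closedBall x₀ r)) (hinj : InjOn f (Metric.closedBall x₀ r)) :
    f x₀ ∈ interior (f '' Metric.closedBall x₀ r) := by
  set B := Metric.closedBall x₀ r with hB
  have hBc : IsCompact B := isCompact_closedBall _ _
  have hx₀ : x₀ ∈ B := Metric.mem_closedBall_self hr.le
  have hSc : IsCompact (f '' B) := hBc.image_of_continuousOn hf
  -- the inverse, extended by Tietze
  obtain ⟨G, hGc, hG⟩ : ∃ G : E2 → E2, Continuous G ∧ ∀ x ∈ B, G (f x) = x - x₀ := by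
    have : CompactSpace B := isCompact_iff_compactSpace.1 hBc
    have hcl : Topology.IsClosedEmbedding (B.domRestrict f) :=
      Continuous.isClosedEmbedding (continuousOn_iff_continuous_domRestrict.1 hf)
        (injOn_iff_injective.1 hinj)
    obtain ⟨g, hg⟩ := ContinuousMap.exists_extension hcl
      (⟨fun x : B => (x : E2) - x₀, by fun_prop⟩ : C(B, E2))
    refine ⟨g, g.continuous, fun x hx => ?_⟩
    have := congrArg (fun h : C(B, E2) => h ⟨x, hx⟩) hg
    simpa using this
  have hG0 : G (f x₀) = 0 := by rw [hG x₀ hx₀, sub_self]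
  have stab : ∀ H : E2 → E2, ContinuousOn H (f '' B) → (∀ y ∈ f '' B, ‖G y - H y‖ ≤ r) →
      ∃ y ∈ f '' B, H y = 0 := by
    intro H hH hd
    obtain ⟨x, hx, hxe⟩ := brouwer_E2 x₀ r hr (fun x => x - H (f x))
      (continuousOn_id.sub (hH.comp hf (mapsTo_image f B))) (by
        intro x hx
        rw [mem_closedBall_iff_norm]
        have := hd (f x) (mem_image_of_mem f hx)
        rw [hG x hx] at this
        rwa [sub_right_comm])
    exact ⟨f x, mem_image_of_mem f hx, by simpa using hxe⟩
  by_contra hint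
  set y₀ := f x₀ with hy₀
  obtain ⟨δ, hδ, hGδ⟩ : ∃ δ > 0, ∀ y, dist y y₀ < 2 * δ → ‖G y‖ < r / 10 := by
    obtain ⟨d, hd, h⟩ := Metric.continuous_iff.1 hGc y₀ (r / 10) (by positivity)
    refine ⟨d / 2, by positivity, fun y hy => ?_⟩
    have := h y (by linarith)
    rwa [hG0, dist_zero_right] at this
  obtain ⟨c, hcb, hcS⟩ : ∃ c, dist c y₀ < δ ∧ c ∉ f '' B := by
    by_contra! h
    exact hint (mem_interior_iff_mem_nhds.2 (Filter.mem_of_superset (Metric.ball_mem_nhds y₀ hδ)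
      fun c hc => h c hc))
  set S1 : Set E2 := {y | y ∈ f '' B ∧ δ ≤ dist y c} with hS1
  have hS1c : IsCompact S1 := hSc.inter_right (isClosed_le (f := fun _ : E2 => δ) (g := fun y => dist y c)
    continuous_const (by fun_prop))
  obtain ⟨m, hm, hGm⟩ : ∃ m > 0, ∀ y ∈ S1, m ≤ ‖G y‖ := by
    rcases S1.eq_empty_or_nonempty with h | h
    · exact ⟨1, one_pos, by simp [h]⟩
    · obtain ⟨y, hy, hmin⟩ := hS1c.exists_isMinOn h hGc.norm.continuousOn
      refine ⟨‖G y‖, ?_, fun z hz => hmin hz⟩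
      rw [gt_iff_lt, norm_pos_iff]
      obtain ⟨⟨x, hx, rfl⟩, hyd⟩ := hy
      rw [hG x hx]
      intro h0
      rw [sub_eq_zero] at h0
      subst h0
      rw [dist_comm] at hyd
      linarith
  set η := min (m / 2) (r / 10) with hη
  have hηpos : 0 < η := by positivity
  have hη1 : η ≤ m / 2 := min_le_left _ _
  have hη2 : η ≤ r / 10 := min_le_right _ _
  obtain ⟨P, hP, hPG, -⟩ := hGc.exists_contDiff_approx 1 (ε := fun _ => η) continuous_const
    (fun _ => hηpos)
  have hnull : (volume : Measure E2) (P '' Metric.sphere c δ) = 0 :=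
    addHaar_image_eq_zero_of_differentiableOn_of_addHaar_eq_zero _
      (hP.differentiable (by simp)).differentiableOn (Measure.addHaar_sphere _ _ _)
  obtain ⟨v, hv, hvP⟩ : ∃ v ∈ Metric.ball (0 : E2) η, v ∉ P '' Metric.sphere c δ := by
    by_contra! h
    have h1 := measure_mono_null h hnull
    exact (Metric.measure_ball_pos volume (0 : E2) hηpos).ne' h1
  rw [mem_ball_zero_iff] at hv
  have hPG' : ∀ y, ‖G y - (P y - v)‖ < 2 * η := by
    intro y
    have := hPG y
    rw [dist_comm, dist_eq_norm] at this
    calc ‖G y - (P y - v)‖ = ‖(G y - P y) + v‖ := by congr 1; abel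
      _ ≤ ‖G y - P y‖ + ‖v‖ := norm_add_le _ _
      _ < 2 * η := by linarith
  set Φ : E2 → E2 := fun y => c + (max (δ / dist y c) 1) • (y - c) with hΦ
  have hdpos : ∀ y ∈ f '' B, 0 < dist y c := fun y hy =>
    dist_pos.2 fun h => hcS (h ▸ hy)
  have hΦc : ContinuousOn Φ (f '' B) := by
    have h1 : ContinuousOn (fun y => δ / dist y c) (f '' B) :=
      continuousOn_const.div (by fun_prop) fun y hy => (hdpos y hy).ne'
    fun_prop
  have hΦ1 : ∀ y ∈ f '' B, δ ≤ dist y c → Φ y = y := by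
    intro y hy h
    have : max (δ / dist y c) 1 = 1 := max_eq_right ((div_le_one (hdpos y hy)).2 h)
    simp [hΦ, this]
  have hΦ2 : ∀ y ∈ f '' B, dist y c < δ → Φ y ∈ Metric.sphere c δ := by
    intro y hy h
    have h0 := hdpos y hy
    have : max (δ / dist y c) 1 = δ / dist y c := max_eq_left ((one_le_div h0).2 h.le)
    rw [mem_sphere_iff_norm]
    simp only [hΦ, this, add_sub_cancel_left, norm_smul, Real.norm_eq_abs,
      abs_of_pos (div_pos hδ h0)]
    rw [← dist_eq_norm]
    field_simp
  obtain ⟨y, hy, hy0⟩ := stab (fun y => P (Φ y) - v)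
    ((hP.continuous.comp_continuousOn hΦc).sub continuousOn_const) (by
      intro y hy
      rcases le_or_gt δ (dist y c) with h | h
      · rw [hΦ1 y hy h]
        linarith [hPG' y]
      · have h2 := hΦ2 y hy h
        rw [Metric.mem_sphere] at h2
        have e1 := hGδ y (by linarith [dist_triangle y c y₀])
        have e2 := hGδ (Φ y) (by linarith [dist_triangle (Φ y) c y₀])
        have e3 := hPG' (Φ y)
        calc ‖G y - (P (Φ y) - v)‖ = ‖G y - G (Φ y) + (G (Φ y) - (P (Φ y) - v))‖ := by
              congr 1; abel
          _ ≤ (‖G y‖ + ‖G (Φ y)‖) + ‖G (Φ y) - (P (Φ y) - v)‖ :=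
              (norm_add_le _ _).trans (add_le_add_left (norm_sub_le _ _) _)
          _ ≤ r := by linarith)
  rcases le_or_gt δ (dist y c) with h | h
  · rw [hΦ1 y hy h] at hy0
    have h1 := hPG' y
    rw [hy0, sub_zero] at h1
    linarith [hGm y ⟨hy, h⟩]
  · exact hvP ⟨Φ y, hΦ2 y hy h, sub_eq_zero.1 hy0⟩

/-- Openness of continuous injective maps on open subsets of the plane. -/
theorem image_open_of_injOn (Ω : Set E2) (hΩ : IsOpen Ω) (f : E2 → E2)
    (hf : ContinuousOn f Ω) (hinj : InjOn f Ω) (U : Set E2) (hU : IsOpen U) (hUΩ : U ⊆ Ω) :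
    IsOpen (f '' U) := by
  rw [isOpen_iff_mem_nhds]
  rintro _ ⟨x, hx, rfl⟩
  obtain ⟨r, hr, hb⟩ := Metric.nhds_basis_closedBall.mem_iff.1 (hU.mem_nhds hx)
  have := invariance_of_domain_ball x r hr f (hf.mono (hb.trans hUΩ)) (hinj.mono (hb.trans hUΩ))
  exact Filter.mem_of_superset (mem_interior_iff_mem_nhds.1 this) (image_mono hb)

theorem invFunOn_continuousOn (Ω : Set E2) (hΩ : IsOpen Ω) (f : E2 → E2)
    (hf : ContinuousOn f Ω) (hinj : InjOn f Ω) :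
    ContinuousOn (Function.invFunOn f Ω) (f '' Ω) := by
  rintro _ ⟨x, hx, rfl⟩
  refine ContinuousAt.continuousWithinAt ?_
  rw [ContinuousAt, hinj.leftInvOn_invFunOn hx]
  intro W hW
  obtain ⟨U, hUW, hUo, hxU⟩ := mem_nhds_iff.1 (Filter.inter_mem hW (hΩ.mem_nhds hx))
  have ho := image_open_of_injOn Ω hΩ f hf hinj U hUo (fun z hz => (hUW hz).2)
  rw [Filter.mem_map]
  refine Filter.mem_of_superset (ho.mem_nhds (mem_image_of_mem f hxU)) ?_
  rintro _ ⟨z, hz, rfl⟩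
  rw [mem_preimage, hinj.leftInvOn_invFunOn (hUW hz).2]
  exact (hUW hz).1

theorem isCompact_preimage_of_injOn (Ω : Set E2) (hΩ : IsOpen Ω) (f : E2 → E2)
    (hf : ContinuousOn f Ω) (hinj : InjOn f Ω) (A : Set E2) (hA : IsCompact A)
    (hAΩ : A ⊆ f '' Ω) : IsCompact (Ω ∩ f ⁻¹' A) := by
  have h1 := hA.image_of_continuousOn ((invFunOn_continuousOn Ω hΩ f hf hinj).mono hAΩ)
  convert h1 using 1
  ext x
  constructor
  · rintro ⟨hx, hxA⟩
    exact ⟨f x, hxA, hinj.leftInvOn_invFunOn hx⟩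
  · rintro ⟨y, hy, rfl⟩
    obtain ⟨z, hz, rfl⟩ := hAΩ hy
    rw [hinj.leftInvOn_invFunOn hz]
    exact ⟨hz, hy⟩


/-- In the plane, `|det T| ≤ ‖T‖ * ‖T v‖` for every unit vector `v`. -/
theorem abs_det_le_norm_mul (T : E2 →L[ℝ] E2) (v : E2) (hv : ‖v‖ = 1) :
    |T.det| ≤ ‖T‖ * ‖T v‖ := by
  set a := v 0
  set b := v 1
  have hab : a ^ 2 + b ^ 2 = 1 := by
    have := EuclideanSpace.real_norm_sq_eq v
    rw [hv, Fin.sum_univ_two] at this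
    simp only [one_pow] at this
    exact this.symm
  set w : E2 := !₂[-b, a] with hw
  have hwn : ‖w‖ = 1 := by
    have := EuclideanSpace.real_norm_sq_eq w
    rw [Fin.sum_univ_two] at this
    simp only [hw] at this
    simp at this
    have h2 : ‖w‖ ^ 2 = 1 := by rw [hw]; linarith
    nlinarith [norm_nonneg w]
  set e0 : E2 := EuclideanSpace.single 0 1 with he0
  set e1 : E2 := EuclideanSpace.single 1 1 with he1
  have hv' : v = a • e0 + b • e1 := by
    ext i; fin_cases i <;> simp [a, b, e0, e1]
  have hw' : w = (-b) • e0 + a • e1 := by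
    ext i; fin_cases i <;> simp [hw, e0, e1]
  have hdet : T.det = (T e0) 0 * (T e1) 1 - (T e1) 0 * (T e0) 1 := by
    have h1 : T.det = LinearMap.det (T : E2 →ₗ[ℝ] E2) := rfl
    rw [h1, ← LinearMap.det_toMatrix (EuclideanSpace.basisFun (Fin 2) ℝ).toBasis,
      Matrix.det_fin_two]
    simp [LinearMap.toMatrix_apply, e0, e1]
  have hTv0 : ∀ i, (T v) i = a * (T e0) i + b * (T e1) i := by
    intro i; rw [hv', map_add, map_smul, map_smul]; simp
  have hTw0 : ∀ i, (T w) i = -b * (T e0) i + a * (T e1) i := by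
    intro i; rw [hw', map_add, map_smul, map_smul]; simp
  have key : T.det = (T v) 0 * (T w) 1 - (T v) 1 * (T w) 0 := by
    rw [hTv0, hTv0, hTw0, hTw0, hdet]
    linear_combination (-((T e0) 0 * (T e1) 1 - (T e1) 0 * (T e0) 1)) * hab
  have n1 := EuclideanSpace.real_norm_sq_eq (T v)
  have n2 := EuclideanSpace.real_norm_sq_eq (T w)
  rw [Fin.sum_univ_two] at n1 n2
  have h3 : |T.det| ≤ ‖T v‖ * ‖T w‖ := by
    apply abs_le_of_sq_le_sq _ (by positivity)
    rw [key, mul_pow, n1, n2]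
    nlinarith [sq_nonneg ((T v) 0 * (T w) 0 + (T v) 1 * (T w) 1)]
  have h4 : ‖T w‖ ≤ ‖T‖ := by simpa [hwn] using T.le_opNorm w
  nlinarith [norm_nonneg (T v)]

theorem abs_det_le_norm_mul_lstretch (T : E2 →L[ℝ] E2) :
    |T.det| ≤ ‖T‖ * lstretch T := by
  have hne : ((fun v => ‖T v‖) '' {v : E2 | ‖v‖ = 1}).Nonempty :=
    ⟨_, EuclideanSpace.single 0 1, by simp, rfl⟩
  rcases (norm_nonneg T).eq_or_lt with h | h
  · have := abs_det_le_norm_mul T (EuclideanSpace.single 0 1) (by simp)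
    rw [← h, zero_mul] at this ⊢
    exact this
  · rw [← div_le_iff₀' h]
    refine le_csInf hne ?_
    rintro _ ⟨v, hv, rfl⟩
    rw [div_le_iff₀' h]
    exact abs_det_le_norm_mul T v hv

theorem abs_det_le_norm_sq (T : E2 →L[ℝ] E2) : |T.det| ≤ ‖T‖ ^ 2 := by
  have h := abs_det_le_norm_mul T (EuclideanSpace.single 0 1) (by simp)
  have h4 : ‖T (EuclideanSpace.single 0 1)‖ ≤ ‖T‖ := by
    simpa using T.le_opNorm (EuclideanSpace.single 0 1)
  nlinarith [norm_nonneg T]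

theorem det_mul_inv_sq_le (T : E2 →L[ℝ] E2) (k : ℝ) (hT : ‖T‖ ≤ k * lstretch T) :
    ENNReal.ofReal |T.det| * ((ENNReal.ofReal (lstretch T))⁻¹) ^ 2 ≤ ENNReal.ofReal k := by
  have h1 := abs_det_le_norm_mul_lstretch T
  have h0 : 0 ≤ lstretch T := by
    apply Real.sInf_nonneg
    rintro _ ⟨v, -, rfl⟩
    positivity
  rcases h0.eq_or_lt with h | h
  · rw [← h, mul_zero] at h1
    rw [ENNReal.ofReal_eq_zero.2 h1, zero_mul]
    exact zero_le
  · rw [← ENNReal.ofReal_inv_of_pos h, ← ENNReal.ofReal_pow (by positivity),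
      ← ENNReal.ofReal_mul (abs_nonneg _)]
    apply ENNReal.ofReal_le_ofReal
    rw [inv_pow, ← div_eq_mul_inv, div_le_iff₀ (by positivity)]
    nlinarith

/-- A Fatou-type argument (generalized dominated convergence). -/
theorem fatou_bound {α : Type*} [MeasurableSpace α] (μ : Measure α)
    (g G : ℕ → α → ℝ≥0∞) (g' G' : α → ℝ≥0∞) (I : ℕ → ℝ≥0∞) (V : ℝ≥0∞)
    (hg : ∀ n, Measurable (g n)) (hG : ∀ n, Measurable (G n)) (hg' : Measurable g')
    (hle : ∀ n x, g n x ≤ G n x) (hle' : ∀ x, g' x ≤ G' x) (hfin : ∀ x, G' x ≠ ⊤)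
    (hgt : ∀ᵐ x ∂μ, Filter.Tendsto (fun n => g n x) Filter.atTop (𝓝 (g' x)))
    (hGt : ∀ᵐ x ∂μ, Filter.Tendsto (fun n => G n x) Filter.atTop (𝓝 (G' x)))
    (hV : ∀ n, V ≤ ∫⁻ x, g n x ∂μ) (hI : ∀ n, ∫⁻ x, G n x ∂μ ≤ I n)
    (hIt : Filter.Tendsto I Filter.atTop (𝓝 (∫⁻ x, G' x ∂μ)))
    (hIfin : ∫⁻ x, G' x ∂μ ≠ ⊤) :
    V ≤ ∫⁻ x, g' x ∂μ := by
  have h1 : ∫⁻ x, (G' x - g' x) ∂μ ≤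
      Filter.liminf (fun n => ∫⁻ x, (G n x - g n x) ∂μ) Filter.atTop := by
    refine le_trans (le_of_eq (lintegral_congr_ae ?_))
      (lintegral_liminf_le fun n => (hG n).sub (hg n))
    filter_upwards [hgt, hGt] with x h1 h2
    exact ((ENNReal.Tendsto.sub h2 h1 (Or.inl (hfin x))).liminf_eq).symm
  have h2 : ∫⁻ x, g' x ∂μ + ∫⁻ x, (G' x - g' x) ∂μ = ∫⁻ x, G' x ∂μ := by
    rw [← lintegral_add_left hg']
    exact lintegral_congr fun x => add_tsub_cancel_of_le (hle' x)
  have h3 : ∀ n, V + ∫⁻ x, (G n x - g n x) ∂μ ≤ I n := by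
    intro n
    calc V + ∫⁻ x, (G n x - g n x) ∂μ ≤ ∫⁻ x, g n x ∂μ + ∫⁻ x, (G n x - g n x) ∂μ := by
          gcongr; exact hV n
      _ = ∫⁻ x, G n x ∂μ := by
          rw [← lintegral_add_left (hg n)]
          exact lintegral_congr fun x => add_tsub_cancel_of_le (hle n x)
      _ ≤ I n := hI n
  have hVfin : V ≠ ⊤ := by
    intro hV'
    have : ∀ n, I n = ⊤ := fun n => by
      have := h3 n
      rw [hV', top_add, top_le_iff] at this
      exact this
    have h4 : Filter.Tendsto I Filter.atTop (𝓝 ⊤) := by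
      simp only [funext this]; exact tendsto_const_nhds
    exact hIfin (tendsto_nhds_unique hIt h4)
  have h4 : V + ∫⁻ x, (G' x - g' x) ∂μ ≤ ∫⁻ x, G' x ∂μ := by
    have h5 : ∫⁻ x, (G' x - g' x) ∂μ ≤ ∫⁻ x, G' x ∂μ - V := by
      refine h1.trans ?_
      have h6 : Filter.Tendsto (fun n => I n - V) Filter.atTop (𝓝 (∫⁻ x, G' x ∂μ - V)) :=
        ENNReal.Tendsto.sub hIt tendsto_const_nhds (Or.inl hIfin)
      rw [← h6.liminf_eq]
      exact Filter.liminf_le_liminf (Filter.Eventually.of_forall fun n =>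
        ENNReal.le_sub_of_add_le_left hVfin (h3 n))
    have hVI : V ≤ ∫⁻ x, G' x ∂μ :=
      ge_of_tendsto' hIt fun n => le_trans le_self_add (h3 n)
    calc V + ∫⁻ x, (G' x - g' x) ∂μ ≤ V + (∫⁻ x, G' x ∂μ - V) := by gcongr
      _ = _ := add_tsub_cancel_of_le hVI
  rw [← h2] at h4
  refine (ENNReal.add_le_add_iff_right ?_).1 h4
  refine ne_top_of_le_ne_top hIfin (lintegral_mono fun x => tsub_le_self)

open ContinuousLinearMap in
/-- Jensen for mollifications. -/
theorem norm_sq_convolution_le {F : Type*} [NormedAddCommGroup F] [NormedSpace ℝ F]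
    (φ : ContDiffBump (0 : E2)) (u : E2 → F) (hu : LocallyIntegrable u)
    (hu2 : LocallyIntegrable (fun x => ‖u x‖ ^ 2)) (x : E2) :
    ‖(convolution (φ.normed volume) u (lsmul ℝ ℝ) volume) x‖ ^ 2 ≤
      (convolution (φ.normed volume) (fun x => ‖u x‖ ^ 2) (lsmul ℝ ℝ) volume) x := by
  set ρ := φ.normed (volume : Measure E2) with hρ
  have hρc : Continuous ρ := φ.continuous_normed
  have hρs : HasCompactSupport ρ := φ.hasCompactSupport_normed
  have i1 : Integrable (fun t => ρ t * ‖u (x - t)‖) := by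
    simpa using! hρs.convolutionExists_left (lsmul ℝ ℝ) hρc (fun y => (hu y).norm) x
  have i2 : Integrable (fun t => ρ t * ‖u (x - t)‖ ^ 2) := by
    simpa using! hρs.convolutionExists_left (lsmul ℝ ℝ) hρc hu2 x
  have i0 : Integrable ρ := φ.integrable_normed
  set m := ∫ t, ρ t * ‖u (x - t)‖ with hm
  have h1 : ‖(convolution ρ u (lsmul ℝ ℝ) volume) x‖ ≤ m := by
    rw [convolution_def]
    refine (norm_integral_le_integral_norm _).trans (le_of_eq ?_)
    congr 1; ext t
    simp [norm_smul, abs_of_nonneg (φ.nonneg_normed t), hρ]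
  have h2 : 0 ≤ ∫ t, ρ t * (‖u (x - t)‖ - m) ^ 2 :=
    integral_nonneg fun t => mul_nonneg (φ.nonneg_normed t) (sq_nonneg _)
  have h3 : ∫ t, ρ t * (‖u (x - t)‖ - m) ^ 2 =
      (∫ t, ρ t * ‖u (x - t)‖ ^ 2) - 2 * m * m + m ^ 2 * 1 := by
    have : ∀ t, ρ t * (‖u (x - t)‖ - m) ^ 2 =
      (ρ t * ‖u (x - t)‖ ^ 2 - 2 * m * (ρ t * ‖u (x - t)‖)) + m ^ 2 * ρ t := fun t => by ring
    simp_rw [this]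
    have i3 : Integrable (fun t => ρ t * ‖u (x - t)‖ ^ 2 - 2 * m * (ρ t * ‖u (x - t)‖)) :=
      i2.sub (i1.const_mul _)
    rw [integral_add i3 (i0.const_mul _),
      integral_sub i2 (i1.const_mul _), integral_const_mul, integral_const_mul,
      φ.integral_normed]
  have h4 : (convolution ρ (fun x => ‖u x‖ ^ 2) (lsmul ℝ ℝ) volume) x
      = ∫ t, ρ t * ‖u (x - t)‖ ^ 2 := by
    simp [convolution_def]
  rw [h4]
  nlinarith [norm_nonneg ((convolution ρ u (lsmul ℝ ℝ) volume) x)]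

open ContinuousLinearMap in
/-- Mass of a mollification over a compact set. -/
theorem lintegral_convolution_le (φ : ContDiffBump (0 : E2)) (q : E2 → ℝ) (hqm : Measurable q)
    (hq0 : ∀ x, 0 ≤ q x) (hq : LocallyIntegrable q) (C : Set E2) (hC : IsClosed C) :
    ∫⁻ x in C, ENNReal.ofReal ((convolution (φ.normed volume) q (lsmul ℝ ℝ) volume) x) ≤
      ∫⁻ x in Metric.cthickening φ.rOut C, ENNReal.ofReal (q x) := by
  set ρ := φ.normed (volume : Measure E2) with hρ
  have hρc : Continuous ρ := φ.continuous_normed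
  have hρs : HasCompactSupport ρ := φ.hasCompactSupport_normed
  have h1 : ∀ x, ENNReal.ofReal ((convolution ρ q (lsmul ℝ ℝ) volume) x) =
      ∫⁻ t, ENNReal.ofReal (ρ t) * ENNReal.ofReal (q (x - t)) := by
    intro x
    have i1 : Integrable (fun t => ρ t * q (x - t)) := by
      simpa using! hρs.convolutionExists_left (lsmul ℝ ℝ) hρc hq x
    have h4 : (convolution ρ q (lsmul ℝ ℝ) volume) x = ∫ t, ρ t * q (x - t) := by
      simp [convolution_def]
    rw [h4, ofReal_integral_eq_lintegral_ofReal i1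
      (Filter.Eventually.of_forall fun t => mul_nonneg (φ.nonneg_normed t) (hq0 _))]
    exact lintegral_congr fun t => ENNReal.ofReal_mul (φ.nonneg_normed t)
  simp_rw [h1]
  rw [lintegral_lintegral_swap (by
    apply Measurable.aemeasurable
    have := hρc.measurable
    fun_prop)]
  have h2 : ∀ t, ∫⁻ x in C, ENNReal.ofReal (ρ t) * ENNReal.ofReal (q (x - t)) ≤
      ENNReal.ofReal (ρ t) * ∫⁻ x in Metric.cthickening φ.rOut C, ENNReal.ofReal (q x) := by
    intro t
    rw [lintegral_const_mul _ (by fun_prop)]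
    by_cases ht : t ∈ Function.support ρ
    · refine mul_le_mul' le_rfl ?_
      rw [φ.support_normed_eq, mem_ball_zero_iff] at ht
      rw [← lintegral_indicator hC.measurableSet,
        ← lintegral_indicator Metric.isClosed_cthickening.measurableSet]
      rw [← lintegral_add_right_eq_self _ t]
      refine lintegral_mono fun z => ?_
      by_cases hz : z + t ∈ C
      · have hz' : z ∈ Metric.cthickening φ.rOut C :=
          Metric.mem_cthickening_of_dist_le z (z + t) _ _ hz (by simpa using ht.le)
        simp [indicator_of_mem hz, indicator_of_mem hz']
      · simp [indicator_of_notMem hz]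
    · rw [Function.notMem_support.1 ht]; simp
  refine (lintegral_mono h2).trans ?_
  rw [lintegral_mul_const _ (by have := hρc.measurable; fun_prop)]
  rw [← ofReal_integral_eq_lintegral_ofReal φ.integrable_normed
    (Filter.Eventually.of_forall φ.nonneg_normed), φ.integral_normed]
  simp


open ContinuousLinearMap in
/-- The derivative of a mollification is the mollification of the weak derivative. -/
theorem hasFDerivAt_mollify (Ω : Set E2) (f : E2 → E2) (Df : E2 → E2 →L[ℝ] E2)
    (hf : MemW12loc Ω f Df) (A : Set E2) (hA : MeasurableSet A) (hAΩ : A ⊆ Ω)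
    (hfA : LocallyIntegrable (A.indicator f)) (hDA : LocallyIntegrable (A.indicator Df))
    (φ : ContDiffBump (0 : E2)) (x : E2) (hx : Metric.closedBall x φ.rOut ⊆ A) :
    HasFDerivAt (convolution (φ.normed volume) (A.indicator f) (lsmul ℝ ℝ) volume)
      ((convolution (φ.normed volume) (A.indicator Df) (lsmul ℝ ℝ) volume) x) x := by
  set ρ := φ.normed (volume : Measure E2) with hρ
  have hρd : ContDiff ℝ (⊤ : ℕ∞) ρ := φ.contDiff_normed
  have hρc : Continuous ρ := φ.continuous_normed
  have hρs : HasCompactSupport ρ := φ.hasCompactSupport_normed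
  have hρd1 : ContDiff ℝ 1 ρ := φ.contDiff_normed
  have hρsupp : ∀ y, y ∉ Metric.closedBall x φ.rOut → x - y ∉ tsupport ρ := by
    intro y hy h
    rw [hρ, φ.tsupport_normed_eq, mem_closedBall_zero_iff] at h
    rw [mem_closedBall_iff_norm'] at hy
    exact hy h
  have hρ0 : ∀ y, y ∉ A → ρ (x - y) = 0 := fun y hy =>
    image_eq_zero_of_notMem_tsupport (hρsupp y fun h => hy (hx h))
  have hρ'0 : ∀ y, y ∉ A → fderiv ℝ ρ (x - y) = 0 := fun y hy => by
    by_contra hne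
    exact hρsupp y (fun h => hy (hx h)) (support_fderiv_subset ℝ (Function.mem_support.2 hne))
  have h1 := hρs.hasFDerivAt_convolution_left (lsmul ℝ ℝ) hρd1 hfA x
  convert! h1 using 1
  have e1 := hρs.convolutionExists_left (lsmul ℝ ℝ) hρc hDA x
  have e2 := (hρs.fderiv ℝ).convolutionExists_left ((lsmul ℝ ℝ).precompL E2)
    (hρd1.continuous_fderiv one_ne_zero) hfA x
  -- the test function
  set θ : E2 → ℝ := fun y => ρ (x - y) with hθ
  have hθd : ContDiff ℝ (⊤ : ℕ∞) θ := hρd.comp (by fun_prop)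
  have hθt : tsupport θ ⊆ Metric.closedBall x φ.rOut := by
    refine closure_minimal ?_ Metric.isClosed_closedBall
    intro y hy
    by_contra h
    have h0 : ρ (x - y) = 0 := image_eq_zero_of_notMem_tsupport (hρsupp y h)
    exact hy h0
  have hθs : HasCompactSupport θ :=
    (isCompact_closedBall x φ.rOut).of_isClosed_subset (isClosed_tsupport _) hθt
  have hθ' : ∀ y v, fderiv ℝ θ y v = - fderiv ℝ ρ (x - y) v := by
    intro y v
    have hd : HasFDerivAt (fun y : E2 => x - y) (-ContinuousLinearMap.id ℝ E2) y :=
      (hasFDerivAt_id y).const_sub x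
    have := ((hρd1.differentiable one_ne_zero (x - y)).hasFDerivAt.comp y hd).fderiv
    have h' : fderiv ℝ θ y = (fderiv ℝ ρ (x - y)).comp (-ContinuousLinearMap.id ℝ E2) := this
    rw [h']; simp
  have hweak := hf.2.2.2 θ hθd hθs (hθt.trans (hx.trans hAΩ))
  have hbasis : ∀ i : Fin 2,
      (convolution ρ (A.indicator Df) (lsmul ℝ ℝ) volume x) (EuclideanSpace.single i 1) =
      (convolution (fderiv ℝ ρ) (A.indicator f) ((lsmul ℝ ℝ).precompL E2) volume x)
        (EuclideanSpace.single i 1) := by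
    intro i
    set v : E2 := EuclideanSpace.single i 1 with hv
    rw [convolution_def, convolution_def,
      ContinuousLinearMap.integral_apply e1, ContinuousLinearMap.integral_apply e2]
    have s1 : ∫ t, ((lsmul ℝ ℝ) (ρ t) (A.indicator Df (x - t))) v =
        ∫ y in Ω, θ y • Df y v := by
      rw [← integral_sub_left_eq_self _ volume x,
        ← setIntegral_eq_integral_of_forall_compl_eq_zero (s := Ω)]
      · have hz : ∀ y, ((lsmul ℝ ℝ) (ρ (x - y)) (A.indicator Df (x - (x - y)))) v
            = θ y • Df y v := by
          intro y
          rw [sub_sub_cancel]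
          by_cases hy : y ∈ A
          · simp [indicator_of_mem hy, hθ]
          · simp [hθ, hρ0 y hy]
        simp_rw [hz]
      · intro y hy
        rw [hρ0 y fun h => hy (hAΩ h)]; simp
    have s2 : ∫ t, (((lsmul ℝ ℝ).precompL E2 (fderiv ℝ ρ t)) (A.indicator f (x - t))) v =
        - ∫ y in Ω, fderiv ℝ θ y v • f y := by
      rw [← integral_sub_left_eq_self _ volume x,
        ← setIntegral_eq_integral_of_forall_compl_eq_zero (s := Ω), ← integral_neg]
      · have hz : ∀ y, (((lsmul ℝ ℝ).precompL E2 (fderiv ℝ ρ (x - y)))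
            (A.indicator f (x - (x - y)))) v = - (fderiv ℝ θ y v • f y) := by
          intro y
          rw [sub_sub_cancel, hθ', precompL_apply]
          by_cases hy : y ∈ A
          · simp [indicator_of_mem hy]
          · simp [hρ'0 y hy]
        simp_rw [hz]
      · intro y hy
        rw [precompL_apply, hρ'0 y fun h => hy (hAΩ h)]; simp
    rw [s1, s2, hweak i, neg_neg]
  ext1 w
  have hw : w = w 0 • EuclideanSpace.single 0 1 + w 1 • (EuclideanSpace.single 1 1 : E2) := by
    ext i; fin_cases i <;> simp
  rw [hw, map_add, map_add, map_smul, map_smul, map_smul, map_smul, hbasis 0, hbasis 1]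

open ContinuousLinearMap in
theorem ball_volume_le (Ω : Set E2) (hΩ : IsOpen Ω) (f : E2 → E2) (Df : E2 → E2 →L[ℝ] E2)
    (hcont : ContinuousOn f Ω) (hinj : InjOn f Ω) (hf : MemW12loc Ω f Df)
    (y₀ : E2) (r s : ℝ) (hs : 0 < s) (hsr : s < r) (hb : Metric.closedBall y₀ r ⊆ f '' Ω) :
    volume (Metric.closedBall y₀ s) ≤
      ∫⁻ x in Ω ∩ f ⁻¹' Metric.closedBall y₀ r, ENNReal.ofReal |(Df x).det| := by
  set C := Ω ∩ f ⁻¹' Metric.closedBall y₀ r with hC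
  have hCc : IsCompact C :=
    isCompact_preimage_of_injOn Ω hΩ f hcont hinj _ (isCompact_closedBall _ _) hb
  obtain ⟨δ₁, hδ₁, hδΩ⟩ := hCc.exists_cthickening_subset_open hΩ inter_subset_left
  set A := Metric.cthickening δ₁ C with hA
  have hAc : IsCompact A := hCc.cthickening
  have hAm : MeasurableSet A := hAc.measurableSet
  have hCA : C ⊆ A := Metric.self_subset_cthickening _
  obtain ⟨δ₂, hδ₂, huc⟩ := Metric.uniformContinuousOn_iff.1
    (hAc.uniformContinuousOn_of_continuous (hcont.mono hδΩ)) (r - s) (by linarith)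
  set δ := min δ₁ δ₂ with hδ
  have hδp : 0 < δ := lt_min hδ₁ hδ₂
  have hDm : Measurable Df := hf.2.1
  set u := A.indicator Df with hu
  have hum : Measurable u := hDm.indicator hAm
  set q : E2 → ℝ := fun x => ‖u x‖ ^ 2 with hq
  have hqm : Measurable q := by fun_prop
  have hfI : Integrable (A.indicator f) :=
    ((hcont.mono hδΩ).integrableOn_compact hAc).integrable_indicator hAm
  have hqfin : ∫⁻ x, ENNReal.ofReal (q x) < ⊤ := by
    have h1 := hf.2.2.1 A hδΩ hAc
    rw [← lintegral_indicator hAm] at h1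
    refine lt_of_le_of_lt (lintegral_mono fun x => ?_) h1
    by_cases hx : x ∈ A
    · simp [hq, hu, indicator_of_mem hx]
    · simp [hq, hu, indicator_of_notMem hx]
  have hqI : Integrable q := by
    refine ⟨hqm.aestronglyMeasurable, ?_⟩
    rw [hasFiniteIntegral_iff_ofReal (Filter.Eventually.of_forall fun x => by positivity)]
    exact hqfin
  have huI : Integrable u := by
    have h1 : Integrable (A.indicator (fun _ => (1 : ℝ))) :=
      (integrableOn_const (hs := hAc.measure_lt_top.ne)).integrable_indicator hAm
    refine (h1.add hqI).mono' hum.aestronglyMeasurable (Filter.Eventually.of_forall fun x => ?_)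
    by_cases hx : x ∈ A
    · simp only [Pi.add_apply, indicator_of_mem hx, hq]
      nlinarith [sq_nonneg (‖u x‖ - 1), norm_nonneg (u x)]
    · simp [hq, hu, indicator_of_notMem hx]
  -- the mollifiers
  let φ : ℕ → ContDiffBump (0 : E2) := fun n =>
    ⟨δ / (n + 2) / 2, δ / (n + 2), by positivity, half_lt_self (by positivity)⟩
  have hφδ : ∀ n, (φ n).rOut < δ := by
    intro n
    change δ / ((n : ℝ) + 2) < δ
    rw [div_lt_iff₀ (by positivity)]
    nlinarith [(Nat.cast_nonneg n : (0 : ℝ) ≤ n)]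
  have hφt : Filter.Tendsto (fun n => (φ n).rOut) Filter.atTop (𝓝 0) := by
    change Filter.Tendsto (fun n : ℕ => δ / ((n : ℝ) + 2)) Filter.atTop (𝓝 0)
    refine Filter.Tendsto.div_atTop tendsto_const_nhds ?_
    exact Filter.tendsto_atTop_add_const_right _ _ tendsto_natCast_atTop_atTop
  have hφK : ∀ᶠ n in Filter.atTop, (φ n).rOut ≤ 2 * (φ n).rIn :=
    Filter.Eventually.of_forall fun n => by
      change δ / ((n : ℝ) + 2) ≤ 2 * (δ / ((n : ℝ) + 2) / 2)
      linarith
  let fn : ℕ → E2 → E2 := fun n =>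
    convolution ((φ n).normed volume) (A.indicator f) (lsmul ℝ ℝ) volume
  let Dn : ℕ → E2 → E2 →L[ℝ] E2 := fun n =>
    convolution ((φ n).normed volume) u (lsmul ℝ ℝ) volume
  let qn : ℕ → E2 → ℝ := fun n =>
    convolution ((φ n).normed volume) q (lsmul ℝ ℝ) volume
  have hDnc : ∀ n, Continuous (Dn n) := fun n =>
    (φ n).hasCompactSupport_normed.continuous_convolution_left _ (φ n).continuous_normed
      huI.locallyIntegrable
  have hqnc : ∀ n, Continuous (qn n) := fun n =>
    (φ n).hasCompactSupport_normed.continuous_convolution_left _ (φ n).continuous_normed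
      hqI.locallyIntegrable
  have hfnc : ∀ n, Continuous (fn n) := fun n =>
    (φ n).hasCompactSupport_normed.continuous_convolution_left _ (φ n).continuous_normed
      hfI.locallyIntegrable
  have hballA : ∀ n, ∀ x ∈ C, Metric.closedBall x (φ n).rOut ⊆ A := by
    intro n x hx
    refine (Metric.closedBall_subset_cthickening hx _).trans (Metric.cthickening_mono ?_ _)
    exact (hφδ n).le.trans (min_le_left _ _)
  have hderiv : ∀ n, ∀ x ∈ C, HasFDerivAt (fn n) (Dn n x) x := fun n x hx =>
    hasFDerivAt_mollify Ω f Df hf A hAm hδΩ hfI.locallyIntegrable huI.locallyIntegrable (φ n) x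
      (hballA n x hx)
  have hclose : ∀ n, ∀ x ∈ C, dist (fn n x) (f x) ≤ r - s := by
    intro n x hx
    have := (φ n).dist_normed_convolution_le (μ := volume) (g := A.indicator f) (x₀ := x)
      (ε := r - s) hfI.aestronglyMeasurable (by
        intro y hy
        have hyA := hballA n x hx (Metric.ball_subset_closedBall hy)
        rw [indicator_of_mem hyA, indicator_of_mem (hCA hx)]
        refine (huc y hyA x (hCA hx) ?_).le
        exact lt_of_lt_of_le (Metric.mem_ball.1 hy) ((hφδ n).le.trans (min_le_right _ _)))
    rwa [indicator_of_mem (hCA hx)] at this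
  have hV : ∀ n, volume (Metric.closedBall y₀ s) ≤
      ∫⁻ x in C, ENNReal.ofReal |(Dn n x).det| := by
    intro n
    refine le_trans (measure_mono ?_) (addHaar_image_le_lintegral_abs_det_fderiv volume
      hCc.measurableSet fun x hx => (hderiv n x hx).hasFDerivWithinAt)
    have hinvC : ∀ y ∈ Metric.closedBall y₀ r, Function.invFunOn f Ω y ∈ C ∧
        f (Function.invFunOn f Ω y) = y := by
      intro y hy
      have h1 := Function.invFunOn_mem (hb hy)
      have h2 := Function.invFunOn_eq (hb hy)
      exact ⟨⟨h1, by rw [mem_preimage, h2]; exact hy⟩, h2⟩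
    have := closedBall_subset_image_of_near_id y₀ r (r - s) (by linarith)
      (fun y => fn n (Function.invFunOn f Ω y))
      ((hfnc n).comp_continuousOn ((invFunOn_continuousOn Ω hΩ f hcont hinj).mono hb))
      (by
        intro y hy
        obtain ⟨h1, h2⟩ := hinvC y hy
        have := hclose n _ h1
        rwa [h2] at this)
    rw [sub_sub_cancel] at this
    intro z hz
    obtain ⟨y, hy, rfl⟩ := this hz
    exact ⟨_, (hinvC y hy).1, rfl⟩
  have hdetc : Continuous fun T : E2 →L[ℝ] E2 => T.det := ContinuousLinearMap.continuous_det
  have hconv1 := ContDiffBump.ae_convolution_tendsto_right_of_locallyIntegrable (μ := volume)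
    hφt hφK huI.locallyIntegrable
  have hconv2 := ContDiffBump.ae_convolution_tendsto_right_of_locallyIntegrable (μ := volume)
    hφt hφK hqI.locallyIntegrable
  have main := fatou_bound (volume.restrict C)
    (fun n x => ENNReal.ofReal |(Dn n x).det|) (fun n x => ENNReal.ofReal (qn n x))
    (fun x => ENNReal.ofReal |(u x).det|) (fun x => ENNReal.ofReal (q x))
    (fun n => ∫⁻ x in Metric.cthickening (φ n).rOut C, ENNReal.ofReal (q x))
    (volume (Metric.closedBall y₀ s))
    (fun n => (ENNReal.continuous_ofReal.comp (hdetc.comp (hDnc n)).abs).measurable)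
    (fun n => (ENNReal.continuous_ofReal.comp (hqnc n)).measurable)
    ((ENNReal.continuous_ofReal.comp hdetc.abs).measurable.comp hum)
    (fun n x => ENNReal.ofReal_le_ofReal ((abs_det_le_norm_sq _).trans
      (norm_sq_convolution_le (φ n) u huI.locallyIntegrable hqI.locallyIntegrable x)))
    (fun x => ENNReal.ofReal_le_ofReal (abs_det_le_norm_sq _))
    (fun x => ENNReal.ofReal_ne_top)
    (ae_restrict_of_ae (by
      filter_upwards [hconv1] with x hx
      exact ((ENNReal.continuous_ofReal.comp hdetc.abs).tendsto (u x)).comp hx))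
    (ae_restrict_of_ae (by
      filter_upwards [hconv2] with x hx
      exact (ENNReal.continuous_ofReal.tendsto (q x)).comp hx))
    hV
    (fun n => lintegral_convolution_le (φ n) q hqm (fun x => by positivity) hqI.locallyIntegrable
      C hCc.isClosed)
    (by
      have hfinν : ∀ S, volume.withDensity (fun x => ENNReal.ofReal (q x)) S ≠ ⊤ := by
        intro S
        refine ne_top_of_le_ne_top hqfin.ne ((measure_mono (subset_univ S)).trans ?_)
        rw [withDensity_apply _ MeasurableSet.univ, Measure.restrict_univ]
      have h1 := tendsto_measure_cthickening_of_isClosed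
        (μ := volume.withDensity (fun x => ENNReal.ofReal (q x)))
        ⟨1, one_pos, hfinν _⟩ hCc.isClosed
      rw [withDensity_apply _ hCc.measurableSet] at h1
      have h2 := h1.comp hφt
      refine h2.congr fun n => ?_
      simp only [Function.comp]
      rw [withDensity_apply _ Metric.isClosed_cthickening.measurableSet])
    (ne_top_of_le_ne_top hqfin.ne (setLIntegral_le_lintegral _ _))
  refine main.trans (le_of_eq ?_)
  refine setLIntegral_congr_fun hCc.measurableSet fun x hx => ?_
  simp only [hu, indicator_of_mem (hCA hx)]


/-- Area inequality `|E| ≤ ∫_{f⁻¹ E} |det Df|` for Borel subsets of the image. -/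
theorem volume_le_lintegral_det (Ω : Set E2) (hΩ : IsOpen Ω) (f : E2 → E2)
    (Df : E2 → E2 →L[ℝ] E2)
    (hcont : ContinuousOn f Ω) (hinj : InjOn f Ω) (hf : MemW12loc Ω f Df)
    (g : E2 → E2) (hg : Measurable g) (hgf : ∀ x ∈ Ω, g x = f x)
    (μ : Measure E2)
    (hμ : μ = Measure.map g
      ((volume.restrict Ω).withDensity fun x => ENNReal.ofReal |(Df x).det|))
    (E : Set E2) (hE : MeasurableSet E) (hEΩ : E ⊆ f '' Ω) : volume E ≤ μ E := by
  have hpre : ∀ S, Ω ∩ g ⁻¹' S = Ω ∩ f ⁻¹' S := by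
    intro S
    ext x
    constructor
    · rintro ⟨h1, h2⟩; exact ⟨h1, by rwa [mem_preimage, hgf x h1] at h2⟩
    · rintro ⟨h1, h2⟩; exact ⟨h1, by rwa [mem_preimage, hgf x h1]⟩
  have hμS : ∀ S, MeasurableSet S →
      μ S = ∫⁻ x in Ω ∩ f ⁻¹' S, ENNReal.ofReal |(Df x).det| := by
    intro S hS
    rw [hμ, Measure.map_apply hg hS, withDensity_apply _ (hg hS),
      Measure.restrict_restrict (hg hS), inter_comm, hpre]
  have hV : IsOpen (f '' Ω) := image_open_of_injOn Ω hΩ f hcont hinj Ω hΩ Subset.rfl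
  -- compact sets have finite measure
  have hfin : ∀ A : Set E2, IsCompact A → A ⊆ f '' Ω → μ A ≠ ⊤ := by
    intro A hA hAΩ
    rw [hμS A hA.measurableSet]
    refine ne_top_of_le_ne_top (hf.2.2.1 _ inter_subset_left
      (isCompact_preimage_of_injOn Ω hΩ f hcont hinj A hA hAΩ)).ne ?_
    exact lintegral_mono fun x => ENNReal.ofReal_le_ofReal (abs_det_le_norm_sq _)
  -- closed balls
  have hball : ∀ y r, 0 < r → Metric.closedBall y r ⊆ f '' Ω →
      volume (Metric.closedBall y r) ≤ μ (Metric.closedBall y r) := by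
    intro y r hr hb
    rw [Measure.addHaar_closedBall_eq_addHaar_ball]
    have hun : Metric.ball y r ⊆ ⋃ n : ℕ, Metric.closedBall y (r - r / (n + 2)) := by
      intro z hz
      rw [Metric.mem_ball] at hz
      have ht : Filter.Tendsto (fun n : ℕ => r - r / ((n : ℝ) + 2)) Filter.atTop
          (𝓝 (r - 0)) := by
        refine tendsto_const_nhds.sub (Filter.Tendsto.div_atTop tendsto_const_nhds ?_)
        exact Filter.tendsto_atTop_add_const_right _ _ tendsto_natCast_atTop_atTop
      rw [sub_zero] at ht
      obtain ⟨n, hn⟩ := (ht.eventually (lt_mem_nhds hz)).exists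
      exact mem_iUnion.2 ⟨n, Metric.mem_closedBall.2 hn.le⟩
    refine (measure_mono hun).trans ?_
    rw [Monotone.measure_iUnion]
    · refine iSup_le fun n => ?_
      rw [hμS _ Metric.isClosed_closedBall.measurableSet]
      have hn : (0 : ℝ) ≤ n := Nat.cast_nonneg n
      refine ball_volume_le Ω hΩ f Df hcont hinj hf y r _ ?_ ?_ hb
      · rw [sub_pos, div_lt_iff₀ (by positivity)]; nlinarith
      · have : 0 < r / ((n : ℝ) + 2) := by positivity
        linarith
    · intro m n hmn
      refine Metric.closedBall_subset_closedBall ?_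
      have : (m : ℝ) ≤ n := by exact_mod_cast hmn
      gcongr
  -- open sets
  have hopen : ∀ U : Set E2, IsOpen U → U ⊆ f '' Ω → volume U ≤ μ U := by
    intro U hU hUΩ
    have hex : ∀ x ∈ U, ∃ R > 0, Metric.closedBall x R ⊆ U := fun x hx => by
      simpa using Metric.nhds_basis_closedBall.mem_iff.1 (hU.mem_nhds hx)
    choose! R hR hRU using hex
    obtain ⟨t, ρ, htc, htU, hρ, hcov, hdisj⟩ := Besicovitch.exists_disjoint_closedBall_covering_ae
      (volume : Measure E2) (fun _ => univ) U
      (fun x _ δ hδ => ⟨δ / 2, mem_univ _, by positivity, half_lt_self hδ⟩) R hR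
    have hsub : ∀ x ∈ t, Metric.closedBall x (ρ x) ⊆ U := fun x hx =>
      (Metric.closedBall_subset_closedBall (hρ x hx).2.2.le).trans (hRU x (htU hx))
    calc volume U ≤ volume (U \ ⋃ x ∈ t, Metric.closedBall x (ρ x)) +
          volume (⋃ x ∈ t, Metric.closedBall x (ρ x)) := by
          refine (measure_mono ?_).trans (measure_union_le _ _)
          rw [sdiff_union_self]; exact subset_union_left
      _ = volume (⋃ x ∈ t, Metric.closedBall x (ρ x)) := by rw [hcov, zero_add]
      _ ≤ ∑' x : t, volume (Metric.closedBall (x : E2) (ρ x)) := measure_biUnion_le _ htc _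
      _ ≤ ∑' x : t, μ (Metric.closedBall (x : E2) (ρ x)) :=
          ENNReal.tsum_le_tsum fun x => hball _ _ (hρ x x.2).2.1 ((hsub x x.2).trans hUΩ)
      _ = μ (⋃ x ∈ t, Metric.closedBall x (ρ x)) :=
          (measure_biUnion htc hdisj fun x _ => Metric.isClosed_closedBall.measurableSet).symm
      _ ≤ μ U := measure_mono (iUnion₂_subset hsub)
  -- compact sets
  have hcomp : ∀ A : Set E2, IsCompact A → A ⊆ f '' Ω → volume A ≤ μ A := by
    intro A hA hAΩ
    obtain ⟨δ, hδ, hδΩ⟩ := hA.exists_cthickening_subset_open hV hAΩ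
    have ht := tendsto_measure_cthickening_of_isClosed (μ := μ)
      ⟨δ, hδ, hfin _ hA.cthickening hδΩ⟩ hA.isClosed
    have ht' := ht.mono_left (nhdsWithin_le_nhds (s := Ioi 0))
    refine ge_of_tendsto ht' ?_
    filter_upwards [Ioo_mem_nhdsGT hδ] with ε hε
    calc volume A ≤ volume (Metric.thickening ε A) :=
          measure_mono (Metric.self_subset_thickening hε.1 A)
      _ ≤ μ (Metric.thickening ε A) := hopen _ Metric.isOpen_thickening
          (((Metric.thickening_subset_cthickening _ _).trans
            (Metric.cthickening_mono hε.2.le _)).trans hδΩ)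
      _ ≤ μ (Metric.cthickening ε A) := measure_mono (Metric.thickening_subset_cthickening _ _)
  rw [hE.measure_eq_iSup_isCompact]
  refine iSup₂_le fun A hA => iSup_le fun hAc => ?_
  exact (hcomp A hAc (hA.trans hEΩ)).trans (measure_mono hA)

/-- **Quantitative `L²` bound for the inverse gradient** (euclidean case of Lemma 5.1).
Here `ψ(y) = 1 / l(Df(f⁻¹ y))` (with `1/0 = ∞`), and `f⁻¹` is realized by
`Function.invFunOn f Ω`, which inverts `f` on `f(Ω)` since `f` is injective on `Ω`. -/
theorem inverse_gradient_L2_bound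
    (Ω : Set E2) (hΩopen : IsOpen Ω)
    (f : E2 → E2) (Df : E2 → E2 →L[ℝ] E2)
    (hcont : ContinuousOn f Ω) (hinj : InjOn f Ω)
    (hf : MemW12loc Ω f Df)
    (K : E2 → ℝ) (hKmeas : Measurable K) (hK1 : ∀ x, 1 ≤ K x)
    (hKloc : ∀ A : Set E2, A ⊆ Ω → IsCompact A →
      ∫⁻ x in A, ENNReal.ofReal (K x) < ⊤)
    (hdist : ∀ᵐ x ∂(volume.restrict Ω), ‖Df x‖ ≤ K x * lstretch (Df x))
    (ψ : E2 → ℝ≥0∞)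
    (hψ : ∀ y : E2, ψ y = (ENNReal.ofReal (lstretch (Df (Function.invFunOn f Ω y))))⁻¹) :
    (∀ E : Set E2, E ⊆ f '' Ω → MeasurableSet E →
      ∫⁻ y in E, (ψ y) ^ 2 ≤ 2 * ∫⁻ x in Ω ∩ f ⁻¹' E, ENNReal.ofReal (K x)) ∧
    (∀ A : Set E2, A ⊆ f '' Ω → IsCompact A →
      ∫⁻ y in A, (ψ y) ^ 2 < ⊤) := by
  classical
  have hΩm : MeasurableSet Ω := hΩopen.measurableSet
  have key : ∀ E : Set E2, E ⊆ f '' Ω → MeasurableSet E →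
      ∫⁻ y in E, (ψ y) ^ 2 ≤ ∫⁻ x in Ω ∩ f ⁻¹' E, ENNReal.ofReal (K x) := by
    intro E hEΩ hE
    set g : E2 → E2 := Ω.indicator f with hg
    have hgm : Measurable g := by
      refine measurable_of_restrict_of_restrict_compl hΩm ?_ ?_
      · have h1 : Ω.domRestrict g = Ω.domRestrict f := by
          ext1 x; exact indicator_of_mem x.2 f
        rw [h1]; exact (continuousOn_iff_continuous_domRestrict.1 hcont).measurable
      · have h1 : Ωᶜ.domRestrict g = fun _ => 0 := by
          ext1 x; exact indicator_of_notMem x.2 f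
        rw [h1]; exact measurable_const
    have hgf : ∀ x ∈ Ω, g x = f x := fun x hx => indicator_of_mem hx f
    set J : E2 → ℝ≥0∞ := fun x => ENNReal.ofReal |(Df x).det| with hJ
    have hJm : Measurable J :=
      (ENNReal.continuous_ofReal.comp
        (ContinuousLinearMap.continuous_det (𝕜 := ℝ) (E := E2)).abs).measurable.comp hf.2.1
    set μ := Measure.map g ((volume.restrict Ω).withDensity J) with hμ
    have hle : volume.restrict E ≤ μ.restrict E := by
      refine Measure.le_iff.2 fun S hS => ?_
      rw [Measure.restrict_apply hS, Measure.restrict_apply hS]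
      exact volume_le_lintegral_det Ω hΩopen f Df hcont hinj hf g hgm hgf μ hμ _ (hS.inter hE)
        (inter_subset_right.trans hEΩ)
    have hpre : Ω ∩ g ⁻¹' E = Ω ∩ f ⁻¹' E := by
      ext x
      constructor
      · rintro ⟨h1, h2⟩; exact ⟨h1, by rwa [mem_preimage, hgf x h1] at h2⟩
      · rintro ⟨h1, h2⟩; exact ⟨h1, by rwa [mem_preimage, hgf x h1]⟩
    have hm : MeasurableSet (Ω ∩ f ⁻¹' E) := hpre ▸ hΩm.inter (hgm hE)
    calc ∫⁻ y in E, (ψ y) ^ 2 ≤ ∫⁻ y in E, (ψ y) ^ 2 ∂μ := lintegral_mono' hle le_rfl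
      _ = ∫⁻ y, E.indicator (fun y => (ψ y) ^ 2) y ∂μ := (lintegral_indicator hE _).symm
      _ ≤ ∫⁻ x, E.indicator (fun y => (ψ y) ^ 2) (g x) ∂((volume.restrict Ω).withDensity J) :=
          lintegral_map_le _ _
      _ ≤ ∫⁻ x in Ω, (J * fun x => E.indicator (fun y => (ψ y) ^ 2) (g x)) x :=
          lintegral_withDensity_le_lintegral_mul _ hJm _
      _ ≤ ∫⁻ x in Ω, (f ⁻¹' E).indicator (fun x => ENNReal.ofReal (K x)) x := by
          refine lintegral_mono_ae ?_
          filter_upwards [hdist, ae_restrict_mem hΩm] with x hx hxΩ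
          simp only [Pi.mul_apply, hgf x hxΩ]
          by_cases hxE : f x ∈ E
          · rw [indicator_of_mem hxE, indicator_of_mem (show x ∈ f ⁻¹' E from hxE), hψ,
              hinj.leftInvOn_invFunOn hxΩ]
            exact det_mul_inv_sq_le _ _ hx
          · rw [indicator_of_notMem hxE, mul_zero]
            exact zero_le
      _ = ∫⁻ x, (Ω ∩ f ⁻¹' E).indicator (fun x => ENNReal.ofReal (K x)) x := by
          rw [← lintegral_indicator hΩm, indicator_indicator]
      _ = ∫⁻ x in Ω ∩ f ⁻¹' E, ENNReal.ofReal (K x) := lintegral_indicator hm _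
  constructor
  · intro E hEΩ hE
    refine (key E hEΩ hE).trans ?_
    rw [two_mul]
    exact le_self_add
  · intro A hAΩ hA
    exact lt_of_le_of_lt (key A hAΩ hA.measurableSet) (hKloc _ inter_subset_left
      (isCompact_preimage_of_injOn Ω hΩopen f hcont hinj A hA hAΩ))
end
end
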